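/- Let G be a finite p-group for a prime p acting (algebraically) on a quasi-projective complex variety X. If p does not divide the topological Euler characteristic χ(X), then the fixed point set X^G is non-empty. -/

import Mathlib

open CategoryTheory

/-- The singular chain complex with rational coefficients of a topological space. -/
noncomputable def singularChainComplex (X : Type) [TopologicalSpace X] :
    ChainComplex (ModuleCat ℚ) ℕ :=
  (AlgebraicTopology.alternatingFaceMapComplex (ModuleCat ℚ)).obj
    (((CategoryTheory.SimplicialObject.whiskering _ _).obj (ModuleCat.free ℚ)).obj
      (TopCat.toSSet.obj (TopCat.of X)))

/-- Singular homology with rational coefficients. -/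
noncomputable def singularHomology (X : Type) [TopologicalSpace X] (i : ℕ) : ModuleCat ℚ :=
  (singularChainComplex X).homology i

/-- Singular cohomology with rational coefficients (over the field ℚ it is the
dual of singular homology, by universal coefficients). -/
noncomputable def singularCohomology (X : Type) [TopologicalSpace X] (i : ℕ) : ModuleCat ℚ :=
  ModuleCat.of ℚ (Module.Dual ℚ (singularHomology X i))

/-- Topological Euler characteristic. -/
noncomputable def eulerChar (X : Type) [TopologicalSpace X] : ℤ :=
  ∑ᶠ i : ℕ, (-1 : ℤ) ^ i * (Module.finrank ℚ (singularHomology X i) : ℤ)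

/-- `N`-dimensional complex projective space, with its quotient (Euclidean) topology. -/
abbrev PP (N : ℕ) := Projectivization ℂ (Fin (N + 1) → ℂ)

noncomputable instance (N : ℕ) : TopologicalSpace (PP N) :=
  inferInstanceAs (TopologicalSpace (Quotient (projectivizationSetoid ℂ (Fin (N + 1) → ℂ))))

/-- Zariski-closed subsets of projective space: common zero sets of families of
homogeneous polynomials. -/
def ZarClosed {N : ℕ} (C : Set (PP N)) : Prop :=
  ∃ S : Set (MvPolynomial (Fin (N + 1)) ℂ),
    (∀ f ∈ S, ∃ d, f.IsHomogeneous d) ∧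
    C = {x : PP N | ∀ f ∈ S, MvPolynomial.eval x.rep f = 0}

/-- A quasi-projective algebraic set: a Zariski-locally closed subset of ℙ^N. -/
def IsQuasiProjective {N : ℕ} (V : Set (PP N)) : Prop :=
  ∃ C D : Set (PP N), ZarClosed C ∧ ZarClosed D ∧ V = C \ D


/-- The action of `g` on the quasi-projective set `V` is algebraic: it is given by a
tuple of homogeneous polynomials of a common degree. -/
def IsAlgebraicAction {N : ℕ} (V : Set (PP N)) {G : Type} [Group G] [MulAction G ↥V]
    (g : G) : Prop :=
  ∃ (d : ℕ) (A : Fin (N + 1) → MvPolynomial (Fin (N + 1)) ℂ),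
    (∀ j, (A j).IsHomogeneous d) ∧
    ∀ x : ↥V, ∃ hne : (fun j => MvPolynomial.eval (x : PP N).rep (A j)) ≠ 0,
      ((g • x : ↥V) : PP N) = Projectivization.mk ℂ _ hne

/-! ### Affine simplices and barycentric subdivision -/

/-- Rational chains on `k`-tuples of elements of `E`. -/
abbrev TupleChain (E : Type) (k : ℕ) := (Fin k → E) →₀ ℚ

namespace TupleChain

variable {E F : Type}

/-- The map induced on chains of tuples. -/
noncomputable def map (f : E → F) (k : ℕ) : TupleChain E k →ₗ[ℚ] TupleChain F k :=
  Finsupp.lmapDomain ℚ ℚ (fun v => f ∘ v)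

@[simp] lemma map_single (f : E → F) {k : ℕ} (v : Fin k → E) (a : ℚ) :
    map f k (Finsupp.single v a) = Finsupp.single (f ∘ v) a := by
  simp [map]

lemma hom_ext {k : ℕ} {M : Type*} [AddCommGroup M] [Module ℚ M]
    {f g : TupleChain E k →ₗ[ℚ] M}
    (h : ∀ v, f (Finsupp.single v 1) = g (Finsupp.single v 1)) : f = g :=
  Finsupp.lhom_ext' fun v => LinearMap.ext_ring (h v)

/-- The alternating boundary, on chains of tuples (augmented in length zero). -/
noncomputable def bd (k : ℕ) : TupleChain E (k + 1) →ₗ[ℚ] TupleChain E k :=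
  ∑ i : Fin (k + 1), ((-1 : ℚ) ^ (i : ℕ)) • Finsupp.lmapDomain ℚ ℚ (fun v => v ∘ i.succAbove)

lemma bd_single {k : ℕ} (v : Fin (k + 1) → E) (a : ℚ) :
    bd k (Finsupp.single v a) =
      ∑ i : Fin (k + 1), ((-1 : ℚ) ^ (i : ℕ)) • Finsupp.single (v ∘ i.succAbove) a := by
  simp [bd]

/-- The cone with apex `b`. -/
noncomputable def cone (b : E) (k : ℕ) : TupleChain E k →ₗ[ℚ] TupleChain E (k + 1) :=
  Finsupp.lmapDomain ℚ ℚ (fun v => Fin.cons b v)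

@[simp] lemma cone_single (b : E) {k : ℕ} (v : Fin k → E) (a : ℚ) :
    cone b k (Finsupp.single v a) = Finsupp.single (Fin.cons b v : Fin (k + 1) → E) a := by
  simp [cone]

lemma cons_comp_succAbove (b : E) {k : ℕ} (v : Fin (k + 1) → E) (j : Fin (k + 1)) :
    (Fin.cons b v : Fin (k + 2) → E) ∘ j.succ.succAbove
      = (Fin.cons b (v ∘ j.succAbove) : Fin (k + 1) → E) := by
  funext i
  refine Fin.cases ?_ (fun i => ?_) i <;> simp

lemma bd_cone_zero (b : E) (x : TupleChain E 0) : bd 0 (cone b 0 x) = x := by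
  have : (bd 0 ∘ₗ cone b 0 : TupleChain E 0 →ₗ[ℚ] _) = LinearMap.id := by
    refine hom_ext fun v => ?_
    simp only [LinearMap.comp_apply, cone_single, bd_single, LinearMap.id_apply]
    rw [Fin.sum_univ_succ, Fin.sum_univ_zero, add_zero, Fin.val_zero, pow_zero, one_smul]
    congr 1
  exact LinearMap.congr_fun this x

lemma bd_cone (b : E) {k : ℕ} (x : TupleChain E (k + 1)) :
    bd (k + 1) (cone b (k + 1) x) = x - cone b k (bd k x) := by
  have : (bd (k + 1) ∘ₗ cone b (k + 1) : TupleChain E (k + 1) →ₗ[ℚ] _)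
      = LinearMap.id - cone b k ∘ₗ bd k := by
    refine hom_ext fun v => ?_
    simp only [LinearMap.comp_apply, cone_single, bd_single, LinearMap.id_apply,
      LinearMap.sub_apply, map_sum, map_smul]
    rw [Fin.sum_univ_succ]
    simp only [Fin.val_zero, pow_zero, one_smul, Fin.val_succ, pow_succ, cons_comp_succAbove,
      mul_neg, mul_one, neg_smul, Finset.sum_neg_distrib, ← sub_eq_add_neg]
    congr 1
  exact LinearMap.congr_fun this x

lemma bd_bd {k : ℕ} (x : TupleChain E (k + 2)) : bd k (bd (k + 1) x) = 0 := by
  induction k with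
  | zero =>
    have : (bd 0 ∘ₗ bd 1 : TupleChain E 2 →ₗ[ℚ] _) = 0 := by
      refine hom_ext fun v => ?_
      have hv : Finsupp.single v (1 : ℚ)
          = cone (v 0) 1 (Finsupp.single (Fin.tail v) 1) := by simp
      rw [LinearMap.comp_apply, hv, bd_cone, map_sub, bd_cone_zero, sub_self]
      rfl
    exact LinearMap.congr_fun this x
  | succ k ih =>
    have : (bd (k + 1) ∘ₗ bd (k + 2) : TupleChain E (k + 3) →ₗ[ℚ] _) = 0 := by
      refine hom_ext fun v => ?_
      have hv : Finsupp.single v (1 : ℚ)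
          = cone (v 0) (k + 2) (Finsupp.single (Fin.tail v) 1) := by simp
      rw [LinearMap.comp_apply, hv, bd_cone, map_sub, bd_cone, ih, map_zero, sub_zero, sub_self]
      rfl
    exact LinearMap.congr_fun this x

lemma map_bd (f : E → F) {k : ℕ} (x : TupleChain E (k + 1)) :
    map f k (bd k x) = bd k (map f (k + 1) x) := by
  have : (map f k ∘ₗ bd k : TupleChain E (k + 1) →ₗ[ℚ] _) = bd k ∘ₗ map f (k + 1) := by
    refine hom_ext fun v => ?_
    simp only [LinearMap.comp_apply, bd_single, map_single, map_sum, map_smul]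
    rfl
  exact LinearMap.congr_fun this x

lemma map_cone (f : E → F) (b : E) {k : ℕ} (x : TupleChain E k) :
    map f (k + 1) (cone b k x) = cone (f b) k (map f k x) := by
  have : (map f (k + 1) ∘ₗ cone b k : TupleChain E k →ₗ[ℚ] _) = cone (f b) k ∘ₗ map f k := by
    refine hom_ext fun v => ?_
    simp only [LinearMap.comp_apply, cone_single, map_single]
    congr 1
    funext i
    refine Fin.cases ?_ (fun i => ?_) i <;> simp
  exact LinearMap.congr_fun this x

variable (bary : ∀ k, (Fin (k + 1) → E) → E)

/-- Subdivision with respect to a choice of apex for each tuple. -/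
noncomputable def sd : ∀ k, TupleChain E k →ₗ[ℚ] TupleChain E k
  | 0 => LinearMap.id
  | k + 1 => Finsupp.linearCombination ℚ
      (fun v => cone (bary k v) k (sd k (bd k (Finsupp.single v 1))))

/-- The chain homotopy between subdivision and the identity. -/
noncomputable def htpy : ∀ k, TupleChain E k →ₗ[ℚ] TupleChain E (k + 1)
  | 0 => 0
  | k + 1 => Finsupp.linearCombination ℚ
      (fun v => cone (bary k v) (k + 1)
        (Finsupp.single v 1 - htpy k (bd k (Finsupp.single v 1))))

lemma sd_single {k : ℕ} (v : Fin (k + 1) → E) :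
    sd bary (k + 1) (Finsupp.single v 1)
      = cone (bary k v) k (sd bary k (bd k (Finsupp.single v 1))) := by
  simp [sd]

lemma htpy_single {k : ℕ} (v : Fin (k + 1) → E) :
    htpy bary (k + 1) (Finsupp.single v 1) = cone (bary k v) (k + 1)
      (Finsupp.single v 1 - htpy bary k (bd k (Finsupp.single v 1))) := by
  simp [htpy]

lemma bd_htpy {k : ℕ} (x : TupleChain E (k + 1)) :
    bd (k + 1) (htpy bary (k + 1) x) = x - sd bary (k + 1) x - htpy bary k (bd k x) := by
  induction k with
  | zero =>
    have : (bd 1 ∘ₗ htpy bary 1 : TupleChain E 1 →ₗ[ℚ] _)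
        = LinearMap.id - sd bary 1 - htpy bary 0 ∘ₗ bd 0 := by
      refine hom_ext fun v => ?_
      simp only [LinearMap.comp_apply, LinearMap.sub_apply, LinearMap.id_apply]
      rw [htpy_single, bd_cone, sd_single]
      simp [htpy, sd]
    exact LinearMap.congr_fun this x
  | succ k ih =>
    have : (bd (k + 2) ∘ₗ htpy bary (k + 2) : TupleChain E (k + 2) →ₗ[ℚ] _)
        = LinearMap.id - sd bary (k + 2) - htpy bary (k + 1) ∘ₗ bd (k + 1) := by
      refine hom_ext fun v => ?_
      simp only [LinearMap.comp_apply, LinearMap.sub_apply, LinearMap.id_apply]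
      rw [htpy_single, bd_cone, sd_single, map_sub (bd (k + 1)), ih, bd_bd]
      simp only [map_zero, sub_zero, sub_sub_cancel]
      abel
    exact LinearMap.congr_fun this x

section naturality

variable {bary} {bary' : ∀ k, (Fin (k + 1) → F) → F} {f : E → F}
  (hf : ∀ k v, f (bary k v) = bary' k (f ∘ v))
include hf

lemma map_sd {k : ℕ} (x : TupleChain E k) :
    map f k (sd bary k x) = sd bary' k (map f k x) := by
  induction k with
  | zero => rfl
  | succ k ih =>
    have : (map f (k + 1) ∘ₗ sd bary (k + 1) : TupleChain E (k + 1) →ₗ[ℚ] _)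
        = sd bary' (k + 1) ∘ₗ map f (k + 1) := by
      refine hom_ext fun v => ?_
      simp only [LinearMap.comp_apply, map_single]
      rw [sd_single, sd_single, map_cone, ih, map_bd, hf, map_single]
    exact LinearMap.congr_fun this x

lemma map_htpy {k : ℕ} (x : TupleChain E k) :
    map f (k + 1) (htpy bary k x) = htpy bary' k (map f k x) := by
  induction k with
  | zero => simp [htpy]
  | succ k ih =>
    have : (map f (k + 2) ∘ₗ htpy bary (k + 1) : TupleChain E (k + 1) →ₗ[ℚ] _)
        = htpy bary' (k + 1) ∘ₗ map f (k + 1) := by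
      refine hom_ext fun v => ?_
      simp only [LinearMap.comp_apply, map_single]
      rw [htpy_single, htpy_single, map_cone, map_sub, ih, map_bd, hf, map_single]
    exact LinearMap.congr_fun this x

end naturality

end TupleChain

/-! ### Affine maps between standard simplices -/

/-- The standard topological `m`-simplex. -/
abbrev Splx (m : ℕ) := stdSimplex ℝ (Fin (m + 1))

namespace Splx

/-- The affine map with prescribed values at the vertices. -/
noncomputable def aff {n m : ℕ} (w : Fin (n + 1) → Splx m) : C(Splx n, Splx m) where
  toFun t := ⟨∑ i, t i • (w i : Fin (m + 1) → ℝ),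
    (convex_stdSimplex ℝ _).sum_mem (fun i _ => t.2.1 i) t.2.2 (fun i _ => (w i).2)⟩
  continuous_toFun := by
    refine Continuous.subtype_mk (continuous_finsetSum _ fun i _ => ?_) _
    exact ((continuous_apply i).comp continuous_subtype_val).smul continuous_const

lemma aff_coe {n m : ℕ} (w : Fin (n + 1) → Splx m) (t : Splx n) :
    (aff w t : Fin (m + 1) → ℝ) = ∑ i, t i • (w i : Fin (m + 1) → ℝ) := rfl

lemma aff_apply {n m : ℕ} (w : Fin (n + 1) → Splx m) (t : Splx n) (j : Fin (m + 1)) :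
    aff w t j = ∑ i, t i * w i j := by
  have := congrFun (aff_coe w t) j
  simpa using this

lemma aff_comp {l n m : ℕ} (w : Fin (n + 1) → Splx m) (v : Fin (l + 1) → Splx n) :
    (aff w).comp (aff v) = aff (aff w ∘ v) := by
  ext t : 1
  refine stdSimplex.ext ?_
  funext j
  simp only [ContinuousMap.comp_apply, aff_apply, Function.comp_apply, Finset.sum_mul,
    Finset.mul_sum]
  rw [Finset.sum_comm]
  simp only [mul_assoc]

@[simp] lemma aff_vertex {n m : ℕ} (w : Fin (n + 1) → Splx m) (i : Fin (n + 1)) :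
    aff w (stdSimplex.vertex i) = w i := by
  refine stdSimplex.ext ?_
  funext j
  rw [aff_apply]
  simp [Pi.single_apply]

lemma aff_comp_vertex {n m : ℕ} (w : Fin (n + 1) → Splx m) :
    aff w ∘ stdSimplex.vertex = w := by
  funext i
  simp

lemma aff_vertex_eq_id (n : ℕ) :
    aff (stdSimplex.vertex : Fin (n + 1) → Splx n) = ContinuousMap.id _ := by
  ext t : 1
  refine stdSimplex.ext ?_
  funext j
  rw [aff_apply]
  simp [Pi.single_apply]

/-- The `i`-th face inclusion. -/
noncomputable def face {n : ℕ} (i : Fin (n + 2)) : C(Splx n, Splx (n + 1)) :=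
  ⟨stdSimplex.map i.succAbove, stdSimplex.continuous_map _⟩

lemma face_eq_aff {n : ℕ} (i : Fin (n + 2)) :
    face i = aff (stdSimplex.vertex ∘ i.succAbove : Fin (n + 1) → Splx (n + 1)) := by
  ext t : 1
  refine stdSimplex.ext ?_
  funext j
  rw [aff_apply]
  simp only [face, ContinuousMap.coe_mk, stdSimplex.map_coe, FunOnFinite.linearMap_apply_apply]
  simp [Pi.single_apply, Finset.sum_ite, eq_comm]

lemma aff_comp_face {n m : ℕ} (w : Fin (n + 2) → Splx m) (i : Fin (n + 2)) :
    (aff w).comp (face i) = aff (w ∘ i.succAbove) := by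
  rw [face_eq_aff, aff_comp, ← Function.comp_assoc, aff_comp_vertex]

/-- The barycentre of a tuple of points of a simplex. -/
noncomputable def bary (m k : ℕ) (v : Fin (k + 1) → Splx m) : Splx m :=
  aff v stdSimplex.barycenter

lemma aff_bary {n m : ℕ} (w : Fin (n + 1) → Splx m) (k : ℕ) (v : Fin (k + 1) → Splx n) :
    aff w (bary n k v) = bary m k (aff w ∘ v) := by
  rw [bary, bary, ← aff_comp]
  rfl

lemma dist_aff_le {n m : ℕ} (w : Fin (n + 1) → Splx m) (t : Splx n) (x : Splx m) {D : ℝ}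
    (h : ∀ j, dist (w j) x ≤ D) : dist (aff w t) x ≤ D := by
  have := (convex_closedBall (x : Fin (m + 1) → ℝ) D).sum_mem
    (fun i _ => t.2.1 i) t.2.2 (t := Finset.univ) (z := fun i => (w i : Fin (m + 1) → ℝ))
    (fun i _ => h i)
  exact this

lemma dist_bary_le {m k : ℕ} (v : Fin (k + 1) → Splx m) {D : ℝ}
    (h : ∀ i j, dist (v i) (v j) ≤ D) (j : Fin (k + 1)) :
    dist (bary m k v) (v j) ≤ (k : ℝ) / (k + 1) * D := by
  have hk : (0 : ℝ) < k + 1 := by positivity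
  have e : ((bary m k v : Splx m) : Fin (m + 1) → ℝ) - (v j : Fin (m + 1) → ℝ)
      = ∑ i, ((k : ℝ) + 1)⁻¹ • ((v i : Fin (m + 1) → ℝ) - v j) := by
    rw [← Finset.smul_sum, Finset.sum_sub_distrib, smul_sub, bary, aff_coe, Finset.smul_sum]
    congr 1
    · refine Finset.sum_congr rfl fun i _ => ?_
      congr 1
      have : (stdSimplex.barycenter : Splx k) i = _ := stdSimplex.barycenter_apply (𝕜 := ℝ) i
      rw [this]; simp
    · simp only [Finset.sum_const, Finset.card_univ, Fintype.card_fin]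
      rw [← Nat.cast_smul_eq_nsmul ℝ, smul_smul, Nat.cast_add, Nat.cast_one,
        inv_mul_cancel₀ hk.ne', one_smul]
  rw [Subtype.dist_eq, dist_eq_norm]
  refine (congrArg norm e).trans_le ?_
  refine (norm_sum_le _ _).trans ?_
  rw [← Finset.add_sum_erase _ _ (Finset.mem_univ j), sub_self, smul_zero, norm_zero, zero_add]
  refine (Finset.sum_le_card_nsmul _ _ (((k : ℝ) + 1)⁻¹ * D) fun i _ => ?_).trans ?_
  · rw [norm_smul, Real.norm_of_nonneg (by positivity), ← dist_eq_norm]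
    exact mul_le_mul_of_nonneg_left (h i j) (by positivity)
  · rw [Finset.card_erase_of_mem (Finset.mem_univ j), Finset.card_univ, Fintype.card_fin,
      Nat.add_sub_cancel, nsmul_eq_mul]
    apply le_of_eq; ring

/-- Chains on tuples inside the set `S`, with entries at mutual distance at most `D`. -/
def fine {m : ℕ} (S : Set (Splx m)) (D : ℝ) (k : ℕ) :
    Submodule ℚ (TupleChain (Splx m) k) :=
  Finsupp.supported ℚ ℚ {v | (∀ i, v i ∈ S) ∧ ∀ i j, dist (v i) (v j) ≤ D}

end Splx


lemma Finsupp.linearCombination_mem_of_supported {α : Type*} {M : Type*} [AddCommGroup M]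
    [Module ℚ M] {s : Set α} {f : α → M} {P : Submodule ℚ M} (h : ∀ a ∈ s, f a ∈ P)
    {x : α →₀ ℚ} (hx : x ∈ Finsupp.supported ℚ ℚ s) :
    Finsupp.linearCombination ℚ f x ∈ P := by
  rw [Finsupp.linearCombination_apply]
  exact Submodule.sum_mem _ fun a ha => P.smul_mem _ (h a (hx ha))

lemma LinearMap.mem_of_supported {α : Type*} {M : Type*} [AddCommGroup M]
    [Module ℚ M] {s : Set α} {f : (α →₀ ℚ) →ₗ[ℚ] M} {P : Submodule ℚ M}
    (h : ∀ a ∈ s, f (Finsupp.single a 1) ∈ P)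
    {x : α →₀ ℚ} (hx : x ∈ Finsupp.supported ℚ ℚ s) : f x ∈ P := by
  have : f = Finsupp.linearCombination ℚ (fun a => f (Finsupp.single a 1)) := by
    refine Finsupp.lhom_ext' fun a => LinearMap.ext_ring ?_
    simp
  rw [this]
  exact Finsupp.linearCombination_mem_of_supported h hx

namespace Splx

variable {m : ℕ}

lemma range_aff_comp {n k : ℕ} (v : Fin (k + 1) → Splx m) (f : Fin (n + 1) → Fin (k + 1)) :
    Set.range (aff (v ∘ f)) ⊆ Set.range (aff v) := by
  rintro _ ⟨t, rfl⟩
  refine ⟨aff (stdSimplex.vertex ∘ f) t, ?_⟩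
  rw [← ContinuousMap.comp_apply, aff_comp, ← Function.comp_assoc, aff_comp_vertex]

lemma sd_single_mem_fine {D : ℝ} (hD : 0 ≤ D) : ∀ {k : ℕ} (v : Fin (k + 1) → Splx m),
    (∀ i j, dist (v i) (v j) ≤ D) →
    TupleChain.sd (bary m) (k + 1) (Finsupp.single v 1)
      ∈ fine (Set.range (aff v)) ((k : ℝ) / (k + 1) * D) (k + 1) := by
  intro k
  induction k with
  | zero =>
    intro v hv
    rw [TupleChain.sd_single]
    simp only [TupleChain.sd, TupleChain.bd_single, Fin.sum_univ_succ, Fin.sum_univ_zero]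
    simp only [Fin.val_zero, pow_zero, one_smul, add_zero, LinearMap.id_apply,
      TupleChain.cone_single]
    refine Finsupp.single_mem_supported ℚ _ ⟨fun i => ?_, fun i j => ?_⟩
    · rw [Fin.fin_one_eq_zero i]
      exact ⟨_, rfl⟩
    · rw [Fin.fin_one_eq_zero i, Fin.fin_one_eq_zero j]; simp
  | succ k ih =>
    intro v hv
    rw [TupleChain.sd_single, TupleChain.bd_single, map_sum, map_sum]
    refine Submodule.sum_mem _ fun i _ => ?_
    rw [map_smul, map_smul]
    refine Submodule.smul_mem _ _ ?_
    refine LinearMap.mem_of_supported (fun w hw => ?_) (ih (v ∘ i.succAbove) fun a b => hv _ _)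
    obtain ⟨hw1, hw2⟩ := hw
    have hw1' : ∀ a, w a ∈ Set.range (aff v) := fun a => range_aff_comp v _ (hw1 a)
    have hle : (k : ℝ) / (k + 1) * D ≤ ((k + 1 : ℕ) : ℝ) / ((k + 1 : ℕ) + 1) * D := by
      refine mul_le_mul_of_nonneg_right ?_ hD
      rw [div_le_div_iff₀ (by positivity) (by positivity)]
      push_cast; nlinarith
    have hb : ∀ a, dist (bary m (k + 1) v) (w a) ≤ ((k + 1 : ℕ) : ℝ) / ((k + 1 : ℕ) + 1) * D := by
      intro a
      obtain ⟨t, ht⟩ := hw1' a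
      rw [← ht, dist_comm]
      exact dist_aff_le _ _ _ fun j => by rw [dist_comm]; exact dist_bary_le v hv j
    rw [TupleChain.cone_single]
    refine Finsupp.single_mem_supported ℚ _ ⟨fun a => ?_, fun a b => ?_⟩
    · refine Fin.cases ?_ (fun a => ?_) a
      · exact ⟨_, rfl⟩
      · simpa using hw1' a
    · refine Fin.cases ?_ (fun a => ?_) a <;> refine Fin.cases ?_ (fun b => ?_) b
      · simp only [Fin.cons_zero, dist_self]; positivity
      · simpa using hb b
      · simpa [dist_comm] using hb a
      · simpa using (hw2 a b).trans hle

/-- The iterated subdivision of the standard simplex. -/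
noncomputable def sdIter (m r : ℕ) : TupleChain (Splx m) (m + 1) :=
  (TupleChain.sd (bary m) (m + 1))^[r] (Finsupp.single stdSimplex.vertex 1)

lemma sdIter_mem_fine (m r : ℕ) :
    sdIter m r ∈ fine Set.univ (((m : ℝ) / (m + 1)) ^ r) (m + 1) := by
  induction r with
  | zero =>
    refine Finsupp.single_mem_supported ℚ _ ⟨fun i => trivial, fun i j => ?_⟩
    rw [pow_zero, Subtype.dist_eq]
    have := diam_stdSimplex_le (ι := Fin (m + 1))
    exact (Metric.dist_le_diam_of_mem (bounded_stdSimplex _) (Subtype.mem _) (Subtype.mem _)).trans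
      this
  | succ r ih =>
    rw [sdIter, Function.iterate_succ_apply']
    refine LinearMap.mem_of_supported (fun v hv => ?_) ih
    have := sd_single_mem_fine (D := ((m : ℝ) / (m + 1)) ^ r) (by positivity) v hv.2
    refine Finsupp.supported_mono ?_ this
    rintro w ⟨-, h⟩
    exact ⟨fun _ => trivial, fun i j => by rw [pow_succ']; exact h i j⟩

end Splx

/-! ### Euler characteristics of chain complexes -/

lemma Int.alternating_sum_of_telescoping {a x : ℕ → ℤ} (h0 : a 0 = 0)
    (h : ∀ i, x i = a (i + 1) + a i) (N : ℕ) :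
    ∑ i ∈ Finset.range N, (-1 : ℤ) ^ i * x i = -(-1) ^ N * a N := by
  induction N with
  | zero => simp [h0]
  | succ N ih => rw [Finset.sum_range_succ, ih, h]; ring

namespace ChainComplex

/-- A complex of rational vector spaces with finite dimensional total homology. -/
def FinHom (K : ChainComplex (ModuleCat ℚ) ℕ) : Prop :=
  (∀ i, Module.Finite ℚ (K.homology i)) ∧ ∃ N, ∀ i ≥ N, Subsingleton (K.homology i)

/-- The Euler characteristic of a complex of rational vector spaces. -/
noncomputable def euler (K : ChainComplex (ModuleCat ℚ) ℕ) : ℤ :=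
  ∑ᶠ i : ℕ, (-1 : ℤ) ^ i * (Module.finrank ℚ (K.homology i) : ℤ)

lemma euler_eq_sum {K : ChainComplex (ModuleCat ℚ) ℕ} {N : ℕ}
    (h : ∀ i ≥ N, Subsingleton (K.homology i)) :
    euler K = ∑ i ∈ Finset.range N, (-1 : ℤ) ^ i * (Module.finrank ℚ (K.homology i) : ℤ) := by
  refine finsum_eq_sum_of_support_subset _ fun i hi => ?_
  by_contra hc
  simp only [Finset.coe_range, Set.mem_Iio, not_lt] at hc
  have := h i hc
  exact hi (by simp [Module.finrank_zero_of_subsingleton])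

variable {K L : ChainComplex (ModuleCat ℚ) ℕ}

lemma euler_congr (e : K ≅ L) : euler K = euler L := by
  refine finsum_congr fun i => ?_
  rw [LinearEquiv.finrank_eq (HomologicalComplex.homologyMapIso e i).toLinearEquiv]

lemma FinHom.of_homology_iso (e : ∀ i, K.homology i ≅ L.homology i) (h : FinHom K) :
    FinHom L := by
  refine ⟨fun i => ?_, ?_⟩
  · have := h.1 i
    exact Module.Finite.equiv (e i).toLinearEquiv
  · obtain ⟨N, hN⟩ := h.2
    refine ⟨N, fun i hi => ?_⟩
    have := hN i hi
    exact (e i).toLinearEquiv.symm.injective.subsingleton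

lemma FinHom.of_iso (e : K ≅ L) (h : FinHom K) : FinHom L :=
  h.of_homology_iso fun i => HomologicalComplex.homologyMapIso e i

/-- The map induced on homology, as a linear map. -/
noncomputable abbrev hmap (f : K ⟶ L) (i : ℕ) : K.homology i →ₗ[ℚ] L.homology i :=
  (HomologicalComplex.homologyMap f i).hom

section exact

variable {S : ShortComplex (ChainComplex (ModuleCat ℚ) ℕ)} (hS : S.ShortExact)

/-- The connecting map, as a linear map. -/
noncomputable abbrev connecting (i : ℕ) : S.X₃.homology (i + 1) →ₗ[ℚ] S.X₁.homology i :=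
  (hS.δ (i + 1) i (by simp)).hom

include hS

lemma range_f_eq_ker_g (i : ℕ) : LinearMap.range (hmap S.f i) = LinearMap.ker (hmap S.g i) :=
  (hS.homology_exact₂ i).moduleCat_range_eq_ker

lemma range_δ_eq_ker_f (i : ℕ) : LinearMap.range (connecting hS i) = LinearMap.ker (hmap S.f i) :=
  (hS.homology_exact₁ (i + 1) i (by simp)).moduleCat_range_eq_ker

lemma range_g_eq_ker_δ (i : ℕ) :
    LinearMap.range (hmap S.g (i + 1)) = LinearMap.ker (connecting hS i) :=
  (hS.homology_exact₃ (i + 1) i (by simp)).moduleCat_range_eq_ker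

lemma range_g_zero : LinearMap.range (hmap S.g 0) = ⊤ := by
  have := hS.epi_g
  have : Epi (HomologicalComplex.homologyMap S.g 0) :=
    HomologicalComplex.epi_homologyMap_of_epi_of_not_rel _ _ (by simp)
  rw [LinearMap.range_eq_top]
  exact (ModuleCat.epi_iff_surjective _).1 this

lemma finHom_middle (h₁ : FinHom S.X₁) (h₃ : FinHom S.X₃) : FinHom S.X₂ := by
  refine ⟨fun i => ?_, ?_⟩
  · have := h₁.1 i
    have := h₃.1 i
    have := isNoetherian_of_range_eq_ker _ _ (range_f_eq_ker_g hS i)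
    infer_instance
  · obtain ⟨N, hN⟩ := h₁.2
    obtain ⟨M, hM⟩ := h₃.2
    refine ⟨max N M, fun i hi => ?_⟩
    have := hN i (le_trans (le_max_left _ _) hi)
    have := hM i (le_trans (le_max_right _ _) hi)
    rw [← not_nontrivial_iff_subsingleton]
    intro hn
    obtain ⟨x, hx⟩ := exists_ne (0 : S.X₂.homology i)
    have : x ∈ LinearMap.ker (hmap S.g i) := Subsingleton.elim _ _
    rw [← range_f_eq_ker_g hS] at this
    obtain ⟨y, rfl⟩ := this
    exact hx (by rw [Subsingleton.elim y 0, map_zero])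

lemma finHom_right (h₁ : FinHom S.X₁) (h₂ : FinHom S.X₂) : FinHom S.X₃ := by
  have key : ∀ i, LinearMap.range (hmap S.g (i + 1)) = LinearMap.ker (connecting hS i) :=
    range_g_eq_ker_δ hS
  refine ⟨fun i => ?_, ?_⟩
  · have := h₂.1 i
    cases i with
    | zero => exact Module.Finite.of_surjective _ (LinearMap.range_eq_top.1 (range_g_zero hS))
    | succ i =>
      have := h₁.1 i
      have := isNoetherian_of_range_eq_ker _ _ (key i)
      infer_instance
  · obtain ⟨N, hN⟩ := h₁.2
    obtain ⟨M, hM⟩ := h₂.2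
    refine ⟨max N M + 1, fun i hi => ?_⟩
    obtain ⟨i, rfl⟩ := Nat.exists_eq_add_of_le' (Nat.one_le_of_lt (Nat.lt_of_succ_le hi))
    have := hN i (le_trans (le_max_left _ _) (Nat.le_of_succ_le_succ hi))
    have := hM (i + 1) (by omega)
    rw [← not_nontrivial_iff_subsingleton]
    intro hn
    obtain ⟨x, hx⟩ := exists_ne (0 : S.X₃.homology (i + 1))
    have : x ∈ LinearMap.ker (connecting hS i) := Subsingleton.elim _ _
    rw [← key] at this
    obtain ⟨y, rfl⟩ := this
    exact hx (by rw [Subsingleton.elim y 0, map_zero])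

lemma euler_middle (h₁ : FinHom S.X₁) (h₂ : FinHom S.X₂) (h₃ : FinHom S.X₃) :
    euler S.X₂ = euler S.X₁ + euler S.X₃ := by
  have := h₁.1
  have := h₂.1
  have := h₃.1
  obtain ⟨N₁, hN₁⟩ := h₁.2
  obtain ⟨N₂, hN₂⟩ := h₂.2
  obtain ⟨N₃, hN₃⟩ := h₃.2
  set N := N₁ + N₂ + N₃ with hN
  let a : ℕ → ℤ := fun i => Nat.casesOn i 0 fun i =>
    (Module.finrank ℚ (LinearMap.range (connecting hS i)) : ℤ)
  have haN : a N = 0 := by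
    cases h : N with
    | zero => rfl
    | succ n =>
      have := hN₃ (n + 1) (by omega)
      have e : LinearMap.range (connecting hS n) = ⊥ := by
        rw [LinearMap.range_eq_bot]
        ext x
        rw [Subsingleton.elim x 0, map_zero, map_zero]
      simp only [a]
      rw [e]; simp
  have key := Int.alternating_sum_of_telescoping (a := a)
    (x := fun i => (Module.finrank ℚ (S.X₁.homology i) : ℤ)
      - Module.finrank ℚ (S.X₂.homology i) + Module.finrank ℚ (S.X₃.homology i)) rfl (fun i => by
      have e1 := LinearMap.finrank_range_add_finrank_ker (hmap S.f i)
      have e2 := LinearMap.finrank_range_add_finrank_ker (hmap S.g i)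
      rw [← range_δ_eq_ker_f hS] at e1
      rw [← range_f_eq_ker_g hS] at e2
      have e3 : (Module.finrank ℚ (S.X₃.homology i) : ℤ)
          = Module.finrank ℚ (LinearMap.range (hmap S.g i)) + a i := by
        cases i with
        | zero =>
          rw [range_g_zero hS]; simp [a]
        | succ i =>
          have e := LinearMap.finrank_range_add_finrank_ker (connecting hS i)
          rw [← range_g_eq_ker_δ hS] at e
          rw [← e]
          simp only [a]; push_cast; ring
      rw [← e1, ← e2, e3]
      simp only [a]; push_cast; ring) N
  rw [haN, mul_zero] at key
  rw [euler_eq_sum (N := N) fun i hi => hN₁ i (by omega),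
    euler_eq_sum (N := N) fun i hi => hN₂ i (by omega),
    euler_eq_sum (N := N) fun i hi => hN₃ i (by omega), ← sub_eq_zero, ← neg_eq_zero, ← key,
    ← Finset.sum_add_distrib, ← Finset.sum_sub_distrib, ← Finset.sum_neg_distrib]
  refine Finset.sum_congr rfl fun i _ => ?_
  ring

end exact

end ChainComplex

/-- A chain complex of rational vector spaces, presented by linear maps. -/
structure LinComplex where
  /-- The chains. -/
  M : ℕ → Type
  [grp : ∀ k, AddCommGroup (M k)]
  [mod : ∀ k, Module ℚ (M k)]
  /-- The differential. -/
  d : ∀ k, M (k + 1) →ₗ[ℚ] M k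
  d_d : ∀ k x, d k (d (k + 1) x) = 0

namespace LinComplex

attribute [instance] LinComplex.grp LinComplex.mod

/-- The associated chain complex. -/
noncomputable def cx (C : LinComplex) : ChainComplex (ModuleCat ℚ) ℕ :=
  ChainComplex.of (fun k => ModuleCat.of ℚ (C.M k)) (fun k => ModuleCat.ofHom (C.d k))
    (fun k => by ext x; exact C.d_d k x)

lemma cx_d (C : LinComplex) (k : ℕ) : C.cx.d (k + 1) k = ModuleCat.ofHom (C.d k) :=
  ChainComplex.of_d (fun k => ModuleCat.of ℚ (C.M k)) (fun k => ModuleCat.ofHom (C.d k)) k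

/-- A morphism of complexes from linear maps. -/
noncomputable def hom {C D : LinComplex} (f : ∀ k, C.M k →ₗ[ℚ] D.M k)
    (h : ∀ k x, D.d k (f (k + 1) x) = f k (C.d k x)) : C.cx ⟶ D.cx where
  f k := ModuleCat.ofHom (f k)
  comm' i j hij := by
    obtain rfl : j + 1 = i := hij
    rw [cx_d, cx_d]
    ext x
    exact h j x

/-- An isomorphism of complexes from linear equivalences. -/
noncomputable def iso {C D : LinComplex} (f : ∀ k, C.M k ≃ₗ[ℚ] D.M k)
    (h : ∀ k x, D.d k (f (k + 1) x) = f k (C.d k x)) : C.cx ≅ D.cx :=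
  HomologicalComplex.Hom.isoOfComponents (fun k => (f k).toModuleIso) (fun i j hij => by
    obtain rfl : j + 1 = i := hij
    rw [cx_d, cx_d]
    ext x
    exact h j x)

lemma exists_shortExact {C D E : LinComplex} (f : ∀ k, C.M k →ₗ[ℚ] D.M k)
    (hf : ∀ k x, D.d k (f (k + 1) x) = f k (C.d k x)) (g : ∀ k, D.M k →ₗ[ℚ] E.M k)
    (hg : ∀ k x, E.d k (g (k + 1) x) = g k (D.d k x))
    (inj : ∀ k, Function.Injective (f k)) (surj : ∀ k, Function.Surjective (g k))
    (hfg : ∀ k x, g k (f k x) = 0) (exact : ∀ k y, g k y = 0 → ∃ x, f k x = y) :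
    ∃ S : ShortComplex (ChainComplex (ModuleCat ℚ) ℕ), S.ShortExact ∧
      S.X₁ = C.cx ∧ S.X₂ = D.cx ∧ S.X₃ = E.cx := by
  refine ⟨ShortComplex.mk (hom f hf) (hom g hg) ?_, ?_, rfl, rfl, rfl⟩
  · ext k x
    exact hfg k x
  · refine HomologicalComplex.shortExact_of_degreewise_shortExact _ fun k => ?_
    have h1 : Mono (ModuleCat.ofHom (f k)) := (ModuleCat.mono_iff_injective _).2 (inj k)
    have h2 : Epi (ModuleCat.ofHom (g k)) := (ModuleCat.epi_iff_surjective _).2 (surj k)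
    refine { exact := ?_, mono_f := h1, epi_g := h2 }
    rw [ShortComplex.moduleCat_exact_iff]
    exact fun y hy => exact k y hy

lemma subsingleton_homology_succ (C : LinComplex) (k : ℕ)
    (h : ∀ x : C.M (k + 1), C.d k x = 0 → ∃ y, C.d (k + 1) y = x) :
    Subsingleton (C.cx.homology (k + 1)) := by
  have : C.cx.ExactAt (k + 1) := by
    rw [HomologicalComplex.exactAt_iff' _ (k + 2) (k + 1) k (by simp) (by simp),
      ShortComplex.moduleCat_exact_iff]
    intro x hx
    obtain ⟨y, hy⟩ := h x (by
      change (C.cx.d (k + 1) k) x = 0 at hx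
      rw [cx_d] at hx; exact hx)
    refine ⟨y, ?_⟩
    change (C.cx.d (k + 2) (k + 1)) y = x
    rw [cx_d]; exact hy
  exact ModuleCat.subsingleton_of_isZero this.isZero_homology

lemma subsingleton_homology_zero (C : LinComplex) (h0 : ∀ x : C.M 0, ∃ y, C.d 0 y = x) :
    Subsingleton (C.cx.homology 0) := by
  have : C.cx.ExactAt 0 := by
    rw [HomologicalComplex.exactAt_iff' _ 1 0 0 (by simp) (by simp),
      ShortComplex.moduleCat_exact_iff]
    intro x _
    obtain ⟨y, hy⟩ := h0 x
    refine ⟨y, ?_⟩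
    change (C.cx.d 1 0) y = x
    rw [cx_d]; exact hy
  exact ModuleCat.subsingleton_of_isZero this.isZero_homology

lemma subsingleton_homology (C : LinComplex) (h0 : ∀ x : C.M 0, ∃ y, C.d 0 y = x)
    (h : ∀ k (x : C.M (k + 1)), C.d k x = 0 → ∃ y, C.d (k + 1) y = x) :
    ∀ i, Subsingleton (C.cx.homology i)
  | 0 => C.subsingleton_homology_zero h0
  | k + 1 => C.subsingleton_homology_succ k (h k)

/-- The product of two complexes. -/
def prod (C D : LinComplex) : LinComplex where
  M k := C.M k × D.M k
  d k := (C.d k).prodMap (D.d k)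
  d_d k x := by ext <;> simp [d_d]

/-- The subcomplex given by submodules stable under the differential. -/
def sub (C : LinComplex) (P : ∀ k, Submodule ℚ (C.M k))
    (hP : ∀ k, ∀ x ∈ P (k + 1), C.d k x ∈ P k) : LinComplex where
  M k := P k
  d k := (C.d k).restrict (hP k)
  d_d k x := by ext; simp [LinearMap.restrict_apply, d_d]

/-- The quotient complex by submodules stable under the differential. -/
def quot (C : LinComplex) (P : ∀ k, Submodule ℚ (C.M k))
    (hP : ∀ k, ∀ x ∈ P (k + 1), C.d k x ∈ P k) : LinComplex where
  M k := C.M k ⧸ P k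
  d k := (P (k + 1)).mapQ (P k) (C.d k) (hP k)
  d_d k x := by
    obtain ⟨x, rfl⟩ := Submodule.Quotient.mk_surjective _ x
    simp [d_d]

open ChainComplex

lemma finHom_of_subsingleton {K : ChainComplex (ModuleCat ℚ) ℕ}
    (h : ∀ i, Subsingleton (K.homology i)) : FinHom K :=
  ⟨fun i => have := h i; inferInstance, 0, fun i _ => h i⟩

lemma euler_of_subsingleton {K : ChainComplex (ModuleCat ℚ) ℕ}
    (h : ∀ i, Subsingleton (K.homology i)) : euler K = 0 := by
  rw [euler_eq_sum (N := 0) fun i _ => h i]; simp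

lemma finHom_euler_prod {C D : LinComplex} (hC : FinHom C.cx) (hD : FinHom D.cx) :
    FinHom (C.prod D).cx ∧ euler (C.prod D).cx = euler C.cx + euler D.cx := by
  obtain ⟨S, hS, h1, h2, h3⟩ := exists_shortExact (C := C) (D := C.prod D) (E := D)
    (fun k => LinearMap.inl ℚ _ _) (fun k x => Prod.ext rfl (map_zero (D.d k)))
    (fun k => LinearMap.snd ℚ _ _) (fun k x => rfl) (fun k => LinearMap.inl_injective)
    (fun k => Prod.snd_surjective) (fun k x => rfl) (fun k y hy => ⟨y.1, Prod.ext rfl hy.symm⟩)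
  rw [← h1] at hC ⊢
  rw [← h3] at hD ⊢
  rw [← h2]
  have := finHom_middle hS hC hD
  exact ⟨this, euler_middle hS hC this hD⟩

section MayerVietoris

variable (C : LinComplex) (P Q : ∀ k, Submodule ℚ (C.M k))
  (hP : ∀ k, ∀ x ∈ P (k + 1), C.d k x ∈ P k) (hQ : ∀ k, ∀ x ∈ Q (k + 1), C.d k x ∈ Q k)

include hP hQ in
lemma d_mem_inf : ∀ k, ∀ x ∈ P (k + 1) ⊓ Q (k + 1), C.d k x ∈ P k ⊓ Q k :=
  fun k x hx => ⟨hP k x hx.1, hQ k x hx.2⟩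

include hP hQ in
lemma d_mem_sup : ∀ k, ∀ x ∈ P (k + 1) ⊔ Q (k + 1), C.d k x ∈ P k ⊔ Q k := by
  intro k x hx
  obtain ⟨y, hy, z, hz, rfl⟩ := Submodule.mem_sup.1 hx
  rw [map_add]
  exact Submodule.add_mem_sup (hP k y hy) (hQ k z hz)

/-- Mayer–Vietoris for two subcomplexes whose sum computes the full homology. -/
theorem mayerVietoris
    (hq0 : ∀ x : C.M 0, ∃ y, x - C.d 0 y ∈ P 0 ⊔ Q 0)
    (hq : ∀ k (x : C.M (k + 1)), C.d k x ∈ P k ⊔ Q k →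
      ∃ y, x - C.d (k + 1) y ∈ P (k + 1) ⊔ Q (k + 1))
    (h1 : FinHom (C.sub P hP).cx) (h2 : FinHom (C.sub Q hQ).cx)
    (h12 : FinHom (C.sub (fun k => P k ⊓ Q k) (C.d_mem_inf P Q hP hQ)).cx) :
    FinHom C.cx ∧ euler C.cx
        + euler (C.sub (fun k => P k ⊓ Q k) (C.d_mem_inf P Q hP hQ)).cx
      = euler (C.sub P hP).cx + euler (C.sub Q hQ).cx := by
  obtain ⟨hprod, eprod⟩ := finHom_euler_prod h1 h2
  rw [← eprod]
  set I := C.sub (fun k => P k ⊓ Q k) (C.d_mem_inf P Q hP hQ) with hI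
  set R := C.sub (fun k => P k ⊔ Q k) (C.d_mem_sup P Q hP hQ) with hR
  obtain ⟨S, hS, e1, e2, e3⟩ := exists_shortExact (C := I)
    (D := (C.sub P hP).prod (C.sub Q hQ)) (E := R)
    (fun k => (Submodule.inclusion inf_le_left).prod (Submodule.inclusion inf_le_right))
    (fun k x => rfl)
    (fun k => (Submodule.inclusion le_sup_left).coprod (-Submodule.inclusion le_sup_right))
    (fun k x => by
      refine Subtype.ext ?_
      change C.d k (x.1.1 + -x.2.1) = C.d k x.1.1 + - C.d k x.2.1
      rw [map_add, map_neg])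
    (fun k x y hxy => Subtype.ext (congrArg (fun z => z.1.1) hxy))
    (fun k x => by
      obtain ⟨y, hy, z, hz, e⟩ := Submodule.mem_sup.1 x.2
      refine ⟨(⟨y, hy⟩, ⟨-z, neg_mem hz⟩), Subtype.ext ?_⟩
      change y + - -z = x.1
      rw [neg_neg, e])
    (fun k x => Subtype.ext (add_neg_cancel x.1))
    (fun k y hy => by
      have h : y.1.1 + -y.2.1 = 0 := congrArg Subtype.val hy
      rw [← sub_eq_add_neg, sub_eq_zero] at h
      refine ⟨⟨y.1.1, y.1.2, h ▸ y.2.2⟩, Prod.ext rfl (Subtype.ext h)⟩)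
  rw [← e1] at h12 ⊢
  rw [← e2] at hprod ⊢
  have hRfin := finHom_right hS h12 hprod
  have hRe := euler_middle hS h12 hprod hRfin
  rw [e3] at hRfin hRe
  obtain ⟨S', hS', f1, f2, f3⟩ := exists_shortExact (C := R) (D := C)
    (E := C.quot (fun k => P k ⊔ Q k) (C.d_mem_sup P Q hP hQ))
    (fun k => Submodule.subtype _) (fun k x => rfl) (fun k => Submodule.mkQ _) (fun k x => rfl)
    (fun k => Subtype.val_injective) (fun k => Submodule.mkQ_surjective _)
    (fun k x => (Submodule.Quotient.mk_eq_zero _).2 x.2)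
    (fun k y hy => ⟨⟨y, (Submodule.Quotient.mk_eq_zero _).1 hy⟩, rfl⟩)
  have hsub := subsingleton_homology (C.quot (fun k => P k ⊔ Q k) (C.d_mem_sup P Q hP hQ))
    (fun x => by
      obtain ⟨x, rfl⟩ := Submodule.Quotient.mk_surjective _ x
      obtain ⟨y, hy⟩ := hq0 x
      exact ⟨Submodule.Quotient.mk y, ((Submodule.Quotient.eq _).2 hy).symm⟩)
    (fun k x hx => by
      obtain ⟨x, rfl⟩ := Submodule.Quotient.mk_surjective _ x
      obtain ⟨y, hy⟩ := hq k x ((Submodule.Quotient.mk_eq_zero _).1 hx)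
      exact ⟨Submodule.Quotient.mk y, ((Submodule.Quotient.eq _).2 hy).symm⟩)
  have hqf := finHom_of_subsingleton hsub
  have hqe := euler_of_subsingleton hsub
  rw [← f3] at hqf hqe
  rw [← f1] at hRfin hRe
  have hC := finHom_middle hS' hRfin hqf
  have hCe := euler_middle hS' hRfin hC hqf
  rw [f2] at hC hCe
  exact ⟨hC, by rw [hCe, hqe, hRe]; ring⟩

end MayerVietoris

end LinComplex

/-! ### Singular chains -/

namespace Sing

variable {X Y : Type} [TopologicalSpace X] [TopologicalSpace Y]

/-- Singular chains. -/
abbrev Chain (X : Type) [TopologicalSpace X] (k : ℕ) := C(Splx k, X) →₀ ℚ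

/-- The singular boundary. -/
noncomputable def bd (X : Type) [TopologicalSpace X] (k : ℕ) : Chain X (k + 1) →ₗ[ℚ] Chain X k :=
  ∑ i : Fin (k + 2), ((-1 : ℚ) ^ (i : ℕ)) •
    Finsupp.lmapDomain ℚ ℚ (fun σ : C(Splx (k + 1), X) => σ.comp (Splx.face i))

lemma bd_single {k : ℕ} (σ : C(Splx (k + 1), X)) :
    bd X k (Finsupp.single σ 1) =
      ∑ i : Fin (k + 2), ((-1 : ℚ) ^ (i : ℕ)) • Finsupp.single (σ.comp (Splx.face i)) 1 := by
  simp [bd]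

/-- The singular chain associated with a chain of affine simplices in the source of `σ`. -/
noncomputable def real {m : ℕ} (σ : C(Splx m, X)) (k : ℕ) :
    TupleChain (Splx m) (k + 1) →ₗ[ℚ] Chain X k :=
  Finsupp.lmapDomain ℚ ℚ (fun v => σ.comp (Splx.aff v))

@[simp] lemma real_single {m : ℕ} (σ : C(Splx m, X)) {k : ℕ} (v : Fin (k + 1) → Splx m) (a : ℚ) :
    real σ k (Finsupp.single v a) = Finsupp.single (σ.comp (Splx.aff v)) a := by
  simp [real]

lemma real_vertex {m : ℕ} (σ : C(Splx m, X)) (a : ℚ) :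
    real σ m (Finsupp.single stdSimplex.vertex a) = Finsupp.single σ a := by
  rw [real_single, Splx.aff_vertex_eq_id, ContinuousMap.comp_id]

lemma hom_ext {k : ℕ} {M : Type*} [AddCommGroup M] [Module ℚ M]
    {f g : Chain X k →ₗ[ℚ] M}
    (h : ∀ σ, f (Finsupp.single σ 1) = g (Finsupp.single σ 1)) : f = g :=
  Finsupp.lhom_ext' fun v => LinearMap.ext_ring (h v)

lemma bd_real {m : ℕ} (σ : C(Splx m, X)) {k : ℕ} (x : TupleChain (Splx m) (k + 2)) :
    bd X k (real σ (k + 1) x) = real σ k (TupleChain.bd (k + 1) x) := by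
  have : (bd X k ∘ₗ real σ (k + 1)) = real σ k ∘ₗ TupleChain.bd (k + 1) := by
    refine TupleChain.hom_ext fun v => ?_
    simp only [LinearMap.comp_apply, real_single, bd_single, TupleChain.bd_single, map_sum,
      map_smul, ContinuousMap.comp_assoc, Splx.aff_comp_face]
  exact LinearMap.congr_fun this x

lemma real_comp_aff {m n : ℕ} (σ : C(Splx m, X)) (w : Fin (n + 1) → Splx m) {k : ℕ}
    (x : TupleChain (Splx n) (k + 1)) :
    real (σ.comp (Splx.aff w)) k x = real σ k (TupleChain.map (Splx.aff w) (k + 1) x) := by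
  have : real (σ.comp (Splx.aff w)) k = real σ k ∘ₗ TupleChain.map (Splx.aff w) (k + 1) := by
    refine TupleChain.hom_ext fun v => ?_
    simp only [LinearMap.comp_apply, real_single, TupleChain.map_single, ContinuousMap.comp_assoc,
      Splx.aff_comp]
  exact LinearMap.congr_fun this x

lemma bd_bd (k : ℕ) (x : Chain X (k + 2)) : bd X k (bd X (k + 1) x) = 0 := by
  have : bd X k ∘ₗ bd X (k + 1) = 0 := by
    refine hom_ext fun σ => ?_
    rw [LinearMap.comp_apply, ← real_vertex σ, bd_real, bd_real, TupleChain.bd_bd, map_zero]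
    rfl
  exact LinearMap.congr_fun this x

/-- The singular chain complex, concretely. -/
noncomputable def complex (X : Type) [TopologicalSpace X] : LinComplex where
  M := Chain X
  d := bd X
  d_d := bd_bd

/-- Subdivision of singular chains. -/
noncomputable def sd (X : Type) [TopologicalSpace X] (k : ℕ) : Chain X k →ₗ[ℚ] Chain X k :=
  Finsupp.linearCombination ℚ (fun σ => real σ k
    (TupleChain.sd (Splx.bary k) (k + 1) (Finsupp.single stdSimplex.vertex 1)))

/-- The homotopy between subdivision and the identity. -/
noncomputable def htpy (X : Type) [TopologicalSpace X] (k : ℕ) :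
    Chain X k →ₗ[ℚ] Chain X (k + 1) :=
  Finsupp.linearCombination ℚ (fun σ => real σ (k + 1)
    (TupleChain.htpy (Splx.bary k) (k + 1) (Finsupp.single stdSimplex.vertex 1)))

lemma sd_single {k : ℕ} (σ : C(Splx k, X)) : sd X k (Finsupp.single σ 1) = real σ k
    (TupleChain.sd (Splx.bary k) (k + 1) (Finsupp.single stdSimplex.vertex 1)) := by
  simp [sd]

lemma htpy_single {k : ℕ} (σ : C(Splx k, X)) : htpy X k (Finsupp.single σ 1) = real σ (k + 1)
    (TupleChain.htpy (Splx.bary k) (k + 1) (Finsupp.single stdSimplex.vertex 1)) := by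
  simp [htpy]

lemma sd_real {m : ℕ} (σ : C(Splx m, X)) {k : ℕ} (x : TupleChain (Splx m) (k + 1)) :
    sd X k (real σ k x) = real σ k (TupleChain.sd (Splx.bary m) (k + 1) x) := by
  have : sd X k ∘ₗ real σ k = real σ k ∘ₗ TupleChain.sd (Splx.bary m) (k + 1) := by
    refine TupleChain.hom_ext fun v => ?_
    simp only [LinearMap.comp_apply, real_single]
    rw [sd_single, real_comp_aff, TupleChain.map_sd (Splx.aff_bary v), TupleChain.map_single,
      Splx.aff_comp_vertex]
  exact LinearMap.congr_fun this x

lemma htpy_real {m : ℕ} (σ : C(Splx m, X)) {k : ℕ} (x : TupleChain (Splx m) (k + 1)) :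
    htpy X k (real σ k x) = real σ (k + 1) (TupleChain.htpy (Splx.bary m) (k + 1) x) := by
  have : htpy X k ∘ₗ real σ k = real σ (k + 1) ∘ₗ TupleChain.htpy (Splx.bary m) (k + 1) := by
    refine TupleChain.hom_ext fun v => ?_
    simp only [LinearMap.comp_apply, real_single]
    rw [htpy_single, real_comp_aff, TupleChain.map_htpy (Splx.aff_bary v), TupleChain.map_single,
      Splx.aff_comp_vertex]
  exact LinearMap.congr_fun this x

lemma bd_htpy_zero (x : Chain X 0) : bd X 0 (htpy X 0 x) = x - sd X 0 x := by
  have : bd X 0 ∘ₗ htpy X 0 = LinearMap.id - sd X 0 := by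
    refine hom_ext fun σ => ?_
    simp only [LinearMap.comp_apply, LinearMap.sub_apply, LinearMap.id_apply]
    rw [← real_vertex σ, htpy_real, sd_real, bd_real, TupleChain.bd_htpy]
    simp [TupleChain.htpy]
  exact LinearMap.congr_fun this x

lemma bd_htpy {k : ℕ} (x : Chain X (k + 1)) :
    bd X (k + 1) (htpy X (k + 1) x) = x - sd X (k + 1) x - htpy X k (bd X k x) := by
  have : bd X (k + 1) ∘ₗ htpy X (k + 1)
      = LinearMap.id - sd X (k + 1) - htpy X k ∘ₗ bd X k := by
    refine hom_ext fun σ => ?_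
    simp only [LinearMap.comp_apply, LinearMap.sub_apply, LinearMap.id_apply]
    rw [← real_vertex σ, htpy_real, sd_real, bd_real, bd_real, htpy_real, TupleChain.bd_htpy,
      map_sub, map_sub]
  exact LinearMap.congr_fun this x

lemma bd_sd {k : ℕ} (x : Chain X (k + 1)) :
    bd X k (sd X (k + 1) x) = sd X k (bd X k x) := by
  have h := bd_htpy x
  have h1 : sd X (k + 1) x = x - htpy X k (bd X k x) - bd X (k + 1) (htpy X (k + 1) x) := by
    rw [h]; abel
  rw [h1, map_sub, map_sub, bd_bd, sub_zero]
  cases k with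
  | zero => rw [bd_htpy_zero]; abel
  | succ k => rw [bd_htpy, bd_bd, map_zero, sub_zero]; abel

/-! ### Chains supported in a subset -/

/-- Chains on the simplices with image in `A`. -/
def within (A : Set X) (k : ℕ) : Submodule ℚ (Chain X k) :=
  Finsupp.supported ℚ ℚ {σ | Set.range σ ⊆ A}

lemma real_mem_within {A : Set X} {m : ℕ} {σ : C(Splx m, X)} (hσ : Set.range σ ⊆ A) {k : ℕ}
    (x : TupleChain (Splx m) (k + 1)) : real σ k x ∈ within A k := by
  refine LinearMap.mem_of_supported (s := Set.univ) (fun v _ => ?_) (by simp)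
  rw [real_single]
  exact Finsupp.single_mem_supported ℚ _ ((Set.range_comp_subset_range (Splx.aff v) σ).trans hσ)

lemma bd_mem_within (A : Set X) (k : ℕ) : ∀ x ∈ within A (k + 1), bd X k x ∈ within A k :=
  fun _ hx => LinearMap.mem_of_supported (fun σ hσ => by
    rw [← real_vertex σ, bd_real]; exact real_mem_within hσ _) hx

lemma sd_mem_within (A : Set X) (k : ℕ) : ∀ x ∈ within A k, sd X k x ∈ within A k :=
  fun _ hx => LinearMap.mem_of_supported (fun σ hσ => by
    rw [sd_single]; exact real_mem_within hσ _) hx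

lemma htpy_mem_within (A : Set X) (k : ℕ) : ∀ x ∈ within A k, htpy X k x ∈ within A (k + 1) :=
  fun _ hx => LinearMap.mem_of_supported (fun σ hσ => by
    rw [htpy_single]; exact real_mem_within hσ _) hx

lemma within_inf (A B : Set X) (k : ℕ) : within A k ⊓ within B k = within (A ∩ B) k := by
  rw [within, within, within, ← Finsupp.supported_inter]
  congr 1
  ext σ
  simp

lemma map_mem_sup {k l : ℕ} {A B : Set X} {f : Chain X k →ₗ[ℚ] Chain X l}
    (hA : ∀ x ∈ within A k, f x ∈ within A l) (hB : ∀ x ∈ within B k, f x ∈ within B l)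
    {x : Chain X k} (hx : x ∈ within A k ⊔ within B k) : f x ∈ within A l ⊔ within B l := by
  obtain ⟨y, hy, z, hz, rfl⟩ := Submodule.mem_sup.1 hx
  rw [map_add]
  exact Submodule.add_mem_sup (hA y hy) (hB z hz)

section small

variable {U W : Set X}

lemma sd_iterate_mem {k : ℕ} {x : Chain X k} (hx : x ∈ within U k ⊔ within W k) (r : ℕ) :
    (sd X k)^[r] x ∈ within U k ⊔ within W k := by
  induction r with
  | zero => exact hx
  | succ r ih =>
    rw [Function.iterate_succ_apply']
    exact map_mem_sup (sd_mem_within U k) (sd_mem_within W k) ih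

lemma sd_iterate_single {k : ℕ} (σ : C(Splx k, X)) (r : ℕ) :
    (sd X k)^[r] (Finsupp.single σ 1) = real σ k (Splx.sdIter k r) := by
  induction r with
  | zero => exact (real_vertex σ 1).symm
  | succ r ih => rw [Function.iterate_succ_apply', ih, sd_real, Splx.sdIter, Splx.sdIter,
      Function.iterate_succ_apply']

lemma exists_sd_iterate_single_mem (hU : IsOpen U) (hW : IsOpen W) (hUW : U ∪ W = Set.univ) {k : ℕ}
    (σ : C(Splx k, X)) :
    ∃ r, (sd X k)^[r] (Finsupp.single σ 1) ∈ within U k ⊔ within W k := by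
  obtain ⟨δ, hδ, hδ'⟩ := lebesgue_number_lemma_of_metric (s := (Set.univ : Set (Splx k)))
    (c := fun b : Bool => σ ⁻¹' (bif b then U else W)) isCompact_univ
    (fun b => by cases b; exacts [hW.preimage σ.continuous, hU.preimage σ.continuous])
    (fun t _ => by
      rcases (hUW ▸ Set.mem_univ (σ t) : σ t ∈ U ∪ W) with h | h
      exacts [Set.mem_iUnion.2 ⟨true, h⟩, Set.mem_iUnion.2 ⟨false, h⟩])
  obtain ⟨r, hr⟩ := exists_pow_lt_of_lt_one hδ (show (k : ℝ) / (k + 1) < 1 by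
    rw [div_lt_one (by positivity)]; linarith)
  refine ⟨r, ?_⟩
  rw [sd_iterate_single]
  refine LinearMap.mem_of_supported (fun v hv => ?_) (Splx.sdIter_mem_fine k r)
  rw [real_single]
  have hball : Set.range (Splx.aff v) ⊆ Metric.ball (v 0) δ := by
    rintro _ ⟨t, rfl⟩
    exact (Splx.dist_aff_le v t (v 0) fun j => hv.2 j 0).trans_lt hr
  obtain ⟨b, hb⟩ := hδ' (v 0) trivial
  have hr : Set.range (σ.comp (Splx.aff v)) ⊆ bif b then U else W := by
    rintro _ ⟨t, rfl⟩
    exact hb (hball ⟨t, rfl⟩)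
  cases b
  · exact Submodule.mem_sup_right (Finsupp.single_mem_supported ℚ _ hr)
  · exact Submodule.mem_sup_left (Finsupp.single_mem_supported ℚ _ hr)

lemma exists_sd_iterate_mem (hU : IsOpen U) (hW : IsOpen W) (hUW : U ∪ W = Set.univ) {k : ℕ}
    (x : Chain X k) : ∃ r, (sd X k)^[r] x ∈ within U k ⊔ within W k := by
  have it : ∀ r, (sd X k)^[r] = ⇑((sd X k) ^ r) := fun r => (Module.End.coe_pow _ r).symm
  induction x using Finsupp.induction_linear with
  | zero => exact ⟨0, Submodule.zero_mem _⟩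
  | add x y hx hy =>
    obtain ⟨r, hr⟩ := hx
    obtain ⟨s, hs⟩ := hy
    refine ⟨s + r, ?_⟩
    rw [it, map_add]
    rw [← it]
    refine Submodule.add_mem _ ?_ ?_
    · rw [Function.iterate_add_apply]; exact sd_iterate_mem hr s
    · rw [add_comm s r, Function.iterate_add_apply]; exact sd_iterate_mem hs r
  | single σ a =>
    obtain ⟨r, hr⟩ := exists_sd_iterate_single_mem hU hW hUW σ
    refine ⟨r, ?_⟩
    rw [← mul_one a, ← smul_eq_mul, ← Finsupp.smul_single, it, map_smul, ← it]
    exact Submodule.smul_mem _ _ hr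

lemma exists_sub_bd_mem_zero (hU : IsOpen U) (hW : IsOpen W) (hUW : U ∪ W = Set.univ)
    (x : Chain X 0) : ∃ y, x - bd X 0 y ∈ within U 0 ⊔ within W 0 := by
  obtain ⟨r, hr⟩ := exists_sd_iterate_mem hU hW hUW x
  induction r generalizing x with
  | zero => exact ⟨0, by simpa using hr⟩
  | succ r ih =>
    obtain ⟨y, hy⟩ := ih (sd X 0 x) hr
    refine ⟨htpy X 0 x + y, ?_⟩
    have : x - bd X 0 (htpy X 0 x + y) = sd X 0 x - bd X 0 y := by
      rw [map_add, bd_htpy_zero]; abel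
    rwa [this]

lemma exists_sub_bd_mem (hU : IsOpen U) (hW : IsOpen W) (hUW : U ∪ W = Set.univ) {k : ℕ}
    (x : Chain X (k + 1)) (hx : bd X k x ∈ within U k ⊔ within W k) :
    ∃ y, x - bd X (k + 1) y ∈ within U (k + 1) ⊔ within W (k + 1) := by
  obtain ⟨r, hr⟩ := exists_sd_iterate_mem hU hW hUW x
  induction r generalizing x with
  | zero => exact ⟨0, by simpa using hr⟩
  | succ r ih =>
    obtain ⟨y, hy⟩ := ih (sd X (k + 1) x) (by
      rw [bd_sd]; exact map_mem_sup (sd_mem_within U k) (sd_mem_within W k) hx) hr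
    refine ⟨htpy X (k + 1) x + y, ?_⟩
    have : x - bd X (k + 1) (htpy X (k + 1) x + y)
        = sd X (k + 1) x - bd X (k + 1) y + htpy X k (bd X k x) := by
      rw [map_add, bd_htpy]; abel
    rw [this]
    exact Submodule.add_mem _ hy (map_mem_sup (htpy_mem_within U k) (htpy_mem_within W k) hx)

end small

end Sing

namespace Sing

variable {X Y : Type} [TopologicalSpace X] [TopologicalSpace Y]

/-- Singular simplices as simplices of the singular set. -/
noncomputable abbrev simplexEquiv (X : Type) [TopologicalSpace X] (k : ℕ) :
    (TopCat.toSSet.obj (TopCat.of X)).obj (Opposite.op (SimplexCategory.mk k)) ≃ C(Splx k, X) :=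
  (TopCat.of X).toSSetObjEquiv (Opposite.op (SimplexCategory.mk k))

lemma simplexEquiv_δ {j : ℕ} (i : Fin (j + 2))
    (σ : (TopCat.toSSet.obj (TopCat.of X)).obj (Opposite.op (SimplexCategory.mk (j + 1)))) :
    simplexEquiv X j ((TopCat.toSSet.obj (TopCat.of X)).δ i σ)
      = (simplexEquiv X (j + 1) σ).comp (Splx.face i) :=
  rfl

/-- Singular chains as chains of the singular set. -/
noncomputable abbrev chainEquiv (X : Type) [TopologicalSpace X] (k : ℕ) :
    ((TopCat.toSSet.obj (TopCat.of X)).obj (Opposite.op (SimplexCategory.mk k)) →₀ ℚ)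
      ≃ₗ[ℚ] Chain X k :=
  Finsupp.domLCongr (simplexEquiv X k)

lemma singularChainComplex_d (j : ℕ) :
    (singularChainComplex X).d (j + 1) j = ∑ i : Fin (j + 2), (-1 : ℤ) ^ (i : ℕ) •
      ModuleCat.ofHom (Finsupp.lmapDomain ℚ ℚ ((TopCat.toSSet.obj (TopCat.of X)).δ i)) :=
  AlgebraicTopology.AlternatingFaceMapComplex.obj_d_eq _ j

lemma bd_chainEquiv (j : ℕ)
    (x : (TopCat.toSSet.obj (TopCat.of X)).obj (Opposite.op (SimplexCategory.mk (j + 1))) →₀ ℚ) :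
    bd X j (chainEquiv X (j + 1) x) = chainEquiv X j ((∑ i : Fin (j + 2), (-1 : ℤ) ^ (i : ℕ) •
      ModuleCat.ofHom (Finsupp.lmapDomain ℚ ℚ
        ((TopCat.toSSet.obj (TopCat.of X)).δ i))).hom x) := by
  have : (bd X j ∘ₗ (chainEquiv X (j + 1)).toLinearMap) = (chainEquiv X j).toLinearMap ∘ₗ
      (∑ i : Fin (j + 2), (-1 : ℤ) ^ (i : ℕ) •
      ModuleCat.ofHom (Finsupp.lmapDomain ℚ ℚ
        ((TopCat.toSSet.obj (TopCat.of X)).δ i))).hom := by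
    refine Finsupp.lhom_ext' fun σ => LinearMap.ext_ring ?_
    simp only [LinearMap.comp_apply, Finsupp.lsingle_apply, LinearEquiv.coe_coe]
    rw [Finsupp.domLCongr_single, bd_single]
    rw [ModuleCat.hom_sum, LinearMap.sum_apply, map_sum]
    refine Finset.sum_congr rfl fun i _ => ?_
    rw [ModuleCat.hom_zsmul, LinearMap.smul_apply, map_zsmul, ModuleCat.hom_ofHom,
      Finsupp.lmapDomain_apply, Finsupp.mapDomain_single, Finsupp.domLCongr_single, simplexEquiv_δ,
      ← Int.cast_smul_eq_zsmul ℚ]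
    push_cast
    rfl
  exact LinearMap.congr_fun this x

/-- The concrete singular complex is isomorphic to the one built from the singular set. -/
noncomputable def compIso (X : Type) [TopologicalSpace X] :
    singularChainComplex X ≅ (complex X).cx :=
  HomologicalComplex.Hom.isoOfComponents (fun k => (chainEquiv X k).toModuleIso) (fun i j hij => by
    obtain rfl : j + 1 = i := hij
    rw [singularChainComplex_d, LinComplex.cx_d]
    exact ModuleCat.hom_ext (LinearMap.ext fun x => bd_chainEquiv j x))

end Sing

section

open ChainComplex

/-- The singular chain complex as a functor. -/
noncomputable def singularChainFunctor : TopCat.{0} ⥤ ChainComplex (ModuleCat ℚ) ℕ :=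
  TopCat.toSSet ⋙ (CategoryTheory.SimplicialObject.whiskering _ _).obj (ModuleCat.free ℚ) ⋙
    AlgebraicTopology.alternatingFaceMapComplex (ModuleCat ℚ)

lemma singularChainFunctor_homologyMap_eq {A B : TopCat.{0}} {f g : A ⟶ B}
    (H : TopCat.Homotopy f g) (n : ℕ) :
    HomologicalComplex.homologyMap (singularChainFunctor.map f) n
      = HomologicalComplex.homologyMap (singularChainFunctor.map g) n :=
  (((SSet.Homotopy.toSimplicialObjectHomotopy H.toSSet).whiskerRight
    (ModuleCat.free ℚ)).toChainHomotopy).homologyMap_eq n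

end

lemma HomologicalComplex.finite_homology (K : ChainComplex (ModuleCat ℚ) ℕ) (i : ℕ)
    [Module.Finite ℚ (K.X i)] : Module.Finite ℚ (K.homology i) := by
  have h1 : Module.Finite ℚ (K.cycles i) :=
    Module.Finite.of_injective (K.iCycles i).hom ((ModuleCat.mono_iff_injective _).1 inferInstance)
  exact Module.Finite.of_surjective (K.homologyπ i).hom
    ((ModuleCat.epi_iff_surjective _).1 inferInstance)

namespace Sing

variable {X Y : Type} [TopologicalSpace X] [TopologicalSpace Y]

/-- The chain map induced by a continuous map. -/
noncomputable def push (f : C(X, Y)) (k : ℕ) : Chain X k →ₗ[ℚ] Chain Y k :=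
  Finsupp.lmapDomain ℚ ℚ fun σ => f.comp σ

lemma bd_push (f : C(X, Y)) (k : ℕ) (x : Chain X (k + 1)) :
    bd Y k (push f (k + 1) x) = push f k (bd X k x) := by
  have : bd Y k ∘ₗ push f (k + 1) = push f k ∘ₗ bd X k := by
    refine hom_ext fun σ => ?_
    simp only [LinearMap.comp_apply, bd_single, map_sum, map_smul, push, Finsupp.lmapDomain_apply,
      Finsupp.mapDomain_single, ContinuousMap.comp_assoc]
  exact LinearMap.congr_fun this x

lemma push_injective {f : C(X, Y)} (hf : Function.Injective f) (k : ℕ) :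
    Function.Injective (push f k) :=
  Finsupp.mapDomain_injective fun _ _ h =>
    ContinuousMap.ext fun x => hf (DFunLike.congr_fun h x)

lemma push_val_mem_within (A : Set X) (k : ℕ) (x : Chain A k) :
    push ⟨Subtype.val, continuous_subtype_val⟩ k x ∈ within A k := by
  refine LinearMap.mem_of_supported (s := Set.univ) (fun σ _ => ?_) (by simp)
  rw [push, Finsupp.lmapDomain_apply, Finsupp.mapDomain_single]
  refine Finsupp.single_mem_supported ℚ _ ?_
  rintro _ ⟨y, rfl⟩
  exact (σ y).2

lemma within_le_range_push_val (A : Set X) (k : ℕ) :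
    within A k ≤ LinearMap.range (push (X := A) ⟨Subtype.val, continuous_subtype_val⟩ k) := by
  intro x hx
  have := LinearMap.mem_of_supported (f := LinearMap.id)
    (P := LinearMap.range (push (X := A) ⟨Subtype.val, continuous_subtype_val⟩ k))
    (fun σ hσ => ?_) hx
  · exact this
  · refine ⟨Finsupp.single ⟨Set.codRestrict σ A fun y => hσ ⟨y, rfl⟩,
      σ.continuous.codRestrict _⟩ 1, ?_⟩
    rw [push, Finsupp.lmapDomain_apply, Finsupp.mapDomain_single]
    rfl

/-- Chains supported in a subset are chains of the subset. -/
noncomputable def subIso (A : Set X) :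
    (complex A).cx ≅ ((complex X).sub (within A) (bd_mem_within A)).cx :=
  LinComplex.iso (C := complex A) (D := (complex X).sub (within A) (bd_mem_within A))
    (fun k => LinearEquiv.ofBijective
      ((push ⟨Subtype.val, continuous_subtype_val⟩ k).codRestrict _ (push_val_mem_within A k))
      ⟨fun x y h => push_injective Subtype.val_injective k (congrArg Subtype.val h), fun x => by
        obtain ⟨y, hy⟩ := within_le_range_push_val A k x.2
        exact ⟨y, Subtype.ext hy⟩⟩)
    (fun k x => Subtype.ext (bd_push _ k x))

end Sing

section

open ChainComplex

/-- Spaces with finite dimensional total rational homology. -/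
def FinHomology (X : Type) [TopologicalSpace X] : Prop :=
  FinHom (singularChainComplex X)

section

variable {X Y : Type} [TopologicalSpace X] [TopologicalSpace Y]

lemma singularHomologyIso (e : X ≃ₜ Y) :
    Nonempty (singularChainComplex X ≅ singularChainComplex Y) :=
  ⟨singularChainFunctor.mapIso (TopCat.isoOfHomeo (X := TopCat.of X) (Y := TopCat.of Y) e)⟩

lemma FinHomology.of_homeomorph (e : X ≃ₜ Y) (h : FinHomology X) : FinHomology Y :=
  have ⟨i⟩ := singularHomologyIso e
  FinHom.of_iso i h

lemma eulerChar_congr (e : X ≃ₜ Y) : eulerChar X = eulerChar Y :=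
  have ⟨i⟩ := singularHomologyIso e
  euler_congr i

lemma subsingleton_singular_of_isEmpty [IsEmpty X] (i : ℕ) :
    Subsingleton ((singularChainComplex X).homology i) := by
  have : ∀ k, Subsingleton (Sing.Chain X k) := fun k =>
    have : IsEmpty C(Splx k, X) := ⟨fun σ => isEmptyElim (σ (Classical.arbitrary _))⟩
    inferInstance
  have h := (Sing.complex X).subsingleton_homology (fun x => ⟨0, (this 0).elim _ _⟩)
    (fun k x _ => ⟨0, (this (k + 1)).elim _ _⟩) i
  exact ((HomologicalComplex.homologyMapIso (Sing.compIso X) i).toLinearEquiv).toEquiv.subsingleton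

lemma FinHomology.of_isEmpty [IsEmpty X] : FinHomology X :=
  LinComplex.finHom_of_subsingleton subsingleton_singular_of_isEmpty

lemma eulerChar_of_isEmpty [IsEmpty X] : eulerChar X = 0 :=
  LinComplex.euler_of_subsingleton subsingleton_singular_of_isEmpty

lemma bd_punit (k : ℕ) (σ : C(Splx (k + 1), PUnit)) (τ : C(Splx k, PUnit)) :
    Sing.bd PUnit k (Finsupp.single σ 1)
      = (∑ i : Fin (k + 2), (-1 : ℚ) ^ (i : ℕ)) • Finsupp.single τ 1 := by
  rw [Sing.bd_single, Finset.sum_smul]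
  exact Finset.sum_congr rfl fun i _ => by congr 2

lemma finHomology_punit : FinHomology PUnit := by
  refine FinHom.of_iso (Sing.compIso PUnit).symm ⟨fun i => ?_, 1, fun i hi => ?_⟩
  · have : Module.Finite ℚ ((Sing.complex PUnit).cx.X i) :=
      inferInstanceAs (Module.Finite ℚ (C(Splx i, PUnit) →₀ ℚ))
    exact HomologicalComplex.finite_homology _ i
  · obtain ⟨k, rfl⟩ : ∃ k, i = k + 1 := ⟨i - 1, by omega⟩
    refine LinComplex.subsingleton_homology_succ _ k fun (x : Sing.Chain PUnit (k + 1)) hx => ?_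
    have hx : Sing.bd PUnit k x = 0 := hx
    let σ : ∀ m, C(Splx m, PUnit) := fun m => ContinuousMap.const _ PUnit.unit
    have hx' : x = x (σ _) • Finsupp.single (σ _) 1 := by
      ext τ
      obtain rfl : τ = σ _ := Subsingleton.elim _ _
      simp
    have key : ∀ n : ℕ, ∑ i : Fin n, (-1 : ℚ) ^ (i : ℕ) = if Even n then 0 else 1 := fun n => by
      rw [Fin.sum_univ_eq_sum_range (fun i => (-1 : ℚ) ^ i), neg_one_geom_sum]
    rcases Nat.even_or_odd k with he | ho
    · suffices h : ∃ y : Sing.Chain PUnit (k + 2), Sing.bd PUnit (k + 1) y = x from h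
      refine ⟨x (σ _) • Finsupp.single (σ _) 1, ?_⟩
      rw [map_smul, bd_punit (k + 1) _ (σ _), key, if_neg (by grind), one_smul, ← hx']
    · rw [hx', map_smul, bd_punit k _ (σ _), key, if_neg (by grind), one_smul] at hx
      have h0 : x (σ _) = 0 := by simpa using DFunLike.congr_fun hx (σ k)
      exact ⟨0, by rw [map_zero, hx', h0, zero_smul]; rfl⟩

lemma FinHomology.of_contractible [ContractibleSpace X] : FinHomology X := by
  obtain ⟨b, hb⟩ := id_nullhomotopic X
  obtain ⟨H⟩ := hb
  let i : TopCat.of X ⟶ TopCat.of PUnit := TopCat.ofHom (ContinuousMap.const _ PUnit.unit)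
  let j : TopCat.of PUnit ⟶ TopCat.of X := TopCat.ofHom (ContinuousMap.const _ b)
  have hij : ∀ n, HomologicalComplex.homologyMap (singularChainFunctor.map i) n ≫
      HomologicalComplex.homologyMap (singularChainFunctor.map j) n = 𝟙 _ := fun n => by
    rw [← HomologicalComplex.homologyMap_comp, ← Functor.map_comp,
      ← HomologicalComplex.homologyMap_id, ← CategoryTheory.Functor.map_id singularChainFunctor]
    exact (singularChainFunctor_homologyMap_eq (f := 𝟙 (TopCat.of X)) (g := i ≫ j) H n).symm
  have inj : ∀ n, Function.Injective
      (HomologicalComplex.homologyMap (singularChainFunctor.map i) n).hom := fun n => by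
    refine (ModuleCat.mono_iff_injective _).1 ?_
    have := hij n
    exact @mono_of_mono _ _ _ _ _ _ _ (by rw [this]; infer_instance)
  obtain ⟨hf, N, hN⟩ := finHomology_punit
  refine ⟨fun n => ?_, N, fun n hn => ?_⟩
  · have : IsNoetherian ℚ ((singularChainFunctor.obj (TopCat.of PUnit)).homology n) :=
      have := hf n
      inferInstanceAs (IsNoetherian ℚ ((singularChainComplex PUnit).homology n))
    exact Module.Finite.of_injective _ (inj n)
  · have : Subsingleton ((singularChainFunctor.obj (TopCat.of PUnit)).homology n) := hN n hn
    exact (inj n).subsingleton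

/-- The Mayer–Vietoris principle for two open sets covering a space. -/
theorem mayerVietoris_univ {U W : Set X} (hU : IsOpen U) (hW : IsOpen W) (hUW : U ∪ W = Set.univ)
    (h1 : FinHomology U) (h2 : FinHomology W) (h12 : FinHomology ↥(U ∩ W)) :
    FinHomology X ∧ eulerChar X + eulerChar ↥(U ∩ W) = eulerChar U + eulerChar W := by
  have iso : ∀ A : Set X, Nonempty (singularChainComplex A ≅
      ((Sing.complex X).sub (Sing.within A) (Sing.bd_mem_within A)).cx) := fun A =>
    ⟨Sing.compIso A ≪≫ Sing.subIso A⟩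
  obtain ⟨iU⟩ := iso U
  obtain ⟨iW⟩ := iso W
  obtain ⟨iI⟩ := iso (U ∩ W)
  have eI : (Sing.complex X).sub (Sing.within (U ∩ W)) (Sing.bd_mem_within _) =
      (Sing.complex X).sub (fun k => Sing.within U k ⊓ Sing.within W k)
        ((Sing.complex X).d_mem_inf _ _ (Sing.bd_mem_within U) (Sing.bd_mem_within W)) := by
    congr 1
    funext k
    exact (Sing.within_inf U W k).symm
  rw [eI] at iI
  have := (Sing.complex X).mayerVietoris (Sing.within U) (Sing.within W) (Sing.bd_mem_within U)
    (Sing.bd_mem_within W) (Sing.exists_sub_bd_mem_zero hU hW hUW)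
    (fun k => Sing.exists_sub_bd_mem hU hW hUW) (FinHom.of_iso iU h1) (FinHom.of_iso iW h2)
    (FinHom.of_iso iI h12)
  refine ⟨FinHom.of_iso (Sing.compIso X).symm this.1, ?_⟩
  have e : ∀ (Z : Type) [TopologicalSpace Z], eulerChar Z = euler (singularChainComplex Z) :=
    fun _ _ => rfl
  rw [e, e, e, e, euler_congr (Sing.compIso X), euler_congr iU, euler_congr iW, euler_congr iI]
  exact this.2

/-- The Mayer–Vietoris principle for subsets that are open in their union. -/
theorem mayerVietoris_subset {S U W : Set X} (hU : ∃ O, IsOpen O ∧ U = S ∩ O)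
    (hW : ∃ O, IsOpen O ∧ W = S ∩ O) (hUW : U ∪ W = S)
    (h1 : FinHomology U) (h2 : FinHomology W) (h12 : FinHomology ↥(U ∩ W)) :
    FinHomology S ∧ eulerChar S + eulerChar ↥(U ∩ W) = eulerChar U + eulerChar W := by
  have e : ∀ A ⊆ S, Nonempty (A ≃ₜ ((↑) ⁻¹' A : Set S)) := fun A hA =>
    ⟨(Topology.IsEmbedding.subtypeVal.homeomorphOfSubsetRange (by simpa using hA)).symm⟩
  have hUS : U ⊆ S := hUW ▸ Set.subset_union_left
  have hWS : W ⊆ S := hUW ▸ Set.subset_union_right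
  obtain ⟨eU⟩ := e U hUS
  obtain ⟨eW⟩ := e W hWS
  obtain ⟨eI⟩ := e (U ∩ W) (Set.inter_subset_left.trans hUS)
  have op : ∀ A, (∃ O, IsOpen O ∧ A = S ∩ O) → IsOpen ((↑) ⁻¹' A : Set S) := by
    rintro A ⟨O, hO, rfl⟩
    simpa using hO.preimage continuous_subtype_val
  have := mayerVietoris_univ (op U hU) (op W hW)
    (by rw [← Set.preimage_union, hUW]; simp) (h1.of_homeomorph eU) (h2.of_homeomorph eW)
    (h12.of_homeomorph eI)
  rw [eulerChar_congr eU, eulerChar_congr eW, eulerChar_congr eI]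
  exact this

end

end

/-! ### Conic stratifications -/

/-- A labelling of a space by a finite preorder whose stars are open and contract conically,
compatibly with the labels. -/
structure Conic {X L : Type} [TopologicalSpace X] [Preorder L] (κ : X → L) : Prop where
  isOpen_star : ∀ c, IsOpen {x | c ≤ κ x}
  contract : ∀ x₀, ∃ b, κ b = κ x₀ ∧ ∃ H : ℝ × X → X,
    ContinuousOn H (Set.Icc 0 1 ×ˢ {x | κ x₀ ≤ κ x}) ∧
      ∀ x, κ x₀ ≤ κ x → H (0, x) = x ∧ H (1, x) = b ∧ ∀ s ∈ Set.Ico (0 : ℝ) 1, κ (H (s, x)) = κ x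

namespace Conic

variable {X L : Type} [TopologicalSpace X] [Preorder L] {κ : X → L}

lemma isOpen_preimage (h : Conic κ) {I : Set L} (hI : IsUpperSet I) : IsOpen (κ ⁻¹' I) := by
  have : κ ⁻¹' I = ⋃ c ∈ I, {x | c ≤ κ x} := by
    ext x
    simp only [Set.mem_preimage, Set.mem_iUnion, Set.mem_ofPred_eq, exists_prop]
    exact ⟨fun hx => ⟨_, hx, le_rfl⟩, fun ⟨c, hc, hcx⟩ => hI hcx hc⟩
  rw [this]
  exact isOpen_biUnion fun c _ => h.isOpen_star c

lemma isPreconnected_fibre (h : Conic κ) (c : L) : IsPreconnected {x | κ x = c} := by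
  rcases Set.eq_empty_or_nonempty {x | κ x = c} with he | ⟨x₀, hx₀⟩
  · rw [he]; exact isPreconnected_empty
  obtain ⟨b, hb, H, hH, hH'⟩ := h.contract x₀
  obtain rfl : κ x₀ = c := hx₀
  refine isPreconnected_of_forall b fun x hx => ?_
  obtain ⟨h0, h1, h2⟩ := hH' x hx.ge
  refine ⟨(fun s => H (s, x)) '' Set.Icc 0 1, ?_, ⟨1, by simp, h1⟩, ⟨0, by simp, h0⟩, ?_⟩
  · rintro _ ⟨s, hs, rfl⟩
    rcases hs.2.lt_or_eq with hs1 | rfl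
    · exact (h2 s ⟨hs.1, hs1⟩).trans hx
    · change κ (H (1, x)) = _
      rw [h1, hb]
  · exact isPreconnected_Icc.image _ (hH.comp (by fun_prop) fun s hs => ⟨hs, hx.ge⟩)

lemma contractible_star (h : Conic κ) (A : Set L) (x₀ : X) (hx₀ : κ x₀ ∈ A) :
    ContractibleSpace ↥(κ ⁻¹' (A ∩ {a | κ x₀ ≤ a})) := by
  obtain ⟨b, hb, H, hH, hH'⟩ := h.contract x₀
  set S := κ ⁻¹' (A ∩ {a | κ x₀ ≤ a}) with hS
  have hbS : b ∈ S := by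
    change κ b ∈ A ∧ κ x₀ ≤ κ b
    rw [hb]
    exact ⟨hx₀, le_rfl⟩
  have hHS : ∀ s ∈ Set.Icc (0 : ℝ) 1, ∀ x ∈ S, H (s, x) ∈ S := fun s hs x hx => by
    obtain ⟨h0, h1, h2⟩ := hH' x hx.2
    rcases hs.2.lt_or_eq with hs1 | rfl
    · change κ (H (s, x)) ∈ A ∩ {a | κ x₀ ≤ a}
      rw [h2 s ⟨hs.1, hs1⟩]
      exact hx
    · rwa [h1]
  have hc : Continuous fun q : unitInterval × S => H (q.1.1, q.2.1) :=
    hH.comp_continuous (by fun_prop) fun q => ⟨q.1.2, q.2.2.2⟩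
  rw [contractible_iff_id_nullhomotopic]
  refine ⟨⟨b, hbS⟩, ⟨?_⟩⟩
  exact
    { toFun := fun q => ⟨H (q.1.1, q.2.1), hHS _ q.1.2 _ q.2.2⟩
      continuous_toFun := hc.subtype_mk _
      map_zero_left := fun x => Subtype.ext (hH' x x.2.2).1
      map_one_left := fun x => Subtype.ext (hH' x x.2.2).2.1 }

theorem finHomology_of_isUpperSet [Finite L] (h : Conic κ) (A I : Set L) (hI : IsUpperSet I) :
    FinHomology ↥(κ ⁻¹' (A ∩ I)) := by
  induction hn : I.ncard using Nat.strong_induction_on generalizing I with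
  | _ n ih =>
  subst hn
  by_cases hne : (κ ⁻¹' (A ∩ I)).Nonempty
  swap
  · have := Set.not_nonempty_iff_eq_empty.1 hne
    rw [this]
    exact FinHomology.of_isEmpty
  have hfin : (κ '' (κ ⁻¹' (A ∩ I))).Finite := Set.toFinite _
  obtain ⟨_, ⟨x₀, hx₀, rfl⟩, hmin⟩ := hfin.exists_minimal (hne.image κ)
  set c := κ x₀ with hc
  set I₁ := I ∩ {a | ¬ a ≤ c} with hI₁
  set I₂ := {a | c ≤ a} with hI₂
  have hu₁ : IsUpperSet I₁ := fun a b hab ha => ⟨hI hab ha.1, fun hb => ha.2 (hab.trans hb)⟩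
  have hu₂ : IsUpperSet I₂ := fun a b hab ha => le_trans ha hab
  have hu₁₂ : IsUpperSet (I₁ ∩ I₂) := hu₁.inter hu₂
  have hcI : c ∈ I := hx₀.2
  have h2I : I₂ ⊆ I := fun a ha => hI ha hcI
  have hlt₁ : I₁.ncard < I.ncard := Set.ncard_lt_ncard
    ⟨Set.inter_subset_left, fun hsub => (hsub hcI).2 le_rfl⟩ (Set.toFinite _)
  have hlt₁₂ : (I₁ ∩ I₂).ncard < I.ncard :=
    (Set.ncard_le_ncard Set.inter_subset_left (Set.toFinite _)).trans_lt hlt₁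
  have hcap : κ ⁻¹' (A ∩ I₁) ∩ κ ⁻¹' (A ∩ I₂) = κ ⁻¹' (A ∩ (I₁ ∩ I₂)) := by
    ext x; simp only [Set.mem_inter_iff, Set.mem_preimage]; tauto
  have hun : κ ⁻¹' (A ∩ I₁) ∪ κ ⁻¹' (A ∩ I₂) = κ ⁻¹' (A ∩ I) := by
    ext x
    constructor
    · rintro (hx | hx)
      exacts [⟨hx.1, hx.2.1⟩, ⟨hx.1, h2I hx.2⟩]
    · intro hx
      by_cases hxc : κ x ≤ c
      · exact Or.inr ⟨hx.1, hmin ⟨x, hx, rfl⟩ hxc⟩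
      · exact Or.inl ⟨hx.1, hx.2, hxc⟩
  have op : ∀ J : Set L, IsUpperSet J → J ⊆ I →
      ∃ O, IsOpen O ∧ κ ⁻¹' (A ∩ J) = κ ⁻¹' (A ∩ I) ∩ O := fun J hJ hJI => by
    refine ⟨κ ⁻¹' J, h.isOpen_preimage hJ, ?_⟩
    ext x
    exact ⟨fun hx => ⟨⟨hx.1, hJI hx.2⟩, hx.2⟩, fun hx => ⟨hx.1.1, hx.2⟩⟩
  refine (mayerVietoris_subset (op I₁ hu₁ Set.inter_subset_left) (op I₂ hu₂ h2I) hun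
    (ih _ hlt₁ _ hu₁ rfl) ?_ ?_).1
  · have := h.contractible_star A x₀ hx₀.1
    exact FinHomology.of_contractible
  · rw [hcap]
    exact ih _ hlt₁₂ _ hu₁₂ rfl

/-- Unions of strata have finite dimensional total homology. -/
theorem finHomology [Finite L] (h : Conic κ) (A : Set L) : FinHomology ↥(κ ⁻¹' A) := by
  have := h.finHomology_of_isUpperSet A Set.univ isUpperSet_univ
  rwa [Set.inter_univ] at this

lemma comp_homeomorph {Y : Type} [TopologicalSpace Y] (h : Conic κ) (e : Y ≃ₜ X) :
    Conic (κ ∘ e) where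
  isOpen_star c := (h.isOpen_star c).preimage e.continuous
  contract y₀ := by
    obtain ⟨b, hb, H, hH, hH'⟩ := h.contract (e y₀)
    refine ⟨e.symm b, by simpa using hb, fun q => e.symm (H (q.1, e q.2)), ?_, fun y hy => ?_⟩
    · refine e.symm.continuous.comp_continuousOn (hH.comp (by fun_prop) fun q hq => ?_)
      exact ⟨hq.1, hq.2⟩
    · obtain ⟨h0, h1, h2⟩ := hH' (e y) hy
      exact ⟨by simp [h0], by simp [h1], fun s hs => by simpa using h2 s hs⟩

end Conic

/-! ### Piecewise linear transport of the real line -/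

lemma sign_sub_eq_sign_sub {a b t u : ℝ} (h₁ : a < t → b < u) (h₂ : a = t → b = u)
    (h₃ : t < a → u < b) : SignType.sign (u - b) = SignType.sign (t - a) := by
  rcases lt_trichotomy a t with h | h | h
  · rw [sign_pos (sub_pos.2 h), sign_pos (sub_pos.2 (h₁ h))]
  · rw [h, h₂ h, sub_self, sub_self]
  · rw [sign_neg (sub_neg.2 h), sign_neg (sub_neg.2 (h₃ h))]

/-- Truncation of a real number to the unit interval. -/
noncomputable def unitClamp (x : ℝ) : ℝ := max 0 (min 1 x)

lemma unitClamp_of_nonpos {x : ℝ} (h : x ≤ 0) : unitClamp x = 0 := by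
  simp [unitClamp, h]

lemma unitClamp_of_one_le {x : ℝ} (h : 1 ≤ x) : unitClamp x = 1 := by
  simp [unitClamp, h]

lemma unitClamp_of_mem {x : ℝ} (h₀ : 0 ≤ x) (h₁ : x ≤ 1) : unitClamp x = x := by
  simp [unitClamp, h₀, h₁]

lemma abs_unitClamp_le (x : ℝ) : |unitClamp x| ≤ 1 := by
  rw [unitClamp, abs_of_nonneg (le_max_left _ _)]
  exact max_le zero_le_one (min_le_left _ _)

lemma continuous_unitClamp : Continuous unitClamp := by
  unfold unitClamp; fun_prop

/-- The piecewise linear map of slope one outside `[a 0, a d]` which sends `a i` to `b i`. -/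
noncomputable def plMap (a b : ℕ → ℝ) (t : ℝ) : ℕ → ℝ
  | 0 => b 0 + (t - a 0)
  | d + 1 => plMap a b t d + (b (d + 1) - b d) * unitClamp ((t - a d) / (a (d + 1) - a d))
      + (max (t - a (d + 1)) 0 - max (t - a d) 0)

section

variable {a b : ℕ → ℝ} {t : ℝ}

lemma plMap_succ_of_le (ha : Monotone a) {d : ℕ} (h : t ≤ a d) :
    plMap a b t (d + 1) = plMap a b t d := by
  have h1 := ha d.le_succ
  rw [plMap, unitClamp_of_nonpos (div_nonpos_of_nonpos_of_nonneg (by linarith) (by linarith)),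
    max_eq_right (by linarith), max_eq_right (by linarith)]
  ring

lemma plMap_of_le (ha : Monotone a) (hab : ∀ i, a i = a (i + 1) → b i = b (i + 1)) {d : ℕ}
    (h : a d ≤ t) : plMap a b t d = b d + (t - a d) := by
  induction d with
  | zero => rfl
  | succ d ih =>
    have h1 := ha d.le_succ
    rw [plMap, ih (h1.trans h), max_eq_left (by linarith), max_eq_left (by linarith)]
    rcases h1.eq_or_lt with he | hl
    · rw [← hab d he]; ring
    · rw [unitClamp_of_one_le ((one_le_div (by linarith)).2 (by linarith))]; ring

lemma plMap_self (ha : Monotone a) (d : ℕ) : plMap a a t d = t := by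
  induction d with
  | zero => simp [plMap]
  | succ d ih =>
    have h1 := ha d.le_succ
    rcases le_total t (a d) with h | h
    · rw [plMap_succ_of_le ha h, ih]
    rcases le_total t (a (d + 1)) with h' | h'
    · rw [plMap, ih, max_eq_right (by linarith), max_eq_left (by linarith)]
      rcases h1.eq_or_lt with he | hl
      · rw [← he]; linarith
      · rw [unitClamp_of_mem (div_nonneg (by linarith) (by linarith))
          ((div_le_one (by linarith)).2 (by linarith)), mul_div_cancel₀ _ (by linarith)]
        ring
    · rw [plMap_of_le ha (fun _ h => h) h']; ring

lemma sign_plMap (ha : Monotone a) (hb : Monotone b) (hab : ∀ i, a i = a (i + 1) ↔ b i = b (i + 1))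
    {d i : ℕ} (hi : i ≤ d) :
    SignType.sign (plMap a b t d - b i) = SignType.sign (t - a i) := by
  induction d generalizing i with
  | zero =>
    obtain rfl : i = 0 := by omega
    simp [plMap]
  | succ d ih =>
    have h1 := ha d.le_succ
    have h2 := hb d.le_succ
    have h3 : a d < a (d + 1) ↔ b d < b (d + 1) := by
      rw [h1.lt_iff_ne, h2.lt_iff_ne, Ne, Ne, hab]
    rcases le_or_gt t (a d) with h | h
    · rw [plMap_succ_of_le ha h]
      rcases Nat.lt_or_eq_of_le hi with hi | rfl
      · exact ih (by omega)
      refine sign_sub_eq_sign_sub (fun h' => ?_) (fun h' => ?_) (fun h' => ?_)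
      · linarith
      · rw [plMap_of_le ha (fun i => (hab i).1) (by linarith), ← (hab d).1 (by linarith)]
        linarith
      · rcases h.eq_or_lt with he | hl
        · rw [plMap_of_le ha (fun i => (hab i).1) he.ge, he]
          have := h3.1 (by linarith)
          linarith
        · have := ih le_rfl
          rw [sign_neg (sub_neg.2 hl), sign_eq_neg_one_iff] at this
          linarith
    · have key : plMap a b t (d + 1) = b d
          + ((b (d + 1) - b d) * unitClamp ((t - a d) / (a (d + 1) - a d))
            + max (t - a (d + 1)) 0) := by
        rw [plMap, plMap_of_le ha (fun i => (hab i).1) h.le,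
          max_eq_left (a := t - a d) (by linarith)]
        ring
      rcases Nat.lt_or_eq_of_le hi with hi | rfl
      · have ha' := ha (show i ≤ d by omega)
        have hb' := hb (show i ≤ d by omega)
        rw [sign_pos (a := t - a i) (by linarith), sign_pos]
        rw [key]
        rcases lt_or_ge (a (d + 1)) t with h' | h'
        · rw [max_eq_left (by linarith)]
          have : 0 ≤ (b (d + 1) - b d) * unitClamp ((t - a d) / (a (d + 1) - a d)) :=
            mul_nonneg (by linarith) (le_max_left _ _)
          linarith
        · have h4 : 0 < (t - a d) / (a (d + 1) - a d) := div_pos (by linarith) (by linarith)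
          have := h3.1 (by linarith)
          rw [max_eq_right (by linarith), unitClamp_of_mem h4.le
            ((div_le_one (by linarith)).2 (by linarith))]
          have := mul_pos (sub_pos.2 this) h4
          linarith
      · rcases le_or_gt (a (d + 1)) t with h' | h'
        · rw [plMap_of_le ha (fun i => (hab i).1) h']
          congr 1; ring
        · have h4 : 0 ≤ (t - a d) / (a (d + 1) - a d) := div_nonneg (by linarith) (by linarith)
          have h5 : (t - a d) / (a (d + 1) - a d) < 1 := (div_lt_one (by linarith)).2 (by linarith)
          have := h3.1 (by linarith)
          rw [sign_neg (a := t - a (d + 1)) (by linarith), sign_neg]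
          rw [key, max_eq_right (by linarith), unitClamp_of_mem h4 h5.le]
          have := mul_lt_mul_of_pos_left h5 (sub_pos.2 this)
          linarith

lemma ContinuousOn.plMap {Z : Type*} [TopologicalSpace Z] {S : Set Z} {a b : Z → ℕ → ℝ} {t : Z → ℝ}
    (ha : ∀ i, ContinuousOn (fun z => a z i) S) (hb : ∀ i, ContinuousOn (fun z => b z i) S)
    (ht : ContinuousOn t S) (hab : ∀ z ∈ S, ∀ i, a z i = a z (i + 1) → b z i = b z (i + 1))
    (d : ℕ) : ContinuousOn (fun z => plMap (a z) (b z) (t z) d) S := by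
  induction d with
  | zero => exact (hb 0).add (ht.sub (ha 0))
  | succ d ih =>
    refine (ih.add ?_).add (((ht.sub (ha _)).sup continuousOn_const).sub
      ((ht.sub (ha _)).sup continuousOn_const))
    intro z hz
    have hgap : ContinuousWithinAt (fun z => b z (d + 1) - b z d) S z := ((hb _).sub (hb _)) z hz
    by_cases h : a z d = a z (d + 1)
    · have h0 : b z (d + 1) - b z d = 0 := by rw [hab z hz d h, sub_self]
      change Filter.Tendsto _ _ _
      beta_reduce
      rw [h0, zero_mul]
      have hgap' : Filter.Tendsto (fun z => |b z (d + 1) - b z d|) (nhdsWithin z S) (nhds 0) := by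
        have := hgap.abs
        change Filter.Tendsto _ _ _ at this
        beta_reduce at this
        rwa [h0, abs_zero] at this
      refine squeeze_zero_norm (fun y => ?_) hgap'
      rw [Real.norm_eq_abs, abs_mul]
      exact mul_le_of_le_one_right (abs_nonneg _) (abs_unitClamp_le _)
    · refine hgap.mul (continuous_unitClamp.continuousAt.comp_continuousWithinAt ?_)
      exact ((ht.sub (ha _)) z hz).div (((ha _).sub (ha _)) z hz) (sub_ne_zero.2 (Ne.symm h))

end

/-! ### Cylindrical stratifications -/

lemma exists_position (a : ℕ → ℝ) (d : ℕ) (t : ℝ) :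
    (∃ j k, j ≤ d ∧ k ≤ d ∧ a j = t ∧ a k = t ∧ ∀ i ≤ d, a i = t → j ≤ i ∧ i ≤ k) ∨
      t < a 0 ∨ a d < t ∨ ∃ j < d, a j < t ∧ t < a (j + 1) := by
  by_cases h : ∃ i ≤ d, a i = t
  · left
    have hne : ((Finset.range (d + 1)).filter fun i => a i = t).Nonempty := by
      obtain ⟨i, hi, h⟩ := h
      exact ⟨i, by simp [h]; omega⟩
    have h1 := Finset.min'_mem _ hne
    have h2 := Finset.max'_mem _ hne
    simp only [Finset.mem_filter, Finset.mem_range] at h1 h2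
    refine ⟨_, _, by omega, by omega, h1.2, h2.2, fun i hi hi' => ?_⟩
    have : i ∈ (Finset.range (d + 1)).filter fun i => a i = t := by
      simp [hi']; omega
    exact ⟨Finset.min'_le _ _ this, Finset.le_max' _ _ this⟩
  · right
    push Not at h
    by_contra! hc
    obtain ⟨h0, h1, h2⟩ := hc
    have : ∀ i ≤ d, a i < t := fun i => by
      induction i with
      | zero => exact fun hi => lt_of_le_of_ne h0 (h 0 hi)
      | succ i ih => exact fun hi => lt_of_le_of_ne (h2 i (by omega) (ih (by omega))) (h _ hi)
    exact absurd (this d le_rfl) (not_lt.2 h1)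

section

variable {X L : Type} [TopologicalSpace X] {κ : X → L} {ξ : ℕ → X → ℝ}

lemma exists_sections (hξ : ∀ i, Continuous (ξ i)) (hm : ∀ x, Monotone fun i => ξ i x)
    (hp : ∀ x y, κ x = κ y → ∀ i j, ξ i x = ξ j x → ξ i y = ξ j y) (d : ℕ) (x₀ : X) (t : ℝ) :
    ∃ l h : X → ℝ, Continuous l ∧ Continuous h ∧ (∀ y, l y ≤ h y) ∧
      (∀ i ≤ d, ξ i x₀ < t → ∀ y, ξ i y ≤ l y) ∧ (∀ i ≤ d, t < ξ i x₀ → ∀ y, h y ≤ ξ i y) ∧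
      (∀ i ≤ d, ξ i x₀ = t → ∀ y, l y ≤ ξ i y ∧ ξ i y ≤ h y) ∧
      ∀ y, κ y = κ x₀ → l y = h y ∧
        ∀ i ≤ d, SignType.sign (l y - ξ i y) = SignType.sign (t - ξ i x₀) := by
  have hs : ∀ y, κ y = κ x₀ → ∀ i j, ξ i x₀ < ξ j x₀ → ξ i y < ξ j y := fun y hy i j hij => by
    have hij' : i ≤ j := by
      by_contra hc
      exact absurd (hm x₀ (le_of_not_ge hc)) (not_le.2 hij)
    exact lt_of_le_of_ne (hm y hij') fun he => hij.ne (hp y x₀ hy i j he)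
  have idx : ∀ i j, ξ i x₀ < ξ j x₀ → ∀ y, ξ i y ≤ ξ j y := fun i j hij y => by
    refine hm y ?_
    by_contra hc
    exact absurd (hm x₀ (le_of_not_ge hc)) (not_le.2 hij)
  rcases exists_position (fun i => ξ i x₀) d t with
    ⟨j, k, hj, hk, hjt, hkt, hjk⟩ | h | h | ⟨j, hj, h1, h2⟩
  · refine ⟨ξ j, ξ k, hξ j, hξ k, fun y => hm y (hjk k hk hkt).1, ?_, ?_, ?_, ?_⟩
    · exact fun i hi hit y => idx i j (hit.trans_eq hjt.symm) y
    · exact fun i hi hit y => idx k i (hkt.trans_lt hit) y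
    · exact fun i hi hit y => ⟨hm y (hjk i hi hit).1, hm y (hjk i hi hit).2⟩
    · refine fun y hy => ⟨hp x₀ y hy.symm j k (hjt.trans hkt.symm), fun i hi => ?_⟩
      refine sign_sub_eq_sign_sub (fun h => ?_) (fun h => ?_) (fun h => ?_)
      · exact hs y hy i j (h.trans_eq hjt.symm)
      · exact hp x₀ y hy.symm i j (h.trans hjt.symm)
      · exact hs y hy j i (hjt.trans_lt h)
  · have hlt : ∀ i, t < ξ i x₀ := fun i => h.trans_le (hm x₀ (Nat.zero_le i))
    refine ⟨fun y => ξ 0 y - 1, fun y => ξ 0 y - 1, by fun_prop, by fun_prop, fun y => le_rfl,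
      ?_, ?_, ?_, ?_⟩
    · exact fun i hi hit => absurd hit (hlt i).not_gt
    · intro i hi hit y
      have : ξ 0 y ≤ ξ i y := hm y (Nat.zero_le i)
      linarith
    · exact fun i hi hit => absurd hit (hlt i).ne'
    · refine fun y hy => ⟨rfl, fun i hi => ?_⟩
      have : ξ 0 y ≤ ξ i y := hm y (Nat.zero_le i)
      rw [sign_neg (sub_neg.2 (hlt i)), sign_neg (by linarith)]
  · have hlt : ∀ i ≤ d, ξ i x₀ < t := fun i hi => (hm x₀ hi).trans_lt h
    refine ⟨fun y => ξ d y + 1, fun y => ξ d y + 1, by fun_prop, by fun_prop, fun y => le_rfl,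
      ?_, ?_, ?_, ?_⟩
    · intro i hi hit y
      have : ξ i y ≤ ξ d y := hm y hi
      linarith
    · exact fun i hi hit => absurd hit (hlt i hi).not_gt
    · exact fun i hi hit => absurd hit (hlt i hi).ne
    · refine fun y hy => ⟨rfl, fun i hi => ?_⟩
      have : ξ i y ≤ ξ d y := hm y hi
      rw [sign_pos (sub_pos.2 (hlt i hi)), sign_pos (by linarith)]
  · have hlo : ∀ i ≤ j, ξ i x₀ < t := fun i hi => (hm x₀ hi).trans_lt h1
    have hhi : ∀ i, j + 1 ≤ i → t < ξ i x₀ := fun i hi => h2.trans_le (hm x₀ hi)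
    have mono : ∀ y, ∀ {i k}, i ≤ k → ξ i y ≤ ξ k y := fun y i k h => hm y h
    refine ⟨fun y => (ξ j y + ξ (j + 1) y) / 2, fun y => (ξ j y + ξ (j + 1) y) / 2,
      by fun_prop, by fun_prop, fun y => le_rfl, ?_, ?_, ?_, ?_⟩
    · intro i hi hit y
      have hij : i ≤ j := by
        by_contra hc
        exact absurd (hhi i (by omega)) hit.not_gt
      linarith [mono y hij, mono y j.le_succ]
    · intro i hi hit y
      have hij : j + 1 ≤ i := by
        by_contra hc
        exact absurd (hlo i (by omega)) hit.not_gt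
      linarith [mono y hij, mono y j.le_succ]
    · intro i hi hit
      rcases le_or_gt i j with hij | hij
      · exact absurd hit (hlo i hij).ne
      · exact absurd hit (hhi i hij).ne'
    · refine fun y hy => ⟨rfl, fun i hi => ?_⟩
      have := hs y hy j (j + 1) (h1.trans h2)
      rcases le_or_gt i j with hij | hij
      · rw [sign_pos (sub_pos.2 (hlo i hij)), sign_pos (by linarith [mono y hij])]
      · rw [sign_neg (sub_neg.2 (hhi i hij)),
          sign_neg (by linarith [mono y (show j + 1 ≤ i from hij)])]

/-- Labels of a cylinder: a label of the base and the position relative to `d + 1` graphs. -/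
structure CylLabel (L : Type) (d : ℕ) where
  /-- The label of the base. -/
  base : L
  /-- The position relative to the graphs. -/
  pos : Fin (d + 1) → SignType

instance (L : Type) [Finite L] (d : ℕ) : Finite (CylLabel L d) :=
  Finite.of_injective (fun c => (c.base, c.pos)) fun c c' h => by
    cases c; cases c'; simp_all

instance (L : Type) [Preorder L] (d : ℕ) : Preorder (CylLabel L d) where
  le c c' := c.base ≤ c'.base ∧ ∀ i, c.pos i ≠ 0 → c'.pos i = c.pos i
  le_refl c := ⟨le_rfl, fun _ _ => rfl⟩
  le_trans a b c hab hbc := ⟨hab.1.trans hbc.1, fun i hi => by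
    have := hab.2 i hi
    rw [hbc.2 i (this ▸ hi), this]⟩

variable [Preorder L]

/-- The labelling of a cylinder by the base and the position relative to graphs. -/
noncomputable def cylLabel {X L : Type} (κ : X → L) (ξ : ℕ → X → ℝ) (d : ℕ)
    (q : X × ℝ) : CylLabel L d :=
  ⟨κ q.1, fun i => SignType.sign (q.2 - ξ i q.1)⟩

lemma sign_combination {s u v c : ℝ} (hs : s ∈ Set.Ico (0 : ℝ) 1) (h₁ : c < u → c ≤ v)
    (h₂ : c = u → c = v) (h₃ : u < c → v ≤ c) :
    SignType.sign ((1 - s) * u + s * v - c) = SignType.sign (u - c) := by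
  obtain ⟨h0, h1⟩ := hs
  refine sign_sub_eq_sign_sub (fun h => ?_) (fun h => ?_) (fun h => ?_)
  · nlinarith [mul_nonneg h0 (sub_nonneg.2 (h₁ h)), mul_pos (sub_pos.2 h1) (sub_pos.2 h)]
  · rw [← h₂ h, ← h]; ring
  · nlinarith [mul_nonneg h0 (sub_nonneg.2 (h₃ h)), mul_pos (sub_pos.2 h1) (sub_pos.2 h)]

/-- The graphs of continuous functions whose coincidences are determined by the label cut a
cylinder over a conic stratification into a conic stratification. -/
theorem Conic.cylinder (hκ : Conic κ) (hξ : ∀ i, Continuous (ξ i))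
    (hm : ∀ x, Monotone fun i => ξ i x)
    (hp : ∀ x y, κ x = κ y → ∀ i j, ξ i x = ξ j x → ξ i y = ξ j y) (d : ℕ) :
    Conic (cylLabel κ ξ d) where
  isOpen_star c := by
    have : {q : X × ℝ | c ≤ cylLabel κ ξ d q} = {q | c.base ≤ κ q.1} ∩
        ⋂ i : Fin (d + 1), {q | c.pos i ≠ 0 → SignType.sign (q.2 - ξ i q.1) = c.pos i} := by
      ext q
      simp only [Set.mem_inter_iff, Set.mem_iInter]
      exact Iff.rfl
    rw [this]
    refine ((hκ.isOpen_star c.base).preimage continuous_fst).inter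
      (isOpen_iInter_of_finite fun i => ?_)
    have := hξ i
    rcases hc : c.pos i with _ | _ | _
    · simp
    · simp only [SignType.neg_eq_neg_one, sign_eq_neg_one_iff]
      simp only [ne_eq, reduceCtorEq, not_false_eq_true, forall_const]
      exact isOpen_lt (by fun_prop) continuous_const
    · simp only [SignType.pos_eq_one, sign_eq_one_iff]
      simp only [ne_eq, one_ne_zero, not_false_eq_true, forall_const]
      exact isOpen_lt continuous_const (by fun_prop)
  contract := by
    rintro ⟨x₀, t₀⟩
    obtain ⟨b, hb, H, hH, hH'⟩ := hκ.contract x₀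
    obtain ⟨l, h, hl, hh, hlh, hlo, hhi, hmid, hbase⟩ := exists_sections hξ hm hp d x₀ t₀
    set u : ℝ × X × ℝ → ℝ := fun z =>
      plMap (fun i => ξ i z.2.1) (fun i => ξ i (H (z.1, z.2.1))) z.2.2 d with hu
    set v : ℝ × X × ℝ → ℝ := fun z =>
      max (l (H (z.1, z.2.1))) (min (h (H (z.1, z.2.1))) (u z)) with hv
    set S : Set (ℝ × X × ℝ) :=
      Set.Icc (0 : ℝ) 1 ×ˢ {q : X × ℝ | cylLabel κ ξ d (x₀, t₀) ≤ cylLabel κ ξ d q} with hS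
    have hHS : ContinuousOn (fun z : ℝ × X × ℝ => H (z.1, z.2.1)) S :=
      hH.comp (f := fun z : ℝ × X × ℝ => (z.1, z.2.1)) (by fun_prop) fun z hz => ⟨hz.1, hz.2.1⟩
    have hpat : ∀ z ∈ S, ∀ i, ξ i z.2.1 = ξ (i + 1) z.2.1 →
        ξ i (H (z.1, z.2.1)) = ξ (i + 1) (H (z.1, z.2.1)) := by
      rintro ⟨s, y, t⟩ ⟨hs, hy⟩ i hi
      change ξ i (H (s, y)) = ξ (i + 1) (H (s, y))
      have hpath : ContinuousOn (fun s => H (s, y)) (Set.Icc 0 1) :=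
        hH.comp (f := fun s => (s, y)) (by fun_prop) fun s hs => ⟨hs, hy.1⟩
      have hsub : Set.Icc (0 : ℝ) 1 ⊆ closure (Set.Ico 0 1) := by
        rw [closure_Ico zero_ne_one]
      exact Set.EqOn.of_subset_closure
        (f := fun s => ξ i (H (s, y))) (g := fun s => ξ (i + 1) (H (s, y))) (s := Set.Ico 0 1)
        (fun s hs => hp y _ ((hH' y hy.1).2.2 s hs).symm i (i + 1) hi)
        ((hξ i).comp_continuousOn hpath) ((hξ (i + 1)).comp_continuousOn hpath)
        Set.Ico_subset_Icc_self hsub hs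
    have hcu : ContinuousOn u S := by
      refine ContinuousOn.plMap (fun i => ?_) (fun i => (hξ i).comp_continuousOn hHS) ?_ hpat d
      · exact ((hξ i).comp (by fun_prop : Continuous fun z : ℝ × X × ℝ => z.2.1)).continuousOn
      · fun_prop
    have hcv : ContinuousOn v S :=
      (hl.comp_continuousOn hHS).sup ((hh.comp_continuousOn hHS).inf hcu)
    have hl1 : l b = h b := (hbase b hb).1
    refine ⟨(b, l b), ?_, fun z => (H (z.1, z.2.1), (1 - z.1) * u z + z.1 * v z), ?_, ?_⟩
    · simp only [cylLabel, hb, CylLabel.mk.injEq, true_and]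
      funext i
      exact (hbase b hb).2 i (Nat.lt_succ_iff.1 i.2)
    · exact hHS.prodMk (((continuousOn_const.sub continuousOn_fst).mul hcu).add
        (continuousOn_fst.mul hcv))
    · rintro ⟨y, t⟩ hq
      obtain ⟨h0, h1, h2⟩ := hH' y hq.1
      refine ⟨?_, ?_, fun s hs => ?_⟩
      · simp only [h0, hu, sub_zero, one_mul, zero_mul, add_zero]
        rw [plMap_self (hm y)]
      · simp only [h1, hv, ← hl1, sub_self, zero_mul, one_mul, zero_add]
        rw [max_eq_left (min_le_left _ _)]
      · have hκs := h2 s hs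
        have hsgn : ∀ i ≤ d, SignType.sign (u (s, y, t) - ξ i (H (s, y)))
            = SignType.sign (t - ξ i y) := fun i hi =>
          sign_plMap (hm y) (hm _) (fun i => ⟨hp _ _ hκs.symm _ _, hp _ _ hκs _ _⟩) hi
        simp only [cylLabel, hκs, CylLabel.mk.injEq, true_and]
        funext ⟨i, hi⟩
        have hi' : i ≤ d := Nat.lt_succ_iff.1 hi
        rw [← hsgn i hi']
        have hle := hlh (H (s, y))
        have hq' := hq.2 ⟨i, hi⟩
        simp only [cylLabel] at hq'
        rw [← hsgn i hi'] at hq'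
        refine sign_combination hs (fun hc => ?_) (fun hc => ?_) (fun hc => ?_)
        all_goals
          rcases lt_trichotomy (ξ i x₀) t₀ with h3 | h3 | h3
          · have h4 := hlo i hi' h3 (H (s, y))
            rw [sign_pos (sub_pos.2 h3)] at hq'
            have h5 := sub_pos.1 (sign_eq_one_iff.1 (hq' one_ne_zero))
            first
            | exact h4.trans (le_max_left _ _)
            | linarith
          · obtain ⟨h4, h5⟩ := hmid i hi' h3 (H (s, y))
            simp only [hv]
            first
            | exact le_max_of_le_right (le_min h5 hc.le)
            | (rw [min_eq_right (hc ▸ h5), max_eq_right (hc ▸ h4)]; exact hc)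
            | exact max_le h4 ((min_le_right _ _).trans hc.le)
          · have h4 := hhi i hi' h3 (H (s, y))
            rw [sign_neg (sub_neg.2 h3)] at hq'
            have h5 := sub_neg.1 (sign_eq_neg_one_iff.1 (hq' (by decide)))
            first
            | linarith
            | exact max_le (hle.trans h4) ((min_le_left _ _).trans h4)

end

section

open Filter Topology

/-- The monic polynomial with a given tuple of roots. -/
noncomputable def rootPoly {D : ℕ} (w : Fin D → ℂ) : Polynomial ℂ :=
  ∏ i, (Polynomial.X - Polynomial.C (w i))

lemma rootPoly_eval {D : ℕ} (w : Fin D → ℂ) (a : ℂ) : (rootPoly w).eval a = ∏ i, (a - w i) := by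
  simp [rootPoly, Polynomial.eval_prod]

lemma rootPoly_roots {D : ℕ} (w : Fin D → ℂ) :
    (rootPoly w).roots = (Finset.univ : Finset (Fin D)).val.map w := by
  rw [← Polynomial.roots_multiset_prod_X_sub_C ((Finset.univ : Finset (Fin D)).val.map w),
    Multiset.map_map]
  rfl

lemma rootPoly_eval_eq_zero {D : ℕ} (w : Fin D → ℂ) (a : ℂ) :
    (rootPoly w).eval a = 0 ↔ ∃ i, w i = a := by
  rw [rootPoly_eval, Finset.prod_eq_zero_iff]
  simp only [Finset.mem_univ, true_and, sub_eq_zero, eq_comm]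

lemma exists_perm_of_rootPoly_eq {D : ℕ} {z w : Fin D → ℂ} (h : rootPoly z = rootPoly w) :
    ∃ σ : Equiv.Perm (Fin D), z = w ∘ σ := by
  have h1 := congrArg Polynomial.roots h
  rw [rootPoly_roots, rootPoly_roots] at h1
  have h2 : ∀ c, Nonempty ({i // z i = c} ≃ {i // w i = c}) := by
    intro c
    have h3 := congrArg (Multiset.count c) h1
    rw [Multiset.count_map, Multiset.count_map] at h3
    apply Fintype.card_eq.mp
    rw [Fintype.card_subtype, Fintype.card_subtype]
    simp only [eq_comm (b := c)]
    exact h3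
  have e := fun c => (h2 c).some
  refine ⟨Equiv.ofFiberEquiv e, ?_⟩
  ext1 i
  exact (Equiv.ofFiberEquiv_map e i).symm

lemma rootPoly_comp_perm {D : ℕ} (w : Fin D → ℂ) (σ : Equiv.Perm (Fin D)) :
    rootPoly (w ∘ σ) = rootPoly w :=
  Equiv.prod_comp σ fun i => (Polynomial.X - Polynomial.C (w i))

lemma exists_rootPoly_eq {D : ℕ} {p : Polynomial ℂ} (hp : p.Monic) (hD : p.natDegree = D) :
    ∃ w : Fin D → ℂ, rootPoly w = p := by
  have hs := IsAlgClosed.splits p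
  have hc : p.roots.toList.length = D := by
    rw [Multiset.length_toList, ← hD]
    exact (hs.natDegree_eq_card_roots).symm
  subst hc
  refine ⟨fun i => p.roots.toList.get i, ?_⟩
  have h1 := hs.eq_prod_roots_of_monic hp
  have h2 : rootPoly (fun i => p.roots.toList.get i)
      = (p.roots.toList.map fun a => Polynomial.X - Polynomial.C a).prod := by
    rw [rootPoly, ← List.prod_ofFn]
    congr 1
    apply List.ext_get
    · simp
    · intro n _ _
      simp
  rw [h2]
  conv_rhs => rw [h1, ← Multiset.coe_toList p.roots, Multiset.map_coe, Multiset.prod_coe]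

lemma exists_sorted_rootPoly_eq {D : ℕ} {p : Polynomial ℂ} (hp : p.Monic) (hD : p.natDegree = D) :
    ∃ w : Fin D → ℂ, rootPoly w = p ∧ Monotone fun i => (w i).re := by
  obtain ⟨w, hw⟩ := exists_rootPoly_eq hp hD
  refine ⟨w ∘ Tuple.sort (fun i => (w i).re), by rw [rootPoly_comp_perm, hw], ?_⟩
  exact Tuple.monotone_sort (fun i => (w i).re)

lemma re_eq_of_rootPoly_eq {D : ℕ} {z w : Fin D → ℂ} (h : rootPoly z = rootPoly w)
    (hz : Monotone fun i => (z i).re) (hw : Monotone fun i => (w i).re) (i : Fin D) :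
    (z i).re = (w i).re := by
  obtain ⟨σ, rfl⟩ := exists_perm_of_rootPoly_eq h
  have := Tuple.unique_monotone (f := fun i => (w i).re) (σ := σ) (τ := 1) hz hw
  exact congrFun this i

lemma rootPoly_monic {D : ℕ} (w : Fin D → ℂ) : (rootPoly w).Monic :=
  Polynomial.monic_prod_of_monic _ _ fun i _ => Polynomial.monic_X_sub_C (w i)

lemma rootPoly_natDegree {D : ℕ} (w : Fin D → ℂ) : (rootPoly w).natDegree = D := by
  rw [rootPoly, Polynomial.natDegree_prod_of_monic _ _ fun i _ => Polynomial.monic_X_sub_C (w i)]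
  simp

lemma Ultrafilter.eventually_const {X α : Type*} [Finite α] (F : Ultrafilter X) (m : X → α) :
    ∃ a, ∀ᶠ y in (F : Filter X), m y = a := by
  obtain ⟨a, ha⟩ := (F.map m).eq_pure_of_finite
  refine ⟨a, ?_⟩
  have : {a} ∈ F.map m := by rw [ha]; exact Ultrafilter.mem_pure.mpr rfl
  exact this

/-- Roots do not escape: tuples of roots converge along ultrafilters. -/
lemma exists_tendsto_roots {X : Type*} {D : ℕ} {f : X → Polynomial ℂ} {p : Polynomial ℂ}
    {F : Ultrafilter X} (hf : ∀ k, Tendsto (fun y => (f y).coeff k) F (𝓝 (p.coeff k)))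
    (hp : p.natDegree = D)
    {w : X → Fin D → ℂ} (hw : ∀ y, rootPoly (w y) = f y) :
    ∃ v : Fin D → ℂ, Tendsto w F (𝓝 v) ∧ rootPoly v = p := by
  have hdeg : ∀ y, (f y).natDegree = D := fun y => by rw [← hw, rootPoly_natDegree]
  have hev : ∀ᶠ y in (F : Filter X), ∀ k ∈ Finset.range D, ‖(f y).coeff k‖₊ < ‖p.coeff k‖₊ + 1 := by
    rw [eventually_all_finset]
    intro k _
    exact (hf k).nnnorm.eventually_lt_const (by simp)
  set B : NNReal := (Finset.range D).sup (fun k => ‖p.coeff k‖₊ + 1) + 1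
  have hb : ∀ᶠ y in (F : Filter X), w y ∈ Metric.closedBall (0 : Fin D → ℂ) B := by
    filter_upwards [hev] with y hy
    rw [mem_closedBall_zero_iff]
    refine (pi_norm_le_iff_of_nonneg B.2).mpr fun i => ?_
    have hm : (f y).Monic := by rw [← hw]; exact rootPoly_monic _
    have h1 := Polynomial.IsRoot.norm_lt_cauchyBound (p := f y) hm.ne_zero (a := w y i)
      (by rw [← hw]; exact (rootPoly_eval_eq_zero _ _).mpr ⟨i, rfl⟩)
    refine h1.le.trans ?_
    rw [Polynomial.cauchyBound, hm.leadingCoeff, hdeg]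
    simp only [nnnorm_one, div_one]
    norm_cast
    refine add_le_add (Finset.sup_mono_fun fun k hk => (hy k hk).le) le_rfl
  obtain ⟨v, -, hv⟩ := (isCompact_closedBall (0 : Fin D → ℂ) B).ultrafilter_le_nhds (F.map w)
    (by rw [le_principal_iff]; exact hb)
  refine ⟨v, hv, ?_⟩
  apply Polynomial.funext
  intro a
  have h1 : Tendsto (fun y => (f y).eval a) F (𝓝 (p.eval a)) := by
    simp_rw [Polynomial.eval_eq_sum_range, hdeg, hp]
    exact tendsto_finsetSum _ fun k _ => (hf k).mul_const _
  have h2 : Tendsto (fun y => (f y).eval a) F (𝓝 ((rootPoly v).eval a)) := by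
    simp_rw [← hw, rootPoly_eval]
    have hv' : Tendsto w F (𝓝 v) := hv
    exact tendsto_finsetProd _ fun i _ => tendsto_const_nhds.sub ((tendsto_pi_nhds.mp hv') i)
  exact tendsto_nhds_unique h2 h1

/-- Additive coincidences in a tuple of complex numbers. -/
noncomputable def coincidences {D : ℕ} (w : Fin D → ℂ) : Finset (Fin D × Fin D × Fin D × Fin D) :=
  Finset.univ.filter fun q => w q.1 + w q.2.1 = w q.2.2.1 + w q.2.2.2

lemma mem_coincidences {D : ℕ} {w : Fin D → ℂ} {i j k l : Fin D} :
    (i, j, k, l) ∈ coincidences w ↔ w i + w j = w k + w l := by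
  simp [coincidences]

lemma card_coincidences_comp_perm {D : ℕ} (w : Fin D → ℂ) (σ : Equiv.Perm (Fin D)) :
    (coincidences (w ∘ σ)).card = (coincidences w).card := by
  refine Finset.card_equiv (σ.prodCongr (σ.prodCongr (σ.prodCongr σ))) ?_
  rintro ⟨i, j, k, l⟩
  simp [coincidences]

/-- A continuous family of monic complex polynomials of degree `D` with real coefficients, together
with an enumeration of the roots in order of their real parts. -/
structure RootFamily {X : Type} [TopologicalSpace X] (D : ℕ) (f : X → Polynomial ℂ)
    (z : X → Fin D → ℂ) : Prop where
  continuous_coeff : ∀ k, Continuous fun y => (f y).coeff k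
  real : ∀ y k, starRingEnd ℂ ((f y).coeff k) = (f y).coeff k
  rootPoly_eq : ∀ y, rootPoly (z y) = f y
  monotone : ∀ y, Monotone fun i => (z y i).re

namespace RootFamily

variable {X : Type} [TopologicalSpace X] {D : ℕ} {f : X → Polynomial ℂ} {z : X → Fin D → ℂ}

lemma natDegree (h : RootFamily D f z) (y : X) : (f y).natDegree = D := by
  rw [← h.rootPoly_eq, rootPoly_natDegree]

lemma exists_limit (h : RootFamily D f z) (F : Ultrafilter X) (y₀ : X) (hF : ↑F ≤ 𝓝 y₀) :
    ∃ v : Fin D → ℂ, Tendsto z F (𝓝 v) ∧ rootPoly v = f y₀ ∧ ∀ i, (v i).re = (z y₀ i).re := by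
  obtain ⟨v, hv, hv'⟩ := exists_tendsto_roots
    (fun k => ((h.continuous_coeff k).tendsto y₀).mono_left hF) (h.natDegree y₀) h.rootPoly_eq
  refine ⟨v, hv, hv', fun i => re_eq_of_rootPoly_eq (hv'.trans (h.rootPoly_eq y₀).symm) ?_
    (h.monotone y₀) i⟩
  intro i j hij
  have hr : ∀ k, Tendsto (fun y => (z y k).re) F (𝓝 (v k).re) := fun k =>
    (Complex.continuous_re.tendsto _).comp ((tendsto_pi_nhds.mp hv) k)
  exact le_of_tendsto_of_tendsto' (hr i) (hr j) fun y => h.monotone y hij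

lemma continuous_re (h : RootFamily D f z) (i : Fin D) : Continuous fun y => (z y i).re := by
  rw [continuous_iff_ultrafilter]
  intro y₀ F hF
  obtain ⟨v, hv, -, hre⟩ := h.exists_limit F y₀ hF
  rw [← hre i]
  exact (Complex.continuous_re.tendsto _).comp ((tendsto_pi_nhds.mp hv) i)

lemma exists_conj (h : RootFamily D f z) (y : X) (v : Fin D → ℂ) (hv : rootPoly v = f y) :
    ∃ σ : Equiv.Perm (Fin D), ∀ i, starRingEnd ℂ (v i) = v (σ i) := by
  have h1 : rootPoly (fun i => starRingEnd ℂ (v i)) = rootPoly v := by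
    have h2 : rootPoly (fun i => starRingEnd ℂ (v i)) = (rootPoly v).map (starRingEnd ℂ) := by
      simp [rootPoly, Polynomial.map_prod]
    rw [h2, hv]
    ext k
    rw [Polynomial.coeff_map, h.real]
  obtain ⟨σ, hσ⟩ := exists_perm_of_rootPoly_eq h1
  exact ⟨σ, congrFun hσ⟩

/-- Along a set on which the number of coincidences is constant, coincidences neither appear nor
disappear in the limit, and complex conjugation acts by a constant permutation. -/
lemma exists_limit_of_card (h : RootFamily D f z) (F : Ultrafilter X) (y₀ : X) (hF : ↑F ≤ 𝓝 y₀)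
    (hc : ∀ᶠ y in (F : Filter X), (coincidences (z y)).card = (coincidences (z y₀)).card) :
    ∃ (v : Fin D → ℂ) (σ : Equiv.Perm (Fin D)), Tendsto z F (𝓝 v) ∧ rootPoly v = f y₀ ∧
      (∀ i, (v i).re = (z y₀ i).re) ∧
      (∀ᶠ y in (F : Filter X), coincidences (z y) = coincidences v) ∧
      (∀ᶠ y in (F : Filter X), ∀ i, starRingEnd ℂ (z y i) = z y (σ i)) ∧
      ∀ i, starRingEnd ℂ (v i) = v (σ i) := by
  obtain ⟨v, hv, hv', hre⟩ := h.exists_limit F y₀ hF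
  have hvi := tendsto_pi_nhds.mp hv
  choose τ hτ using fun y => h.exists_conj y (z y) (h.rootPoly_eq y)
  obtain ⟨σ, hσ⟩ := F.eventually_const τ
  obtain ⟨E, hE⟩ := F.eventually_const fun y => coincidences (z y)
  have hcard : (coincidences v).card = (coincidences (z y₀)).card := by
    obtain ⟨π, rfl⟩ := exists_perm_of_rootPoly_eq (hv'.trans (h.rootPoly_eq y₀).symm)
    exact card_coincidences_comp_perm _ _
  have hEv : E = coincidences v := by
    apply Finset.eq_of_subset_of_card_le
    · rintro ⟨i, j, k, l⟩ hq
      rw [mem_coincidences]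
      refine tendsto_nhds_unique_of_eventuallyEq ((hvi i).add (hvi j)) ((hvi k).add (hvi l)) ?_
      filter_upwards [hE] with y hy
      rw [← hy] at hq
      exact mem_coincidences.mp hq
    · obtain ⟨y, hy1, hy2⟩ := (hE.and hc).exists
      rw [hcard, ← hy2, hy1]
  subst hEv
  have hσ' : ∀ᶠ y in (F : Filter X), ∀ i, starRingEnd ℂ (z y i) = z y (σ i) := by
    filter_upwards [hσ] with y hy i
    rw [← hy, hτ]
  refine ⟨v, σ, hv, hv', hre, hE, hσ', fun i => ?_⟩
  refine tendsto_nhds_unique_of_eventuallyEq ((Complex.continuous_conj.tendsto _).comp (hvi i))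
    (hvi (σ i)) ?_
  filter_upwards [hσ'] with y hy
  exact hy i

lemma re_eq_re_iff {w : Fin D → ℂ} {σ : Equiv.Perm (Fin D)}
    (hσ : ∀ i, starRingEnd ℂ (w i) = w (σ i)) (i j : Fin D) :
    (w i).re = (w j).re ↔ (i, σ i, j, σ j) ∈ coincidences w := by
  rw [mem_coincidences, ← hσ, ← hσ, Complex.add_conj, Complex.add_conj]
  norm_cast
  constructor
  · intro h; rw [h]
  · intro h; linarith

lemma re_eq_iff_of_isPreconnected (h : RootFamily D f z) {C : Set X} (hC : IsPreconnected C)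
    (hc : ∀ y ∈ C, ∀ y' ∈ C, (coincidences (z y)).card = (coincidences (z y')).card) {y y' : X}
    (hy : y ∈ C) (hy' : y' ∈ C) (i j : Fin D) :
    (z y i).re = (z y j).re ↔ (z y' i).re = (z y' j).re := by
  have hcont : ContinuousOn (fun y => decide ((z y i).re = (z y j).re)) C := by
    intro y₀ hy₀
    rw [ContinuousWithinAt, tendsto_iff_ultrafilter]
    intro F hF
    have hFC : ∀ᶠ y in (F : Filter X), y ∈ C := hF.trans inf_le_right (mem_principal_self C)
    obtain ⟨v, σ, -, -, hre, hE, hσ, hσv⟩ := h.exists_limit_of_card F y₀ (hF.trans inf_le_left)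
      (hFC.mono fun y hy => hc y hy y₀ hy₀)
    apply tendsto_nhds_of_eventually_eq
    filter_upwards [hE, hσ] with y h1 h2
    rw [decide_eq_decide, re_eq_re_iff h2, h1, ← re_eq_re_iff hσv, hre, hre]
  exact decide_eq_decide.mp (hC.constant hcont hy hy')

/-- The zero set of a factor does not cut a connected piece of the cylinder delineated by the real
parts of the roots. -/
lemma eval_eq_zero_of_isPreconnected (h : RootFamily D f z) {E : ℕ} {g : X → Polynomial ℂ}
    (hg : ∀ k, Continuous fun y => (g y).coeff k) (hgm : ∀ y, (g y).Monic)
    (hgE : ∀ y, (g y).natDegree = E) (hgf : ∀ y, g y ∣ f y) {K : Set (X × ℝ)}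
    (hK : IsPreconnected K)
    (hc : ∀ q ∈ K, ∀ q' ∈ K, (coincidences (z q.1)).card = (coincidences (z q'.1)).card)
    (hKξ : ∀ q ∈ K, ∀ q' ∈ K, ∀ i, q.2 = (z q.1 i).re → q'.2 = (z q'.1 i).re)
    {q q' : X × ℝ} (hq : q ∈ K) (hq' : q' ∈ K) :
    (g q.1).eval (q.2 : ℂ) = 0 ↔ (g q'.1).eval (q'.2 : ℂ) = 0 := by
  classical
  have hev : Continuous fun q : X × ℝ => (g q.1).eval (q.2 : ℂ) := by
    simp_rw [Polynomial.eval_eq_sum_range, hgE]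
    exact continuous_finsetSum _ fun k _ => ((hg k).comp continuous_fst).mul
      ((Complex.continuous_ofReal.comp continuous_snd).pow _)
  choose w hw using fun y => exists_rootPoly_eq (hgm y) (hgE y)
  have hcont : ContinuousOn (fun q : X × ℝ => decide ((g q.1).eval (q.2 : ℂ) = 0)) K := by
    intro q₀ hq₀
    rw [ContinuousWithinAt, tendsto_iff_ultrafilter]
    intro F hF
    have hFK : ∀ᶠ q in (F : Filter (X × ℝ)), q ∈ K :=
      hF.trans inf_le_right (mem_principal_self K)
    apply tendsto_nhds_of_eventually_eq
    by_cases h0 : (g q₀.1).eval (q₀.2 : ℂ) = 0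
    · have hF1 : ((F.map Prod.fst : Ultrafilter X) : Filter X) ≤ 𝓝 q₀.1 :=
        (continuous_fst.tendsto q₀).mono_left (hF.trans inf_le_left)
      obtain ⟨v, σ, hv, -, hre, hE, hσ, hσv⟩ := h.exists_limit_of_card (F.map Prod.fst) q₀.1
        hF1 (hFK.mono fun q hq => hc q hq q₀ hq₀)
      obtain ⟨u, hu, hu'⟩ := exists_tendsto_roots
        (fun k => ((hg k).tendsto q₀.1).mono_left hF1) (hgE q₀.1) hw
      obtain ⟨l, hl⟩ := (rootPoly_eval_eq_zero u _).mp (by rw [hu']; exact h0)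
      have hm : ∀ y, ∃ m, z y m = w y l := by
        intro y
        rw [← rootPoly_eval_eq_zero, h.rootPoly_eq]
        exact Polynomial.eval_eq_zero_of_dvd_of_eval_eq_zero (hgf y)
          (by rw [← hw]; exact (rootPoly_eval_eq_zero _ _).mpr ⟨l, rfl⟩)
      choose m hm using hm
      obtain ⟨m₀, hm₀⟩ := (F.map Prod.fst).eventually_const m
      have hvm : v m₀ = q₀.2 := by
        rw [← hl]
        refine tendsto_nhds_unique_of_eventuallyEq ((tendsto_pi_nhds.mp hv) m₀)
          ((tendsto_pi_nhds.mp hu) l) ?_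
        filter_upwards [hm₀] with y hy
        rw [← hm, hy]
      have hvσ : v (σ m₀) = v m₀ := by rw [← hσv, hvm, Complex.conj_ofReal]
      have hq₀ξ : q₀.2 = (z q₀.1 m₀).re := by rw [← hre, hvm, Complex.ofReal_re]
      have hall : ∀ᶠ q in (F : Filter (X × ℝ)), (g q.1).eval (q.2 : ℂ) = 0 := by
        have h1 : ∀ᶠ q in (F : Filter (X × ℝ)), coincidences (z q.1) = coincidences v := hE
        have h2 : ∀ᶠ q in (F : Filter (X × ℝ)), ∀ i, starRingEnd ℂ (z q.1 i) = z q.1 (σ i) := hσ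
        have h3 : ∀ᶠ q in (F : Filter (X × ℝ)), m q.1 = m₀ := hm₀
        filter_upwards [h1, h2, h3, hFK] with q h1 h2 h3 h4
        have h5 : z q.1 m₀ = z q.1 (σ m₀) := by
          have : (m₀, m₀, σ m₀, σ m₀) ∈ coincidences (z q.1) := by
            rw [h1, mem_coincidences, hvσ]
          rw [mem_coincidences] at this
          linear_combination this / 2
        have h6 : z q.1 m₀ = q.2 := by
          rw [hKξ q₀ hq₀ q h4 m₀ hq₀ξ]
          exact (Complex.conj_eq_iff_re.mp ((h2 m₀).trans h5.symm)).symm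
        rw [← hw, rootPoly_eval_eq_zero]
        exact ⟨l, by rw [← hm, h3, h6]⟩
      filter_upwards [hall] with q hq
      rw [decide_eq_decide, eq_true hq, eq_true h0]
    · have : ∀ᶠ q in (F : Filter (X × ℝ)), (g q.1).eval (q.2 : ℂ) ≠ 0 :=
        (hF.trans inf_le_left) (hev.continuousAt.eventually_ne h0)
      filter_upwards [this] with q hq
      rw [decide_eq_decide, eq_false hq, eq_false h0]
  exact decide_eq_decide.mp (hK.constant hcont hq hq')

end RootFamily

end

section SymmetricFunctions

open MvPolynomial

lemma rootPoly_coeff {D : ℕ} (w : Fin D → ℂ) {k : ℕ} (h : k ≤ D) :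
    (rootPoly w).coeff k =
      (-1) ^ (D - k) * ((Finset.univ : Finset (Fin D)).val.map w).esymm (D - k) := by
  have hc : Multiset.card ((Finset.univ : Finset (Fin D)).val.map w) = D := by simp
  have := Multiset.prod_X_sub_C_coeff ((Finset.univ : Finset (Fin D)).val.map w) (hc.symm ▸ h)
  rw [hc, Multiset.map_map] at this
  exact this

/-- A symmetric function of the roots is a polynomial in the coefficients. -/
lemma exists_aeval_coeff_of_isSymmetric {D : ℕ} (Ψ : MvPolynomial (Fin D) ℝ) (hΨ : Ψ.IsSymmetric) :
    ∃ Θ : MvPolynomial (Fin D) ℝ, ∀ w : Fin D → ℂ,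
      aeval w Ψ = aeval (fun i : Fin D => (rootPoly w).coeff i) Θ := by
  obtain ⟨Θ, hΘ⟩ := esymmAlgHom_surjective (σ := Fin D) ℝ (n := D) (by simp) ⟨Ψ, hΨ⟩
  refine ⟨aeval (fun i : Fin D => (-1) ^ (i.val + 1) * X (Fin.rev i)) Θ, fun w => ?_⟩
  have h1 : Ψ = aeval (fun i : Fin D ↦ esymm (Fin D) ℝ (i + 1)) Θ := by
    rw [← esymmAlgHom_apply, hΘ]
  rw [h1, ← AlgHom.comp_apply, ← AlgHom.comp_apply, comp_aeval, comp_aeval]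
  congr 2
  ext1 i
  have hi := i.isLt
  rw [aeval_esymm_eq_multiset_esymm, map_mul, aeval_X, map_pow, map_neg, map_one,
    rootPoly_coeff w (Fin.rev i).isLt.le, Fin.val_rev,
    show D - (D - (i.val + 1)) = i.val + 1 by omega, ← mul_assoc, ← mul_pow]
  simp

lemma natTrailingDegree_congr {R : Type*} [Semiring R] {p q : Polynomial R}
    (h : ∀ r, p.coeff r = 0 ↔ q.coeff r = 0) : p.natTrailingDegree = q.natTrailingDegree := by
  have hs : p.support = q.support := by
    ext r
    rw [Polynomial.mem_support_iff, Polynomial.mem_support_iff, not_iff_not, h]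
  rw [Polynomial.natTrailingDegree, Polynomial.natTrailingDegree, Polynomial.trailingDegree,
    Polynomial.trailingDegree, hs]

/-- The polynomial whose roots are the differences of sums of pairs of the variables. -/
noncomputable def pairDifferencePoly (D : ℕ) (A : Type) [CommRing A] (w : Fin D → A) :
    Polynomial A :=
  ∏ q : Fin D × Fin D × Fin D × Fin D,
    (Polynomial.X - Polynomial.C (w q.1 + w q.2.1 - (w q.2.2.1 + w q.2.2.2)))

lemma pairDifferencePoly_map {D : ℕ} {A B : Type} [CommRing A] [CommRing B] (φ : A →+* B)
    (w : Fin D → A) :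
    (pairDifferencePoly D A w).map φ = pairDifferencePoly D B fun i => φ (w i) := by
  simp [pairDifferencePoly, Polynomial.map_prod]

lemma pairDifferencePoly_comp_perm {D : ℕ} {A : Type} [CommRing A] (w : Fin D → A)
    (σ : Equiv.Perm (Fin D)) :
    pairDifferencePoly D A (fun i => w (σ i)) = pairDifferencePoly D A w :=
  Equiv.prod_comp (σ.prodCongr (σ.prodCongr (σ.prodCongr σ)))
    fun q => (Polynomial.X - Polynomial.C (w q.1 + w q.2.1 - (w q.2.2.1 + w q.2.2.2)))

lemma card_coincidences_eq_natTrailingDegree {D : ℕ} (w : Fin D → ℂ) :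
    (coincidences w).card = (pairDifferencePoly D ℂ w).natTrailingDegree := by
  have h1 : (pairDifferencePoly D ℂ w).roots
      = (Finset.univ : Finset (Fin D × Fin D × Fin D × Fin D)).val.map
          fun q => w q.1 + w q.2.1 - (w q.2.2.1 + w q.2.2.2) := by
    rw [← Polynomial.roots_multiset_prod_X_sub_C (Multiset.map _ _), Multiset.map_map]
    rfl
  rw [← Polynomial.rootMultiplicity_eq_natTrailingDegree', ← Polynomial.count_roots, h1,
    Multiset.count_map, coincidences, Finset.card_def, Finset.filter_val]
  congr 1
  apply Multiset.filter_congr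
  intro q _
  rw [eq_comm (a := (0 : ℂ)), sub_eq_zero]

/-- The number of coincidences among the roots is determined by the vanishing pattern of finitely
many polynomials in the coefficients. -/
lemma exists_finset_determining_coincidences (D : ℕ) :
    ∃ 𝒯 : Finset (MvPolynomial (Fin D) ℝ), ∀ w w' : Fin D → ℂ,
      (∀ Θ ∈ 𝒯, aeval (fun i : Fin D => (rootPoly w).coeff i) Θ = 0 ↔
        aeval (fun i : Fin D => (rootPoly w').coeff i) Θ = 0) →
      (coincidences w).card = (coincidences w').card := by
  classical
  set R := pairDifferencePoly D (MvPolynomial (Fin D) ℝ) X with hR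
  have hsymm : ∀ r, (R.coeff r).IsSymmetric := by
    intro r σ
    have h1 := pairDifferencePoly_map (rename σ : MvPolynomial (Fin D) ℝ →ₐ[ℝ] _).toRingHom X
    have h2 := pairDifferencePoly_comp_perm (X : Fin D → MvPolynomial (Fin D) ℝ) σ
    have h3 : R.map (rename σ : MvPolynomial (Fin D) ℝ →ₐ[ℝ] _).toRingHom = R := by
      rw [hR, h1, ← h2]
      congr 1
      ext1 i
      exact rename_X σ i
    conv_rhs => rw [← h3, Polynomial.coeff_map]
    rfl
  have heval : ∀ (w : Fin D → ℂ) r, (pairDifferencePoly D ℂ w).coeff r = aeval w (R.coeff r) := by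
    intro w r
    have h1 := pairDifferencePoly_map (aeval w : MvPolynomial (Fin D) ℝ →ₐ[ℝ] ℂ).toRingHom X
    have h2 : pairDifferencePoly D ℂ w
        = R.map (aeval w : MvPolynomial (Fin D) ℝ →ₐ[ℝ] ℂ).toRingHom := by
      rw [hR, h1]
      congr 1
      ext1 i
      exact (aeval_X w i).symm
    rw [h2, Polynomial.coeff_map]
    rfl
  choose Θ hΘ using fun r => exists_aeval_coeff_of_isSymmetric (R.coeff r) (hsymm r)
  refine ⟨(Finset.range (R.natDegree + 1)).image Θ, fun w w' h => ?_⟩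
  rw [card_coincidences_eq_natTrailingDegree, card_coincidences_eq_natTrailingDegree]
  apply natTrailingDegree_congr
  intro r
  rw [heval, heval]
  by_cases hr : r < R.natDegree + 1
  · rw [hΘ, hΘ]
    exact h _ (Finset.mem_image_of_mem _ (Finset.mem_range.mpr hr))
  · rw [Polynomial.coeff_eq_zero_of_natDegree_lt (by omega)]
    simp

end SymmetricFunctions

namespace Shear

section
open Polynomial MvPolynomial Ideal Nat RingHom List

variable {k : Type*} [Field k] {n : ℕ} (f : MvPolynomial (Fin (n + 1)) k)
variable (v w : Fin (n + 1) →₀ ℕ)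

variable {f v} in
lemma lt_up (vlt : ∀ i, v i < (2 + f.totalDegree)) : ∀ l ∈ ofFn v, l < (2 + f.totalDegree) := by
  grind

/-- The algebra map fixing `X_0` and sending `X_i` to `X_i + c • X_0 ^ r_i`, with
`r_i = (2 + f.totalDegree) ^ i`, for `i ≠ 0`. -/
noncomputable abbrev T1 (c : k) :
    MvPolynomial (Fin (n + 1)) k →ₐ[k] MvPolynomial (Fin (n + 1)) k :=
  aeval fun i ↦ if i = 0 then X 0 else X i + c • X 0 ^ (2 + f.totalDegree) ^ i.1

lemma t1_comp_t1_neg (c : k) : (T1 f c).comp (T1 f (-c)) = AlgHom.id _ _ := by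
  rw [comp_aeval, ← MvPolynomial.aeval_X_left]
  ext i v
  cases i using Fin.cases <;> simp

/-- `T1 f 1` leads to an algebra equiv `T f`. -/
noncomputable abbrev T := AlgEquiv.ofAlgHom (T1 f 1) (T1 f (-1))
  (t1_comp_t1_neg f 1) (by simpa using t1_comp_t1_neg f (-1))

lemma sum_r_mul_ne (vlt : ∀ i, v i < (2 + f.totalDegree)) (wlt : ∀ i, w i < (2 + f.totalDegree))
    (ne : v ≠ w) :
    ∑ x : Fin (n + 1), (2 + f.totalDegree) ^ x.1 * v x ≠
      ∑ x : Fin (n + 1), (2 + f.totalDegree) ^ x.1 * w x := by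
  intro h
  refine ne <| Finsupp.ext <| congrFun <| ofFn_inj.mp ?_
  apply ofDigits_inj_of_len_eq (Nat.lt_add_right f.totalDegree one_lt_two)
    (by simp) (lt_up vlt) (lt_up wlt)
  simpa only [ofDigits_eq_sum_mapIdx, mapIdx_eq_ofFn, get_ofFn, length_ofFn,
    Fin.val_cast, mul_comm, sum_ofFn] using! h

lemma degreeOf_zero_t {a : k} (ha : a ≠ 0) : ((T f) (monomial v a)).degreeOf 0 =
    ∑ i : Fin (n + 1), ((2 + f.totalDegree) ^ i.1) * v i := by
  rw [← natDegree_finSuccEquiv, monomial_eq, Finsupp.prod_pow v fun a ↦ X a]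
  simp only [Fin.prod_univ_succ, Fin.sum_univ_succ, map_mul, map_prod, map_pow,
    AlgEquiv.ofAlgHom_apply, MvPolynomial.aeval_C, MvPolynomial.aeval_X, if_pos, Fin.succ_ne_zero,
    ite_false, one_smul, map_add, finSuccEquiv_X_zero, finSuccEquiv_X_succ, algebraMap_eq]
  have h (i : Fin n) :
      (Polynomial.C (X (R := k) i) + Polynomial.X ^ (2 + f.totalDegree) ^ i.succ.1) ^ v i.succ ≠ 0 :=
    pow_ne_zero (v i.succ) (leadingCoeff_ne_zero.mp <| by simp [add_comm, leadingCoeff_X_pow_add_C])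
  rw [natDegree_mul (by simp [ha]) (mul_ne_zero (by simp) (Finset.prod_ne_zero_iff.mpr
    (fun i _ ↦ h i))), natDegree_mul (by simp) (Finset.prod_ne_zero_iff.mpr (fun i _ ↦ h i)),
    natDegree_prod _ _ (fun i _ ↦ h i), natDegree_finSuccEquiv, degreeOf_C]
  simpa only [natDegree_pow, zero_add, natDegree_X, mul_one, Fin.val_zero, pow_zero, one_mul,
    add_right_inj] using Finset.sum_congr rfl (fun i _ ↦ by
    rw [add_comm (Polynomial.C _), natDegree_X_pow_add_C, mul_comm])

/-- `T` maps different monomials of `f` to polynomials with different degrees in `X_0`. -/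
lemma degreeOf_t_ne_of_ne (hv : v ∈ f.support) (hw : w ∈ f.support) (ne : v ≠ w) :
    (T f <| monomial v <| coeff v f).degreeOf 0 ≠
    (T f <| monomial w <| coeff w f).degreeOf 0 := by
  rw [degreeOf_zero_t _ _ <| mem_support_iff.mp hv, degreeOf_zero_t _ _ <| mem_support_iff.mp hw]
  refine sum_r_mul_ne f v w (fun i ↦ ?_) (fun i ↦ ?_) ne <;>
  exact lt_of_le_of_lt ((monomial_le_degreeOf i ‹_›).trans (degreeOf_le_totalDegree f i))
    (by lia)

lemma leadingCoeff_finSuccEquiv_t :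
    (finSuccEquiv k n ((T f) ((monomial v) (coeff v f)))).leadingCoeff =
    algebraMap k _ (coeff v f) := by
  rw [monomial_eq, Finsupp.prod_fintype]
  · simp only [map_mul, map_prod, leadingCoeff_mul, leadingCoeff_prod]
    rw [AlgEquiv.ofAlgHom_apply, algHom_C, algebraMap_eq, finSuccEquiv_apply,
      eval₂Hom_C, coe_comp]
    simp only [AlgEquiv.ofAlgHom_apply, Function.comp_apply, leadingCoeff_C, map_pow,
      leadingCoeff_pow, algebraMap_eq]
    have : ∀ j, ((finSuccEquiv k n) ((T1 f) 1 (X j))).leadingCoeff = 1 := fun j ↦ by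
      by_cases h : j = 0
      · simp [h, finSuccEquiv_apply]
      · simp only [aeval_eq_bind₁, bind₁_X_right, if_neg h, one_smul, map_add, map_pow]
        obtain ⟨i, rfl⟩ := Fin.exists_succ_eq.mpr h
        simp [finSuccEquiv_X_succ, finSuccEquiv_X_zero, add_comm]
    simp only [this, one_pow, Finset.prod_const_one, mul_one]
  exact fun i ↦ pow_zero _

/-- `T` maps `f` into some polynomial in `X_0` such that the leading coefficient is invertible. -/
lemma T_leadingcoeff_isUnit (fne : f ≠ 0) :
    IsUnit (finSuccEquiv k n (T f f)).leadingCoeff := by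
  obtain ⟨v, vin, vs⟩ := Finset.exists_max_image f.support
    (fun v ↦ (T f ((monomial v) (coeff v f))).degreeOf 0) (support_nonempty.mpr fne)
  set h := fun w ↦ (MvPolynomial.monomial w) (coeff w f)
  simp only [← natDegree_finSuccEquiv] at vs
  replace vs : ∀ x ∈ f.support \ {v}, (finSuccEquiv k n ((T f) (h x))).degree <
      (finSuccEquiv k n ((T f) (h v))).degree := by
    intro x hx
    obtain ⟨h1, h2⟩ := Finset.mem_sdiff.mp hx
    apply degree_lt_degree <| lt_of_le_of_ne (vs x h1) ?_
    simpa only [natDegree_finSuccEquiv]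
      using degreeOf_t_ne_of_ne f _ _ h1 vin <| ne_of_not_mem_cons h2
  have coeff : (finSuccEquiv k n ((T f) (h v + ∑ x ∈ f.support \ {v}, h x))).leadingCoeff =
      (finSuccEquiv k n ((T f) (h v))).leadingCoeff := by
    simp only [map_add, map_sum]
    rw [add_comm]
    apply leadingCoeff_add_of_degree_lt <| (lt_of_le_of_lt <| degree_sum_le _ _) ?_
    have h2 : h v ≠ 0 := by simpa [h] using mem_support_iff.mp vin
    replace h2 : (finSuccEquiv k n ((T f) (h v))) ≠ 0 := fun eq ↦ h2 <|
      by simpa only [map_eq_zero_iff _ (AlgEquiv.injective _)] using eq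
    exact (Finset.sup_lt_iff <| Ne.bot_lt (fun x ↦ h2 <| degree_eq_bot.mp x)).mpr vs
  nth_rw 2 [← f.support_sum_monomial_coeff]
  rw [Finset.sum_eq_add_sum_sdiff_singleton_of_mem vin h]
  rw [leadingCoeff_finSuccEquiv_t] at coeff
  simpa only [coeff, algebraMap_eq] using (mem_support_iff.mp vin).isUnit.map MvPolynomial.C

end

lemma exists_homeomorph {n : ℕ} (f : MvPolynomial (Fin (n + 1)) ℝ) :
    ∃ e : (Fin (n + 1) → ℝ) ≃ₜ (Fin (n + 1) → ℝ), ∀ (P : MvPolynomial (Fin (n + 1)) ℝ) x,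
      MvPolynomial.eval x (T f P) = MvPolynomial.eval (e x) P := by
  let φ (c : ℝ) (x : Fin (n + 1) → ℝ) : Fin (n + 1) → ℝ := fun i =>
    if i = 0 then x 0 else x i + c * x 0 ^ (2 + f.totalDegree) ^ i.1
  have hφ : ∀ c, Continuous (φ c) := fun c => continuous_pi fun i => by
    by_cases h : i = 0 <;> simp only [φ, h, if_true, if_false] <;> fun_prop
  have hinv : ∀ c x, φ (-c) (φ c x) = x := fun c x => by
    ext1 i
    by_cases h : i = 0
    · simp [φ, h]
    · simp [φ, h]
  refine ⟨⟨⟨φ 1, φ (-1), hinv 1, fun x => by simpa using hinv (-1) x⟩, hφ 1, hφ (-1)⟩,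
    fun P x => ?_⟩
  have h : ((MvPolynomial.eval x).comp (T1 f 1).toRingHom) = MvPolynomial.eval (φ 1 x) := by
    apply MvPolynomial.ringHom_ext
    · intro r
      simp
    · intro i
      by_cases h : i = 0 <;> simp [φ, h]
  exact RingHom.congr_fun h P

end Shear

section Delineation

open MvPolynomial Filter Topology

/-- A conic labelling of affine space by a finite preorder which determines the signs of the given
polynomials. -/
def HasConicLabelling (n : ℕ) (𝒮 : Finset (MvPolynomial (Fin n) ℝ)) : Prop :=
  ∃ (L : Type) (_ : Preorder L) (_ : Finite L) (κ : (Fin n → ℝ) → L), Conic κ ∧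
    ∀ P ∈ 𝒮, ∀ x y, κ x = κ y → SignType.sign (eval x P) = SignType.sign (eval y P)

lemma hasConicLabelling_zero (𝒮 : Finset (MvPolynomial (Fin 0) ℝ)) : HasConicLabelling 0 𝒮 := by
  refine ⟨Unit, inferInstance, inferInstance, fun _ => (), ⟨fun c => ?_, fun x₀ => ?_⟩, ?_⟩
  · simp
  · exact ⟨x₀, rfl, fun _ => x₀, continuousOn_const,
      fun x _ => ⟨Subsingleton.elim _ _, rfl, fun _ _ => rfl⟩⟩
  · intro P _ x y _
    rw [Subsingleton.elim x y]

/-- Evaluation at a real point, as a complex number. -/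
noncomputable abbrev evalC {n : ℕ} (y : Fin n → ℝ) : MvPolynomial (Fin n) ℝ →+* ℂ :=
  Complex.ofRealHom.comp (eval y)

lemma eval_map_evalC {n : ℕ} (P : Polynomial (MvPolynomial (Fin n) ℝ)) (y : Fin n → ℝ) (t : ℝ) :
    (P.map (evalC y)).eval (t : ℂ) = ((P.map (eval y)).eval t : ℝ) := by
  rw [← Polynomial.map_map]
  exact Polynomial.eval_map_apply Complex.ofRealHom t

lemma aeval_evalC {n D : ℕ} (q : Fin D → MvPolynomial (Fin n) ℝ) (Θ : MvPolynomial (Fin D) ℝ)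
    (y : Fin n → ℝ) :
    aeval (fun i => evalC y (q i)) Θ = (eval y (aeval q Θ) : ℝ) := by
  have h : (aeval (fun i => evalC y (q i)) : MvPolynomial (Fin D) ℝ →ₐ[ℝ] ℂ).toRingHom
      = (evalC y).comp (aeval q : MvPolynomial (Fin D) ℝ →ₐ[ℝ] _).toRingHom := by
    apply ringHom_ext
    · intro r
      simp
    · intro i
      simp
  exact RingHom.congr_fun h Θ

lemma continuous_coeff_evalC {n : ℕ} (P : Polynomial (MvPolynomial (Fin n) ℝ)) (k : ℕ) :
    Continuous fun y : Fin n → ℝ => (P.map (evalC y)).coeff k := by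
  simp only [Polynomial.coeff_map]
  exact Complex.continuous_ofReal.comp (continuous_eval _)

lemma continuous_eval_map {n : ℕ} (P : Polynomial (MvPolynomial (Fin n) ℝ)) :
    Continuous fun q : (Fin n → ℝ) × ℝ => (P.map (eval q.1)).eval q.2 := by
  simp only [Polynomial.eval_map, Polynomial.eval₂_eq_sum_range]
  exact continuous_finsetSum _ fun k _ =>
    ((continuous_eval _).comp continuous_fst).mul (continuous_snd.pow _)

/-- Cylindrical decomposition for monic polynomials. -/
lemma exists_conic_cylinder {n : ℕ} (ih : ∀ 𝒮, HasConicLabelling n 𝒮)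
    (𝒬 : Finset (Polynomial (MvPolynomial (Fin n) ℝ))) (h𝒬 : ∀ P ∈ 𝒬, P.Monic) :
    ∃ (L : Type) (_ : Preorder L) (_ : Finite L) (κ : (Fin n → ℝ) × ℝ → L), Conic κ ∧
      ∀ P ∈ 𝒬, ∀ q q', κ q = κ q' → SignType.sign ((P.map (eval q.1)).eval q.2) =
        SignType.sign ((P.map (eval q'.1)).eval q'.2) := by
  classical
  set Q : Polynomial (MvPolynomial (Fin n) ℝ) := Polynomial.X * ∏ P ∈ 𝒬, P with hQ
  have hprod : (∏ P ∈ 𝒬, P).Monic := Polynomial.monic_prod_of_monic _ _ h𝒬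
  have hQm : Q.Monic := Polynomial.monic_X.mul hprod
  obtain ⟨d, hd⟩ : ∃ d, Q.natDegree = d + 1 :=
    ⟨(∏ P ∈ 𝒬, P).natDegree, by
      rw [hQ, Polynomial.monic_X.natDegree_mul hprod, Polynomial.natDegree_X, add_comm]⟩
  let f : (Fin n → ℝ) → Polynomial ℂ := fun y => Q.map (evalC y)
  choose z hz hzm using fun y => exists_sorted_rootPoly_eq (hQm.map (evalC y))
    ((hQm.natDegree_map (evalC y)).trans hd)
  have hf : RootFamily (d + 1) f z :=
    ⟨continuous_coeff_evalC Q, fun y k => by simp [f], hz, hzm⟩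
  obtain ⟨𝒯, h𝒯⟩ := exists_finset_determining_coincidences (d + 1)
  obtain ⟨L, _, _, κ, hκ, hκ𝒮⟩ :=
    ih (𝒯.image fun Θ => aeval (fun i : Fin (d + 1) => Q.coeff i) Θ)
  have hcard : ∀ y y', κ y = κ y' → (coincidences (z y)).card = (coincidences (z y')).card := by
    intro y y' hy
    apply h𝒯
    intro Θ hΘ
    have h1 := hκ𝒮 _ (Finset.mem_image_of_mem _ hΘ) y y' hy
    have h2 : ∀ y, aeval (fun i : Fin (d + 1) => (rootPoly (z y)).coeff i) Θ
        = (eval y (aeval (fun i : Fin (d + 1) => Q.coeff i) Θ) : ℝ) := by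
      intro y
      rw [← aeval_evalC, hz]
      simp only [Polynomial.coeff_map]
    rw [h2, h2, Complex.ofReal_eq_zero, Complex.ofReal_eq_zero, ← sign_eq_zero_iff, h1,
      sign_eq_zero_iff]
  let ξ : ℕ → (Fin n → ℝ) → ℝ := fun i y => (z y ⟨min i d, by omega⟩).re
  have hcyl : Conic (cylLabel κ ξ d) := by
    refine hκ.cylinder (fun i => hf.continuous_re _) (fun y i j hij => hzm y ?_)
      (fun x y hxy i j hij => ?_) d
    · change min i d ≤ min j d
      omega
    · exact (hf.re_eq_iff_of_isPreconnected (hκ.isPreconnected_fibre (κ x))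
        (fun y hy y' hy' => hcard y y' (Eq.trans hy (Eq.symm hy'))) rfl hxy.symm _ _).mp hij
  refine ⟨_, inferInstance, inferInstance, _, hcyl, fun P hP q q' hqq' => ?_⟩
  have hK := hcyl.isPreconnected_fibre (cylLabel κ ξ d q)
  set K := {x | cylLabel κ ξ d x = cylLabel κ ξ d q} with hKdef
  have hqK : q ∈ K := rfl
  have hq'K : q' ∈ K := hqq'.symm
  have hPQ : P ∣ Q := (Finset.dvd_prod_of_mem _ hP).mul_left _
  have hbase : ∀ x ∈ K, ∀ x' ∈ K, cylLabel κ ξ d x = cylLabel κ ξ d x' :=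
    fun x hx x' hx' => Eq.trans hx (Eq.symm hx')
  have hzero : ∀ x ∈ K, ∀ x' ∈ K, (P.map (eval x.1)).eval x.2 = 0 ↔
      (P.map (eval x'.1)).eval x'.2 = 0 := by
    intro x hx x' hx'
    have := hf.eval_eq_zero_of_isPreconnected (g := fun y => P.map (evalC y))
      (continuous_coeff_evalC P) (fun y => (h𝒬 P hP).map _) (fun y => (h𝒬 P hP).natDegree_map _)
      (fun y => Polynomial.map_dvd _ hPQ) hK
      (fun x hx x' hx' => hcard _ _ (congrArg CylLabel.base (hbase x hx x' hx')))
      (fun x hx x' hx' i hi => by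
        have h1 := congrFun (congrArg CylLabel.pos (hbase x hx x' hx')) i
        have h2 : (⟨min i.val d, by omega⟩ : Fin (d + 1)) = i := Fin.ext (by simp; omega)
        simp only [cylLabel, ξ, h2] at h1
        rw [hi, sub_self, sign_zero] at h1
        exact sub_eq_zero.mp (sign_eq_zero_iff.mp h1.symm)) hx hx'
    simpa only [eval_map_evalC, Complex.ofReal_eq_zero] using this
  by_cases h0 : (P.map (eval q.1)).eval q.2 = 0
  · rw [h0, (hzero q hqK q' hq'K).mp h0]
  · refine hK.constant (f := fun q : (Fin n → ℝ) × ℝ =>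
      SignType.sign ((P.map (eval q.1)).eval q.2)) (fun x hx => ?_) hqK hq'K
    have hx0 : (P.map (eval x.1)).eval x.2 ≠ 0 := fun h => h0 ((hzero x hx q hqK).mp h)
    exact (ContinuousAt.comp (f := fun q : (Fin n → ℝ) × ℝ => (P.map (eval q.1)).eval q.2)
      (continuousAt_sign_of_ne_zero hx0) (continuous_eval_map P).continuousAt).continuousWithinAt

/-- Splitting off the first coordinate. -/
def finConsHomeomorph (n : ℕ) : (Fin (n + 1) → ℝ) ≃ₜ (Fin n → ℝ) × ℝ where
  toFun x := (Fin.tail x, x 0)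
  invFun q := Fin.cons q.2 q.1
  left_inv x := Fin.cons_self_tail x
  right_inv q := rfl
  continuous_toFun := by unfold Fin.tail; fun_prop
  continuous_invFun := by
    refine continuous_pi fun i => ?_
    cases i using Fin.cases with
    | zero => exact continuous_snd
    | succ i => exact (continuous_apply i).comp continuous_fst

theorem hasConicLabelling (n : ℕ) (𝒮 : Finset (MvPolynomial (Fin n) ℝ)) :
    HasConicLabelling n 𝒮 := by
  classical
  induction n with
  | zero => exact hasConicLabelling_zero 𝒮
  | succ n ih =>
    set f := ∏ P ∈ 𝒮.filter (· ≠ 0), P with hf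
    have hf0 : f ≠ 0 := Finset.prod_ne_zero_iff.mpr fun P hP => (Finset.mem_filter.mp hP).2
    let φ (P : MvPolynomial (Fin (n + 1)) ℝ) := finSuccEquiv ℝ n (Shear.T f P)
    have hlead : ∀ P ∈ 𝒮, P ≠ 0 → ∃ r : ℝ, r ≠ 0 ∧ (φ P).leadingCoeff = C r := by
      intro P hP hP0
      have h1 : IsUnit (φ f).leadingCoeff := Shear.T_leadingcoeff_isUnit f hf0
      have h2 : P ∣ f := Finset.dvd_prod_of_mem _ (Finset.mem_filter.mpr ⟨hP, hP0⟩)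
      obtain ⟨g, hg⟩ := h2
      have h3 : φ f = φ P * φ g := by
        simp only [φ]
        rw [← map_mul, ← map_mul, ← hg]
      rw [h3, Polynomial.leadingCoeff_mul] at h1
      obtain ⟨r, hr, hr'⟩ := isUnit_iff_eq_C_of_isReduced.mp (isUnit_of_mul_isUnit_left h1)
      exact ⟨r, hr.ne_zero, hr'⟩
    choose! r hr0 hr using hlead
    let 𝒬 := (𝒮.filter (· ≠ 0)).image fun P => Polynomial.C (C (r P)⁻¹) * φ P
    obtain ⟨L, _, _, κ, hκ, hκ𝒬⟩ := exists_conic_cylinder ih 𝒬 (by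
      intro P' hP'
      obtain ⟨P, hP, rfl⟩ := Finset.mem_image.mp hP'
      obtain ⟨hP, hP0⟩ := Finset.mem_filter.mp hP
      rw [Polynomial.Monic, Polynomial.leadingCoeff_mul, Polynomial.leadingCoeff_C, hr P hP hP0,
        ← C_mul, inv_mul_cancel₀ (hr0 P hP hP0), C_1])
    obtain ⟨e, he⟩ := Shear.exists_homeomorph f
    refine ⟨L, inferInstance, inferInstance, _,
      hκ.comp_homeomorph (e.symm.trans (finConsHomeomorph n)), fun P hP x y hxy => ?_⟩
    by_cases hP0 : P = 0
    · rw [hP0, (eval x).map_zero, (eval y).map_zero]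
    have h1 : ∀ x, eval x P = ((φ P).map (eval (Fin.tail (e.symm x)))).eval (e.symm x 0) := by
      intro x
      rw [← eval_eq_eval_mv_eval', Fin.cons_self_tail, he, e.apply_symm_apply]
    have h2 := hκ𝒬 _ (Finset.mem_image_of_mem _ (Finset.mem_filter.mpr ⟨hP, hP0⟩)) _ _ hxy
    simp only [Polynomial.map_mul, Polynomial.map_C, eval_C, Polynomial.eval_mul,
      Polynomial.eval_C] at h2
    rw [sign_mul, sign_mul] at h2
    rw [h1, h1]
    refine mul_left_cancel₀ ?_ h2
    rw [Ne, sign_eq_zero_iff]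
    exact inv_ne_zero (hr0 P hP hP0)

end Delineation

section SemiAlgebraic

open MvPolynomial

variable {ι : Type}

/-- Semialgebraic sets: membership is determined by the signs of finitely many polynomials. -/
def SemiAlg (T : Set (ι → ℝ)) : Prop :=
  ∃ 𝒮 : Finset (MvPolynomial ι ℝ), ∀ x y,
    (∀ P ∈ 𝒮, SignType.sign (eval x P) = SignType.sign (eval y P)) → x ∈ T → y ∈ T

namespace SemiAlg

lemma biInter_finset {κ : Type*} (s : Finset κ) {T : κ → Set (ι → ℝ)} (h : ∀ i ∈ s, SemiAlg (T i)) :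
    SemiAlg {x | ∀ i ∈ s, x ∈ T i} := by
  classical
  choose! 𝒮 h𝒮 using h
  exact ⟨s.biUnion 𝒮, fun x y hxy hx i hi =>
    h𝒮 i hi x y (fun P hP => hxy P (Finset.mem_biUnion.mpr ⟨i, hi, hP⟩)) (hx i hi)⟩

lemma iInter {κ : Type*} [Finite κ] {T : κ → Set (ι → ℝ)} (h : ∀ i, SemiAlg (T i)) :
    SemiAlg {x | ∀ i, x ∈ T i} := by
  have := Fintype.ofFinite κ
  simpa using biInter_finset Finset.univ fun i _ => h i

lemma inter {S T : Set (ι → ℝ)} (hS : SemiAlg S) (hT : SemiAlg T) : SemiAlg (S ∩ T) := by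
  classical
  obtain ⟨A, hA⟩ := hS
  obtain ⟨B, hB⟩ := hT
  exact ⟨A ∪ B, fun x y hxy hx =>
    ⟨hA x y (fun P hP => hxy P (Finset.mem_union_left _ hP)) hx.1,
      hB x y (fun P hP => hxy P (Finset.mem_union_right _ hP)) hx.2⟩⟩

lemma compl {S : Set (ι → ℝ)} (hS : SemiAlg S) : SemiAlg Sᶜ := by
  obtain ⟨A, hA⟩ := hS
  exact ⟨A, fun x y hxy hx hy => hx (hA y x (fun P hP => (hxy P hP).symm) hy)⟩

lemma union {S T : Set (ι → ℝ)} (hS : SemiAlg S) (hT : SemiAlg T) : SemiAlg (S ∪ T) := by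
  rw [← compl_compl (S ∪ T), Set.compl_union]
  exact (hS.compl.inter hT.compl).compl

lemma empty : SemiAlg (∅ : Set (ι → ℝ)) := ⟨∅, fun _ _ _ h => h⟩

lemma eq_zero (P : MvPolynomial ι ℝ) : SemiAlg {x : ι → ℝ | eval x P = 0} :=
  ⟨{P}, fun x y hxy hx => by
    have h := hxy P (Finset.mem_singleton_self P)
    exact sign_eq_zero_iff.mp (h ▸ sign_eq_zero_iff.mpr hx)⟩

lemma pos (P : MvPolynomial ι ℝ) : SemiAlg {x : ι → ℝ | 0 < eval x P} :=
  ⟨{P}, fun x y hxy hx => by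
    have h := hxy P (Finset.mem_singleton_self P)
    exact sign_eq_one_iff.mp (h ▸ sign_eq_one_iff.mpr hx)⟩

theorem finHomology [Finite ι] {T : Set (ι → ℝ)} (hT : SemiAlg T) : FinHomology ↥T := by
  classical
  obtain ⟨𝒮, h𝒮⟩ := hT
  have := Fintype.ofFinite ι
  let e : ι ≃ Fin (Fintype.card ι) := Fintype.equivFin ι
  obtain ⟨L, _, _, κ, hκ, hκ𝒮⟩ := hasConicLabelling _ (𝒮.image (rename e))
  let E : (ι → ℝ) ≃ₜ (Fin (Fintype.card ι) → ℝ) := Homeomorph.piCongrLeft (Y := fun _ => ℝ) e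
  have hE : ∀ x, E x ∘ e = x := by
    intro x
    ext1 i
    exact Equiv.piCongrLeft_apply_apply (fun _ => ℝ) e x i
  have hκ' := hκ.comp_homeomorph E
  have hT : T = (κ ∘ E) ⁻¹' ((κ ∘ E) '' T) := by
    refine Set.Subset.antisymm (Set.subset_preimage_image _ _) ?_
    rintro y ⟨x, hx, hxy⟩
    refine h𝒮 x y (fun P hP => ?_) hx
    have := hκ𝒮 _ (Finset.mem_image_of_mem _ hP) _ _ hxy
    rwa [eval_rename, eval_rename, hE, hE] at this
  rw [hT]
  exact hκ'.finHomology _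

end SemiAlg

/-- Complex-valued functions whose real and imaginary parts are polynomial. -/
structure PolyFun (f : (ι → ℝ) → ℂ) : Prop where
  re : ∃ P : MvPolynomial ι ℝ, ∀ x, eval x P = (f x).re
  im : ∃ P : MvPolynomial ι ℝ, ∀ x, eval x P = (f x).im

namespace PolyFun

variable {f g : (ι → ℝ) → ℂ}

lemma const (c : ℂ) : PolyFun fun _ : ι → ℝ => c :=
  ⟨⟨C c.re, fun _ => eval_C _⟩, ⟨C c.im, fun _ => eval_C _⟩⟩

lemma add (hf : PolyFun f) (hg : PolyFun g) : PolyFun fun x => f x + g x := by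
  obtain ⟨⟨A, hA⟩, ⟨B, hB⟩⟩ := hf
  obtain ⟨⟨A', hA'⟩, ⟨B', hB'⟩⟩ := hg
  exact ⟨⟨A + A', fun x => by simp [hA, hA']⟩, ⟨B + B', fun x => by simp [hB, hB']⟩⟩

lemma mul (hf : PolyFun f) (hg : PolyFun g) : PolyFun fun x => f x * g x := by
  obtain ⟨⟨A, hA⟩, ⟨B, hB⟩⟩ := hf
  obtain ⟨⟨A', hA'⟩, ⟨B', hB'⟩⟩ := hg
  exact ⟨⟨A * A' - B * B', fun x => by simp [hA, hA', hB, hB']⟩,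
    ⟨A * B' + B * A', fun x => by simp [hA, hA', hB, hB']⟩⟩

lemma sub (hf : PolyFun f) (hg : PolyFun g) : PolyFun fun x => f x - g x := by
  have := hf.add ((const (-1)).mul hg)
  simpa [← sub_eq_add_neg] using this

lemma conj (hf : PolyFun f) : PolyFun fun x => starRingEnd ℂ (f x) := by
  obtain ⟨⟨A, hA⟩, ⟨B, hB⟩⟩ := hf
  exact ⟨⟨A, fun x => by simp [hA]⟩, ⟨-B, fun x => by simp [hB]⟩⟩

lemma sum {κ : Type*} (s : Finset κ) {f : κ → (ι → ℝ) → ℂ} (h : ∀ k ∈ s, PolyFun (f k)) :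
    PolyFun fun x => ∑ k ∈ s, f k x := by
  choose! A hA using fun k hk => (h k hk).re
  choose! B hB using fun k hk => (h k hk).im
  refine ⟨⟨∑ k ∈ s, A k, fun x => ?_⟩, ⟨∑ k ∈ s, B k, fun x => ?_⟩⟩
  · rw [map_sum, Complex.re_sum]
    exact Finset.sum_congr rfl fun k hk => hA k hk x
  · rw [map_sum, Complex.im_sum]
    exact Finset.sum_congr rfl fun k hk => hB k hk x

lemma eval {κ : Type*} {v : (ι → ℝ) → κ → ℂ} (hv : ∀ k, PolyFun fun x => v x k)
    (F : MvPolynomial κ ℂ) : PolyFun fun x => MvPolynomial.eval (v x) F := by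
  induction F using MvPolynomial.induction_on with
  | C a => simpa using const a
  | add p q hp hq => simpa using hp.add hq
  | mul_X p k hp => simpa using hp.mul (hv k)

lemma semiAlg_eq_zero (hf : PolyFun f) : SemiAlg {x | f x = 0} := by
  obtain ⟨⟨A, hA⟩, ⟨B, hB⟩⟩ := hf
  have : {x | f x = 0} = {x | MvPolynomial.eval x A = 0} ∩ {x | MvPolynomial.eval x B = 0} := by
    ext x
    simp [hA, hB, Complex.ext_iff]
  rw [this]
  exact (SemiAlg.eq_zero A).inter (SemiAlg.eq_zero B)

lemma semiAlg_eq (hf : PolyFun f) (hg : PolyFun g) : SemiAlg {x | f x = g x} := by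
  simpa only [sub_eq_zero] using (hf.sub hg).semiAlg_eq_zero

end PolyFun

end SemiAlgebraic

/-- A class of subsets closed under unions and intersections all of whose members have finite
homology. -/
structure TameClass {X : Type} [TopologicalSpace X] (𝒞 : Set (Set X)) : Prop where
  finHomology : ∀ Z ∈ 𝒞, FinHomology ↥Z
  empty_mem : ∅ ∈ 𝒞
  inter_mem : ∀ Z ∈ 𝒞, ∀ W ∈ 𝒞, Z ∩ W ∈ 𝒞
  union_mem : ∀ Z ∈ 𝒞, ∀ W ∈ 𝒞, Z ∪ W ∈ 𝒞

lemma eulerChar_empty_set {X : Type} [TopologicalSpace X] : eulerChar ↥(∅ : Set X) = 0 :=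
  eulerChar_of_isEmpty

/-- Inclusion–exclusion for the Euler characteristic of a union of open sets. -/
lemma TameClass.inclusion_exclusion {X I : Type} [TopologicalSpace X] {𝒞 : Set (Set X)}
    (h𝒞 : TameClass 𝒞) (U : I → Set X) (hU : ∀ i, IsOpen (U i)) (hU𝒞 : ∀ i, U i ∈ 𝒞)
    (s : Finset I) (Z : Set X) (hZ : Z ∈ 𝒞) :
    (⋃ i ∈ s, U i) ∩ Z ∈ 𝒞 ∧ eulerChar ↥Z - eulerChar ↥((⋃ i ∈ s, U i) ∩ Z) =
      ∑ J ∈ s.powerset, (-1 : ℤ) ^ J.card * eulerChar ↥((⋂ i ∈ J, U i) ∩ Z) := by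
  classical
  induction s using Finset.induction_on generalizing Z with
  | empty =>
    have h1 : (⋃ i ∈ (∅ : Finset I), U i) ∩ Z = ∅ := by simp
    have h2 : (⋂ i ∈ (∅ : Finset I), U i) ∩ Z = Z := by simp
    rw [h1, Finset.powerset_empty, Finset.sum_singleton, h2, eulerChar_empty_set]
    exact ⟨h𝒞.empty_mem, by simp⟩
  | insert a s ha ih =>
    have hUZ := h𝒞.inter_mem _ (hU𝒞 a) Z hZ
    obtain ⟨h1, h1'⟩ := ih Z hZ
    obtain ⟨h2, h2'⟩ := ih (U a ∩ Z) hUZ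
    have hunion : (⋃ i ∈ insert a s, U i) ∩ Z = (U a ∩ Z) ∪ ((⋃ i ∈ s, U i) ∩ Z) := by
      rw [Finset.set_biUnion_insert, Set.union_inter_distrib_right]
    have hinter : (U a ∩ Z) ∩ ((⋃ i ∈ s, U i) ∩ Z) = (⋃ i ∈ s, U i) ∩ (U a ∩ Z) := by
      ext x
      simp only [Set.mem_inter_iff]
      tauto
    obtain ⟨-, hmv⟩ := mayerVietoris_subset (S := (⋃ i ∈ insert a s, U i) ∩ Z)
      (U := U a ∩ Z) (W := (⋃ i ∈ s, U i) ∩ Z)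
      ⟨U a, hU a, by
        rw [hunion]
        ext x
        simp only [Set.mem_inter_iff, Set.mem_union]
        tauto⟩
      ⟨⋃ i ∈ s, U i, isOpen_biUnion fun i _ => hU i, by
        rw [hunion]
        ext x
        simp only [Set.mem_inter_iff, Set.mem_union]
        tauto⟩
      hunion.symm (h𝒞.finHomology _ hUZ) (h𝒞.finHomology _ h1)
      (by rw [hinter]; exact h𝒞.finHomology _ h2)
    rw [hinter] at hmv
    refine ⟨by rw [hunion]; exact h𝒞.union_mem _ hUZ _ h1, ?_⟩
    rw [Finset.sum_powerset_insert ha, ← h1']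
    have h3 : ∑ J ∈ s.powerset, (-1 : ℤ) ^ (insert a J).card *
        eulerChar ↥((⋂ i ∈ insert a J, U i) ∩ Z)
        = -∑ J ∈ s.powerset, (-1 : ℤ) ^ J.card * eulerChar ↥((⋂ i ∈ J, U i) ∩ (U a ∩ Z)) := by
      rw [← Finset.sum_neg_distrib]
      refine Finset.sum_congr rfl fun J hJ => ?_
      have haJ : a ∉ J := fun h => ha (Finset.mem_powerset.mp hJ h)
      have h4 : (⋂ i ∈ insert a J, U i) ∩ Z = (⋂ i ∈ J, U i) ∩ (U a ∩ Z) := by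
        rw [Finset.set_biInter_insert]
        ext x
        simp only [Set.mem_inter_iff]
        tauto
      rw [Finset.card_insert_of_notMem haJ, pow_succ, h4]
      ring
    rw [h3, ← h2']
    linarith

/-- An invariant function on a finite set with an action of a `p`-group which vanishes at fixed
points has sum divisible by `p`. -/
lemma IsPGroup.dvd_sum_of_invariant {G : Type} [Group G] [Finite G] {p : ℕ} [Fact p.Prime]
    (hG : IsPGroup p G) {α : Type} [Fintype α] [MulAction G α] (F : α → ℤ)
    (hF : ∀ (g : G) a, F (g • a) = F a) (h0 : ∀ a, (∀ g : G, g • a = a) → F a = 0) :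
    (p : ℤ) ∣ ∑ a, F a := by
  classical
  have := Fintype.ofFinite (Quotient (MulAction.orbitRel G α))
  rw [← Finset.sum_fiberwise Finset.univ
    (fun a => (Quotient.mk (MulAction.orbitRel G α) a)) F]
  refine Finset.dvd_sum fun ω _ => ?_
  obtain ⟨b, rfl⟩ := Quotient.exists_rep ω
  have hmem : ∀ a, Quotient.mk (MulAction.orbitRel G α) a = Quotient.mk _ b ↔
      a ∈ MulAction.orbit G b := fun a => Quotient.eq.trans Iff.rfl
  have hconst : ∀ a ∈ Finset.univ.filter
      (fun a => Quotient.mk (MulAction.orbitRel G α) a = Quotient.mk _ b), F a = F b := by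
    intro a ha
    obtain ⟨g, rfl⟩ := (hmem a).mp (Finset.mem_filter.mp ha).2
    exact hF g b
  rw [Finset.sum_congr rfl hconst, Finset.sum_const]
  obtain ⟨n, hn⟩ := hG.card_orbit b
  have hcard : (Finset.univ.filter
      (fun a => Quotient.mk (MulAction.orbitRel G α) a = Quotient.mk _ b)).card = p ^ n := by
    rw [← hn, Nat.card_eq_card_toFinset]
    congr 1
    ext a
    rw [Finset.mem_filter, hmem, Set.mem_toFinset]
    simp
  rw [hcard]
  rcases n with _ | n
  · have hb : F b = 0 := by
      apply h0
      intro g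
      rw [pow_zero] at hn
      have := (Nat.card_eq_one_iff_unique.mp hn).1
      exact congrArg Subtype.val (this.elim ⟨g • b, MulAction.mem_orbit b g⟩
        ⟨b, MulAction.mem_orbit_self b⟩)
    rw [hb, smul_zero]
    exact dvd_zero _
  · rw [nsmul_eq_mul, Nat.cast_pow, pow_succ, mul_assoc]
    exact dvd_mul_of_dvd_right (dvd_mul_right _ _) _

open scoped Pointwise in
/-- If a `p`-group acts on a space covered by a permuted family of tame open sets, none of whose
nonempty invariant subfamilies has a common point, then `p` divides the Euler characteristic. -/
lemma TameClass.dvd_eulerChar {X I G : Type} [TopologicalSpace X] {𝒞 : Set (Set X)}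
    (h𝒞 : TameClass 𝒞) (huniv : Set.univ ∈ 𝒞) [Finite I] [Group G] [Finite G] {p : ℕ}
    [Fact p.Prime] (hG : IsPGroup p G) [MulAction G X] [MulAction G I]
    (hcont : ∀ g : G, Continuous fun x : X => g • x)
    (U : I → Set X) (hU : ∀ i, IsOpen (U i)) (hU𝒞 : ∀ i, U i ∈ 𝒞) (hcover : ⋃ i, U i = Set.univ)
    (hgU : ∀ (g : G) i x, x ∈ U i → g • x ∈ U (g • i))
    (hfix : ∀ i x, ∃ g : G, x ∉ U (g • i)) :
    (p : ℤ) ∣ eulerChar X := by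
  classical
  have := Fintype.ofFinite I
  obtain ⟨-, h⟩ := h𝒞.inclusion_exclusion U hU hU𝒞 Finset.univ Set.univ huniv
  have hW : (⋃ i ∈ Finset.univ, U i) ∩ Set.univ = Set.univ := by simpa using hcover
  rw [hW, sub_self, Finset.powerset_univ, Finset.sum_congr rfl fun J _ => by
    rw [Set.inter_univ]] at h
  have hfix' : ∀ J : Finset I, (∀ g : G, g • J = J) → J.Nonempty → ⋂ i ∈ J, U i = ∅ := by
    intro J hJ ⟨i, hi⟩
    refine Set.eq_empty_of_forall_notMem fun x hx => ?_
    obtain ⟨g, hg⟩ := hfix i x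
    refine hg (Set.mem_iInter₂.mp hx _ ?_)
    rw [← hJ g]
    exact Finset.smul_mem_smul_finset hi
  have htrans : ∀ (g : G) (J : Finset I) x, x ∈ ⋂ i ∈ J, U i → g • x ∈ ⋂ i ∈ g • J, U i := by
    intro g J x hx
    refine Set.mem_iInter₂.mpr fun i hi => ?_
    obtain ⟨j, hj, rfl⟩ := Finset.mem_smul_finset.mp hi
    exact hgU g j x (Set.mem_iInter₂.mp hx j hj)
  have hinv : ∀ (g : G) (J : Finset I),
      eulerChar ↥(⋂ i ∈ g • J, U i) = eulerChar ↥(⋂ i ∈ J, U i) := by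
    intro g J
    refine (eulerChar_congr ?_).symm
    refine ⟨⟨fun x => ⟨g • x.1, htrans g J x.1 x.2⟩, fun x => ⟨g⁻¹ • x.1, ?_⟩, fun x => ?_,
      fun x => ?_⟩, ?_, ?_⟩
    · have := htrans g⁻¹ (g • J) x.1 x.2
      rwa [inv_smul_smul] at this
    · exact Subtype.ext (inv_smul_smul g x.1)
    · exact Subtype.ext (smul_inv_smul g x.1)
    · exact ((hcont g).comp continuous_subtype_val).subtype_mk _
    · exact ((hcont g⁻¹).comp continuous_subtype_val).subtype_mk _
  have hX : eulerChar X = eulerChar ↥(⋂ i ∈ (∅ : Finset I), U i) := by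
    have : ⋂ i ∈ (∅ : Finset I), U i = Set.univ := by simp
    rw [this]
    exact eulerChar_congr (Homeomorph.Set.univ X).symm
  have hsum := hG.dvd_sum_of_invariant
    (fun J : Finset I => if J.Nonempty then (-1 : ℤ) ^ J.card * eulerChar ↥(⋂ i ∈ J, U i) else 0)
    (fun g J => by simp only [Finset.smul_finset_nonempty, Finset.card_smul_finset, hinv])
    (fun J hJ => by
      by_cases hne : J.Nonempty
      · rw [if_pos hne, hfix' J hJ hne, eulerChar_empty_set, mul_zero]
      · rw [if_neg hne])
  have hsplit : ∑ J : Finset I, (-1 : ℤ) ^ J.card * eulerChar ↥(⋂ i ∈ J, U i)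
      = eulerChar X + ∑ J : Finset I,
        if J.Nonempty then (-1 : ℤ) ^ J.card * eulerChar ↥(⋂ i ∈ J, U i) else 0 := by
    rw [← Finset.add_sum_erase _ _ (Finset.mem_univ (∅ : Finset I)),
      ← Finset.add_sum_erase _ (fun J : Finset I => if J.Nonempty then _ else _)
        (Finset.mem_univ (∅ : Finset I)), hX]
    simp only [Finset.card_empty, pow_zero, one_mul, Finset.not_nonempty_empty, if_false, zero_add]
    congr 1
    refine Finset.sum_congr rfl fun J hJ => ?_
    rw [if_pos (Finset.nonempty_iff_ne_empty.mpr (Finset.ne_of_mem_erase hJ))]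
  rw [hsplit] at h
  exact (dvd_add_left hsum).mp (h ▸ dvd_zero _)

section PolynomialAction

open MvPolynomial Topology

lemma tameClass_preimage {V m : Type} [TopologicalSpace V] [Finite m] {φ : V → m → ℝ}
    (hφ : IsEmbedding φ) (hr : SemiAlg (Set.range φ)) :
    TameClass {Z : Set V | ∃ T, SemiAlg T ∧ Z = φ ⁻¹' T} where
  finHomology := by
    rintro Z ⟨T, hT, rfl⟩
    have h := (hT.inter hr).finHomology
    rw [← Set.image_preimage_eq_inter_range] at h
    exact FinHomology.of_homeomorph (hφ.homeomorphImage (φ ⁻¹' T)).symm h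
  empty_mem := ⟨∅, SemiAlg.empty, rfl⟩
  inter_mem := by
    rintro Z ⟨S, hS, rfl⟩ W ⟨T, hT, rfl⟩
    exact ⟨S ∩ T, hS.inter hT, rfl⟩
  union_mem := by
    rintro Z ⟨S, hS, rfl⟩ W ⟨T, hT, rfl⟩
    exact ⟨S ∪ T, hS.union hT, rfl⟩

open scoped Pointwise in
/-- If a finite `p`-group acts without fixed points on a semialgebraic set by quotients of
polynomials, then `p` divides the Euler characteristic. -/
theorem dvd_eulerChar_of_polynomial_action {V m G : Type} [TopologicalSpace V] [Finite m]
    [Group G] [Finite G] [MulAction G V] {p : ℕ} [Fact p.Prime] (hG : IsPGroup p G)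
    {φ : V → m → ℝ} (hφ : IsEmbedding φ) (hr : SemiAlg (Set.range φ))
    (num : G → m → MvPolynomial m ℝ) (den : G → MvPolynomial m ℝ)
    (hden : ∀ g x, 0 < eval (φ x) (den g))
    (hnum : ∀ g x i, φ (g • x) i * eval (φ x) (den g) = eval (φ x) (num g i))
    (hfix : ∀ x : V, ∃ g : G, g • x ≠ x) : (p : ℤ) ∣ eulerChar V := by
  classical
  have := Fintype.ofFinite G
  have h𝒞 := tameClass_preimage hφ hr
  have hquot : ∀ g x i, φ (g • x) i = eval (φ x) (num g i) / eval (φ x) (den g) := fun g x i => by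
    rw [← hnum, mul_div_cancel_right₀ _ (hden g x).ne']
  have hcont : ∀ g : G, Continuous fun x : V => g • x := by
    intro g
    refine hφ.continuous_iff.mpr (continuous_pi fun i => ?_)
    simp only [Function.comp_apply, hquot]
    exact ((continuous_eval _).comp hφ.continuous).div
      ((continuous_eval _).comp hφ.continuous) fun x => (hden g x).ne'
  have hlt : ∀ g g' x i, φ (g • x) i < φ (g' • x) i ↔
      0 < eval (φ x) (num g' i * den g - num g i * den g') := by
    intro g g' x i
    rw [hquot, hquot, div_lt_div_iff₀ (hden g x) (hden g' x)]
    simp only [map_sub, map_mul, sub_pos]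
  let U : Finset G × m → Set V := fun q => {x | (q.1.Nonempty ∧ q.1 ≠ Finset.univ) ∧
    ∀ a ∈ q.1, ∀ b ∉ q.1, φ (b⁻¹ • x) q.2 < φ (a⁻¹ • x) q.2}
  let _ : MulAction G (Finset G × m) :=
    { smul := fun g q => (g • q.1, q.2)
      one_smul := fun q => Prod.ext (one_smul G q.1) rfl
      mul_smul := fun g h q => Prod.ext (mul_smul g h q.1) rfl }
  have hsmul : ∀ (g : G) (q : Finset G × m), g • q = (g • q.1, q.2) := fun _ _ => rfl
  refine h𝒞.dvd_eulerChar ⟨∅ᶜ, SemiAlg.empty.compl, by simp⟩ hG hcont U (fun q => ?_) (fun q => ?_)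
    ?_ (fun g q x hx => ?_) (fun q x => ?_)
  · have : U q = {_x | q.1.Nonempty ∧ q.1 ≠ Finset.univ} ∩
        ⋂ a : G, ⋂ b : G, {x | a ∈ q.1 → b ∉ q.1 → φ (b⁻¹ • x) q.2 < φ (a⁻¹ • x) q.2} := by
      ext x
      simp only [U, Set.mem_inter_iff, Set.mem_iInter, Set.mem_ofPred_eq]
      exact and_congr_right fun _ =>
        ⟨fun h a b ha hb => h a ha b hb, fun h a ha b hb => h a b ha hb⟩
    rw [this]
    refine isOpen_const.inter (isOpen_iInter_of_finite fun a => isOpen_iInter_of_finite fun b => ?_)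
    by_cases ha : a ∈ q.1 <;> by_cases hb : b ∈ q.1 <;>
      simp only [ha, hb, not_true, not_false_iff, true_imp_iff, false_imp_iff, Set.ofPred_true,
        isOpen_univ]
    exact isOpen_lt ((continuous_apply q.2).comp (hφ.continuous.comp (hcont b⁻¹)))
      ((continuous_apply q.2).comp (hφ.continuous.comp (hcont a⁻¹)))
  · by_cases hq : q.1.Nonempty ∧ q.1 ≠ Finset.univ
    · refine ⟨{y | ∀ a ∈ q.1, y ∈ {y | ∀ b ∈ q.1ᶜ, y ∈ {y : m → ℝ | 0 < eval y
        (num a⁻¹ q.2 * den b⁻¹ - num b⁻¹ q.2 * den a⁻¹)}}}, ?_, ?_⟩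
      · exact SemiAlg.biInter_finset _ fun a _ => SemiAlg.biInter_finset _ fun b _ => SemiAlg.pos _
      · ext x
        simp only [U, Set.mem_preimage, Set.mem_ofPred_eq, hq, hlt, Finset.mem_compl, true_and,
          ne_eq, not_false_eq_true]
    · refine ⟨∅, SemiAlg.empty, ?_⟩
      exact Set.eq_empty_of_forall_notMem fun x hx => hq hx.1
  · refine Set.eq_univ_of_forall fun x => Set.mem_iUnion.mpr ?_
    obtain ⟨g, hg⟩ := hfix x
    obtain ⟨i, hi⟩ : ∃ i, φ (g • x) i ≠ φ x i := by
      by_contra! h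
      exact hg (hφ.injective (funext h))
    obtain ⟨a₀, ha₀⟩ := Finite.exists_max fun a : G => φ (a⁻¹ • x) i
    refine ⟨(Finset.univ.filter fun a => φ (a⁻¹ • x) i = φ (a₀⁻¹ • x) i, i),
      ⟨⟨a₀, by simp⟩, ?_⟩, ?_⟩
    · intro h
      have h' : (Finset.univ.filter fun a : G => φ (a⁻¹ • x) i = φ (a₀⁻¹ • x) i) = Finset.univ := h
      have h1 : ∀ a : G, φ (a⁻¹ • x) i = φ (a₀⁻¹ • x) i := fun a =>
        Finset.filter_eq_self.mp h' a (Finset.mem_univ a)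
      have h2 := (h1 g⁻¹).trans (h1 1).symm
      rw [inv_inv, inv_one, one_smul] at h2
      exact hi h2
    · intro a ha b hb
      have ha' := (Finset.mem_filter.mp ha).2
      have hb' : φ (b⁻¹ • x) i ≠ φ (a₀⁻¹ • x) i := fun h =>
        hb (Finset.mem_filter.mpr ⟨Finset.mem_univ _, h⟩)
      change φ (b⁻¹ • x) i < φ (a⁻¹ • x) i
      rw [ha']
      exact lt_of_le_of_ne (ha₀ b) hb'
  · rw [hsmul]
    obtain ⟨⟨h1, h2⟩, h3⟩ := hx
    refine ⟨⟨h1.smul_finset, fun h => h2 ?_⟩, fun a ha b hb => ?_⟩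
    · rw [← inv_smul_smul g q.1]
      exact (congrArg (g⁻¹ • ·) h).trans Finset.smul_finset_univ
    · have := h3 (g⁻¹ • a) (Finset.inv_smul_mem_iff.mpr ha) (g⁻¹ • b)
        (fun h => hb (Finset.inv_smul_mem_iff.mp h))
      simpa [smul_smul] using this
  · by_contra! h
    have h1 := h 1
    rw [one_smul] at h1
    obtain ⟨⟨⟨a₀, ha₀⟩, hne⟩, hx⟩ := h1
    have heq : ∀ g : G, g • q.1 = q.1 := by
      intro g
      by_contra hg
      have hcard : (g • q.1).card = q.1.card := Finset.card_smul_finset g q.1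
      obtain ⟨a, ha, ha'⟩ := Finset.not_subset.mp fun hs =>
        hg (Finset.eq_of_subset_of_card_le hs hcard.ge)
      obtain ⟨b, hb, hb'⟩ := Finset.not_subset.mp fun hs =>
        hg (Finset.eq_of_subset_of_card_le hs hcard.le).symm
      exact lt_asymm ((h g).2 a ha b hb') (hx b hb a ha')
    refine hne (Finset.eq_univ_of_forall fun b => ?_)
    rw [← heq (b * a₀⁻¹)]
    exact Finset.mem_smul_finset.mpr ⟨a₀, ha₀, by simp⟩

end PolynomialAction

section Projective

open MvPolynomial Topology ComplexConjugate

lemma eval_smul_of_isHomogeneous {σ R : Type*} [CommSemiring R] {f : MvPolynomial σ R} {d : ℕ}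
    (hf : f.IsHomogeneous d) (c : R) (v : σ → R) : eval (c • v) f = c ^ d * eval v f := by
  rw [eval_eq, eval_eq, Finset.mul_sum]
  refine Finset.sum_congr rfl fun e he => ?_
  have hd : ∑ i ∈ e.support, e i = d := by
    rw [← hf (mem_support_iff.mp he)]
    simp [Finsupp.weight_apply, Finsupp.sum]
  simp only [Pi.smul_apply, smul_eq_mul, mul_pow, Finset.prod_mul_distrib]
  rw [Finset.prod_pow_eq_pow_sum, hd]
  ring

variable {n : Type}

/-- The real coordinates of a complex matrix. -/
def realCoords (h : n → n → ℂ) (q : n × n × Bool) : ℝ :=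
  bif q.2.2 then (h q.1 q.2.1).im else (h q.1 q.2.1).re

/-- The complex matrix with given real coordinates. -/
def complexEntries (x : n × n × Bool → ℝ) (i j : n) : ℂ := ⟨x (i, j, false), x (i, j, true)⟩

variable [Fintype n]

/-- The squared Hermitian norm of a complex vector. -/
noncomputable def sumNormSq (v : n → ℂ) : ℝ := ∑ k, Complex.normSq (v k)

lemma sumNormSq_pos {v : n → ℂ} (hv : v ≠ 0) : 0 < sumNormSq v := by
  obtain ⟨k, hk⟩ := Function.ne_iff.mp hv
  exact Finset.sum_pos' (fun _ _ => Complex.normSq_nonneg _)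
    ⟨k, Finset.mem_univ k, Complex.normSq_pos.mpr hk⟩

lemma ofReal_sumNormSq (v : n → ℂ) : (sumNormSq v : ℂ) = ∑ k, v k * conj (v k) := by
  simp [sumNormSq, Complex.mul_conj]

lemma sumNormSq_smul (c : ℂ) (v : n → ℂ) :
    sumNormSq (c • v) = Complex.normSq c * sumNormSq v := by
  simp [sumNormSq, Finset.mul_sum]

/-- The matrix of the orthogonal projection onto the line spanned by `v`. -/
noncomputable def lineProjection (v : n → ℂ) (i j : n) : ℂ := v i * conj (v j) / sumNormSq v

lemma lineProjection_smul {c : ℂ} (hc : c ≠ 0) (v : n → ℂ) :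
    lineProjection (c • v) = lineProjection v := by
  funext i j
  have h : (Complex.normSq c : ℂ) ≠ 0 := by simpa using hc
  simp only [lineProjection, sumNormSq_smul, Pi.smul_apply, smul_eq_mul, map_mul,
    Complex.ofReal_mul]
  rw [← mul_div_mul_left (v i * conj (v j)) _ h, Complex.normSq_eq_conj_mul_self]
  ring

lemma lineProjection_col (v : n → ℂ) (j : n) :
    (fun i => lineProjection v i j) = (conj (v j) / sumNormSq v) • v := by
  funext i
  simp only [lineProjection, Pi.smul_apply, smul_eq_mul]
  ring

lemma exists_smul_eq_of_lineProjection_eq {v w : n → ℂ} (hv : v ≠ 0)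
    (h : lineProjection v = lineProjection w) : ∃ a : ℂ, a • w = v := by
  obtain ⟨j, hj⟩ := Function.ne_iff.mp hv
  have hs : (sumNormSq v : ℂ) ≠ 0 := by exact_mod_cast (sumNormSq_pos hv).ne'
  have hc : conj (v j) / (sumNormSq v : ℂ) ≠ 0 := div_ne_zero (by simpa using hj) hs
  refine ⟨(conj (v j) / sumNormSq v)⁻¹ * (conj (w j) / sumNormSq w), ?_⟩
  rw [mul_smul, ← lineProjection_col, ← h, lineProjection_col, inv_smul_smul₀ hc]

lemma lineProjection_symm (v : n → ℂ) (i j : n) :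
    lineProjection v i j = conj (lineProjection v j i) := by
  simp [lineProjection, mul_comm]

lemma lineProjection_mul (v : n → ℂ) (i j k l : n) :
    lineProjection v i j * lineProjection v k l = lineProjection v i l * lineProjection v k j := by
  simp only [lineProjection]
  ring

lemma sum_lineProjection {v : n → ℂ} (hv : v ≠ 0) : ∑ i, lineProjection v i i = 1 := by
  have hs : (sumNormSq v : ℂ) ≠ 0 := by exact_mod_cast (sumNormSq_pos hv).ne'
  simp only [lineProjection]
  rw [← Finset.sum_div, ← ofReal_sumNormSq, div_self hs]

lemma exists_eq_lineProjection {h : n → n → ℂ} (h1 : ∀ i j, h i j = conj (h j i))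
    (h2 : ∀ i j k l, h i j * h k l = h i l * h k j) (h3 : ∑ i, h i i = 1) :
    ∃ v : n → ℂ, v ≠ 0 ∧ lineProjection v = h := by
  obtain ⟨j, hj⟩ : ∃ j, h j j ≠ 0 := by
    by_contra! H
    simp [H] at h3
  refine ⟨fun i => h i j, fun H => hj (congrFun H j), ?_⟩
  have hs : (sumNormSq fun i => h i j : ℂ) = h j j := by
    rw [ofReal_sumNormSq]
    calc ∑ k, h k j * conj (h k j) = ∑ k, h k k * h j j :=
          Finset.sum_congr rfl fun k _ => by rw [← h1 j k, h2]
      _ = h j j := by rw [← Finset.sum_mul, h3, one_mul]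
  funext i k
  simp only [lineProjection]
  rw [hs, ← h1 j k, h2, mul_div_cancel_right₀ _ hj]

lemma PolyFun.complexEntries {n : Type} (i j : n) :
    PolyFun fun x : n × n × Bool → ℝ => complexEntries x i j where
  re := ⟨X (i, j, false), fun _ => eval_X _⟩
  im := ⟨X (i, j, true), fun _ => eval_X _⟩

lemma semiAlg_range_lineProjection :
    SemiAlg (Set.range fun v : {v : n → ℂ // v ≠ 0} => realCoords (lineProjection v.1)) := by
  have h : (Set.range fun v : {v : n → ℂ // v ≠ 0} => realCoords (lineProjection v.1)) =
      ({x | ∀ i, x ∈ {x | ∀ j, x ∈ {x : n × n × Bool → ℝ |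
        complexEntries x i j = conj (complexEntries x j i)}}} ∩
      {x | ∀ i, x ∈ {x | ∀ j, x ∈ {x | ∀ k, x ∈ {x | ∀ l, x ∈ {x : n × n × Bool → ℝ |
        complexEntries x i j * complexEntries x k l =
          complexEntries x i l * complexEntries x k j}}}}}) ∩
      {x | ∑ i, complexEntries x i i = 1} := by
    ext x
    constructor
    · rintro ⟨v, rfl⟩
      exact ⟨⟨lineProjection_symm _, lineProjection_mul _⟩, sum_lineProjection v.2⟩
    · rintro ⟨⟨h1, h2⟩, h3⟩
      obtain ⟨v, hv, h⟩ := exists_eq_lineProjection h1 h2 h3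
      refine ⟨⟨v, hv⟩, funext fun q => ?_⟩
      obtain ⟨i, j, b⟩ := q
      simp only [h]
      cases b <;> rfl
  rw [h]
  refine ((SemiAlg.iInter fun i => SemiAlg.iInter fun j => ?_).inter
    (SemiAlg.iInter fun i => SemiAlg.iInter fun j => SemiAlg.iInter fun k => SemiAlg.iInter
      fun l => ?_)).inter ?_
  · exact (PolyFun.complexEntries i j).semiAlg_eq (PolyFun.complexEntries j i).conj
  · exact ((PolyFun.complexEntries i j).mul (PolyFun.complexEntries k l)).semiAlg_eq
      ((PolyFun.complexEntries i l).mul (PolyFun.complexEntries k j))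
  · exact (PolyFun.sum _ fun i _ => PolyFun.complexEntries i i).semiAlg_eq (PolyFun.const 1)

lemma continuous_realCoords_lineProjection :
    Continuous fun v : {v : n → ℂ // v ≠ 0} => realCoords (lineProjection v.1) := by
  have h : ∀ i j, Continuous fun v : {v : n → ℂ // v ≠ 0} => lineProjection v.1 i j := by
    intro i j
    have hc : ∀ i, Continuous fun v : {v : n → ℂ // v ≠ 0} => v.1 i := fun i =>
      (continuous_apply i).comp continuous_subtype_val
    refine Continuous.div ((hc i).mul (Complex.continuous_conj.comp (hc j)))
      (Complex.continuous_ofReal.comp (continuous_finsetSum _ fun k _ =>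
        Complex.continuous_normSq.comp (hc k))) fun v => ?_
    exact_mod_cast (sumNormSq_pos v.2).ne'
  refine continuous_pi fun q => ?_
  obtain ⟨i, j, b⟩ := q
  cases b
  · exact Complex.continuous_re.comp (h i j)
  · exact Complex.continuous_im.comp (h i j)

/-- The embedding of projective space into a Euclidean space by orthogonal projections. -/
noncomputable def projEmbed {N : ℕ} (x : PP N) :
    Fin (N + 1) × Fin (N + 1) × Bool → ℝ := realCoords (lineProjection x.rep)

lemma projEmbed_mk {N : ℕ} (v : Fin (N + 1) → ℂ) (hv : v ≠ 0) :
    projEmbed (Projectivization.mk ℂ v hv) = realCoords (lineProjection v) := by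
  obtain ⟨a, ha⟩ := Projectivization.exists_smul_eq_mk_rep ℂ v hv
  rw [projEmbed, ← ha, Units.smul_def, lineProjection_smul a.ne_zero]

lemma range_projEmbed (N : ℕ) : Set.range (projEmbed (N := N)) = Set.range
    fun v : {v : Fin (N + 1) → ℂ // v ≠ 0} => realCoords (lineProjection v.1) := by
  ext y
  constructor
  · rintro ⟨x, rfl⟩
    exact ⟨⟨x.rep, x.rep_nonzero⟩, rfl⟩
  · rintro ⟨v, rfl⟩
    exact ⟨_, projEmbed_mk v.1 v.2⟩

lemma continuous_projEmbed (N : ℕ) : Continuous (projEmbed (N := N)) := by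
  refine continuous_coinduced_dom.mpr ?_
  convert continuous_realCoords_lineProjection (n := Fin (N + 1)) using 1
  funext v
  exact projEmbed_mk v.1 v.2

lemma continuous_projectivization_mk (N : ℕ) :
    Continuous fun v : {v : Fin (N + 1) → ℂ // v ≠ 0} => (Projectivization.mk ℂ v.1 v.2 : PP N) :=
  continuous_coinduced_rng

instance compactSpace_PP (N : ℕ) : CompactSpace (PP N) := by
  have h0 : ∀ v : Metric.sphere (0 : Fin (N + 1) → ℂ) 1, v.1 ≠ 0 := fun v =>
    ne_zero_of_mem_unit_sphere v
  let f : Metric.sphere (0 : Fin (N + 1) → ℂ) 1 → PP N := fun v =>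
    Projectivization.mk ℂ v.1 (h0 v)
  have hf : Continuous f :=
    (continuous_projectivization_mk N).comp (continuous_subtype_val.subtype_mk h0)
  have hsurj : Function.Surjective f := by
    intro x
    have hx := norm_ne_zero_iff.mpr x.rep_nonzero
    have hc : ((‖x.rep‖⁻¹ : ℝ) : ℂ) ≠ 0 := by exact_mod_cast inv_ne_zero hx
    refine ⟨⟨((‖x.rep‖⁻¹ : ℝ) : ℂ) • x.rep, ?_⟩, ?_⟩
    · rw [mem_sphere_zero_iff_norm, norm_smul, Complex.norm_real, norm_inv, norm_norm,
        inv_mul_cancel₀ hx]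
    · conv_rhs => rw [← x.mk_rep]
      exact (Projectivization.mk_eq_mk_iff' ℂ _ _ _ _).mpr ⟨_, rfl⟩
  exact hsurj.compactSpace hf

lemma injective_projEmbed (N : ℕ) : Function.Injective (projEmbed (N := N)) := by
  intro x y h
  obtain ⟨a, ha⟩ := exists_smul_eq_of_lineProjection_eq x.rep_nonzero
    (congrArg complexEntries h)
  rw [← x.mk_rep, ← y.mk_rep]
  exact (Projectivization.mk_eq_mk_iff' ℂ _ _ _ _).mpr ⟨a, ha⟩

lemma isEmbedding_projEmbed (N : ℕ) : IsEmbedding (projEmbed (N := N)) :=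
  ((continuous_projEmbed N).isClosedEmbedding (injective_projEmbed N)).isEmbedding

lemma complexEntries_projEmbed_col {N : ℕ} (x : PP N) (j : Fin (N + 1)) :
    (fun i => complexEntries (projEmbed x) i j) =
      (conj (x.rep j) / sumNormSq x.rep : ℂ) • x.rep :=
  lineProjection_col _ _

lemma eval_rep_eq_zero_iff {N : ℕ} {f : MvPolynomial (Fin (N + 1)) ℂ} {d : ℕ}
    (hf : f.IsHomogeneous d) (x : PP N) :
    eval x.rep f = 0 ↔ ∀ j, eval (fun i => complexEntries (projEmbed x) i j) f = 0 := by
  simp only [complexEntries_projEmbed_col, eval_smul_of_isHomogeneous hf]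
  refine ⟨fun h j => by rw [h, mul_zero], fun h => ?_⟩
  obtain ⟨j, hj⟩ := Function.ne_iff.mp x.rep_nonzero
  have hs : (sumNormSq x.rep : ℂ) ≠ 0 := by exact_mod_cast (sumNormSq_pos x.rep_nonzero).ne'
  exact (mul_eq_zero.mp (h j)).resolve_left
    (pow_ne_zero _ (div_ne_zero (by simpa using hj) hs))

lemma ZarClosed.exists_semiAlg {N : ℕ} {C : Set (PP N)} (hC : ZarClosed C) :
    ∃ T, SemiAlg T ∧ C = projEmbed ⁻¹' T := by
  obtain ⟨S, hS, rfl⟩ := hC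
  obtain ⟨s, hsS, hs⟩ := (Submodule.fg_span_iff_fg_span_finset_subset S).mp
    (IsNoetherian.noetherian (Submodule.span (MvPolynomial (Fin (N + 1)) ℂ) S))
  refine ⟨{y | ∀ f ∈ s, y ∈ {y | ∀ j, y ∈ {y | eval (fun i => complexEntries y i j) f = 0}}},
    SemiAlg.biInter_finset _ fun f _ => SemiAlg.iInter fun j =>
      (PolyFun.eval (fun i => PolyFun.complexEntries i j) f).semiAlg_eq_zero, ?_⟩
  ext x
  have h1 : (∀ f ∈ S, eval x.rep f = 0) ↔ ∀ f ∈ s, eval x.rep f = 0 := by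
    refine ⟨fun h f hf => h f (hsS hf), fun h f hf => ?_⟩
    have hle : Submodule.span (MvPolynomial (Fin (N + 1)) ℂ) (s : Set _) ≤
        RingHom.ker (eval x.rep) := Submodule.span_le.mpr h
    exact hle (hs ▸ Submodule.subset_span hf)
  refine h1.trans (forall₂_congr fun f hf => ?_)
  obtain ⟨d, hd⟩ := hS f (hsS hf)
  exact eval_rep_eq_zero_iff hd x

lemma IsQuasiProjective.semiAlg_range {N : ℕ} {V : Set (PP N)} (hV : IsQuasiProjective V) :
    SemiAlg (Set.range fun x : V => projEmbed (x : PP N)) := by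
  obtain ⟨C, D, hC, hD, rfl⟩ := hV
  obtain ⟨S, hS, rfl⟩ := hC.exists_semiAlg
  obtain ⟨T, hT, rfl⟩ := hD.exists_semiAlg
  have h : (Set.range fun x : ↥(projEmbed ⁻¹' S \ projEmbed ⁻¹' T) => projEmbed (x : PP N)) =
      (S ∩ Tᶜ) ∩ Set.range (projEmbed (N := N)) := by
    rw [← Set.image_preimage_eq_inter_range]
    exact (Set.image_eq_range _ _).symm
  rw [h, range_projEmbed]
  exact (hS.inter hT.compl).inter semiAlg_range_lineProjection

/-- An algebraic self-map of a quasi-projective set is a quotient of real polynomials in the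
coordinates of `projEmbed`. -/
lemma IsAlgebraicAction.exists_polynomial {N : ℕ} {V : Set (PP N)} {G : Type} [Group G]
    [MulAction G V] {g : G} (hg : IsAlgebraicAction V g) :
    ∃ (num : Fin (N + 1) × Fin (N + 1) × Bool → MvPolynomial (Fin (N + 1) × Fin (N + 1) × Bool) ℝ)
      (den : MvPolynomial (Fin (N + 1) × Fin (N + 1) × Bool) ℝ),
      (∀ x : V, 0 < eval (projEmbed (x : PP N)) den) ∧
      ∀ (x : V) q, projEmbed ((g • x : V) : PP N) q * eval (projEmbed (x : PP N)) den =
        eval (projEmbed (x : PP N)) (num q) := by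
  obtain ⟨d, A, hA, hx⟩ := hg
  let M : (Fin (N + 1) × Fin (N + 1) × Bool → ℝ) → Fin (N + 1) → Fin (N + 1) → ℂ := fun y k l =>
    ∑ j, eval (fun i => complexEntries y i j) (A k) *
      conj (eval (fun i => complexEntries y i j) (A l))
  have hM : ∀ k l, PolyFun fun y => M y k l := fun k l => PolyFun.sum _ fun j _ =>
    (PolyFun.eval (fun i => PolyFun.complexEntries i j) (A k)).mul
      (PolyFun.eval (fun i => PolyFun.complexEntries i j) (A l)).conj
  choose P hP using fun k l => (hM k l).re
  choose Q hQ using fun k l => (hM k l).im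
  obtain ⟨D, hD⟩ := (PolyFun.sum Finset.univ fun k _ => hM k k).re
  have key : ∀ x : V, ∃ s : ℝ, 0 < s ∧ ∀ k l, M (projEmbed (x : PP N)) k l =
      s * (eval (x : PP N).rep (A k) * conj (eval (x : PP N).rep (A l))) := by
    intro x
    refine ⟨∑ j, Complex.normSq ((conj ((x : PP N).rep j) / sumNormSq (x : PP N).rep) ^ d),
      ?_, fun k l => ?_⟩
    · obtain ⟨j, hj⟩ := Function.ne_iff.mp (x : PP N).rep_nonzero
      have hs : (sumNormSq (x : PP N).rep : ℂ) ≠ 0 := by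
        exact_mod_cast (sumNormSq_pos (x : PP N).rep_nonzero).ne'
      exact Finset.sum_pos' (fun _ _ => Complex.normSq_nonneg _) ⟨j, Finset.mem_univ j,
        Complex.normSq_pos.mpr (pow_ne_zero _ (div_ne_zero (by simpa using hj) hs))⟩
    · rw [Complex.ofReal_sum, Finset.sum_mul]
      refine Finset.sum_congr rfl fun j _ => ?_
      rw [complexEntries_projEmbed_col, eval_smul_of_isHomogeneous (hA k),
        eval_smul_of_isHomogeneous (hA l), map_mul, ← Complex.mul_conj]
      ring
  have hden : ∀ x : V, ∃ s : ℝ, 0 < s ∧ eval (projEmbed (x : PP N)) D =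
      s * sumNormSq (fun k => eval (x : PP N).rep (A k)) ∧ ∀ k l, M (projEmbed (x : PP N)) k l =
      s * (eval (x : PP N).rep (A k) * conj (eval (x : PP N).rep (A l))) := by
    intro x
    obtain ⟨s, hs, h⟩ := key x
    refine ⟨s, hs, ?_, h⟩
    rw [hD]
    simp only [h]
    rw [← Finset.mul_sum, ← ofReal_sumNormSq fun k => eval (x : PP N).rep (A k),
      ← Complex.ofReal_mul, Complex.ofReal_re]
  refine ⟨fun q => bif q.2.2 then Q q.1 q.2.1 else P q.1 q.2.1, D, fun x => ?_, fun x q => ?_⟩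
  · obtain ⟨s, hs, h, -⟩ := hden x
    rw [h]
    exact mul_pos hs (sumNormSq_pos (hx x).1)
  · obtain ⟨s, hs, h, hMx⟩ := hden x
    obtain ⟨hne, hgx⟩ := hx x
    obtain ⟨k, l, b⟩ := q
    have hz : lineProjection (fun k => eval (x : PP N).rep (A k)) k l *
        ((eval (projEmbed (x : PP N)) D : ℝ) : ℂ) = M (projEmbed (x : PP N)) k l := by
      have h0 : (sumNormSq (fun k => eval (x : PP N).rep (A k)) : ℂ) ≠ 0 := by
        exact_mod_cast (sumNormSq_pos hne).ne'
      rw [h, hMx, lineProjection, Complex.ofReal_mul]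
      field_simp
    rw [hgx, projEmbed_mk]
    cases b
    · change _ = eval _ (P k l)
      rw [hP, ← hz, Complex.re_mul_ofReal]
      rfl
    · change _ = eval _ (Q k l)
      rw [hQ, ← hz, Complex.im_mul_ofReal]
      rfl

end Projective

/-- Let a finite `p`-group `G` act algebraically on a quasi-projective
complex variety `V`. If `p` does not divide the topological Euler characteristic `χ(V)`,
then the fixed point set `V^G` is non-empty. -/
theorem stmt_9 {N : ℕ} (V : Set (PP N)) (hV : IsQuasiProjective V)
    (p : ℕ) (hp : p.Prime) (G : Type) [Group G] [Finite G]
    (hpgroup : ∃ k : ℕ, Nat.card G = p ^ k)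
    [MulAction G ↥V] (halg : ∀ g : G, IsAlgebraicAction V g)
    (hchi : ¬ ((p : ℤ) ∣ eulerChar ↥V)) :
    ∃ x : ↥V, ∀ g : G, g • x = x := by
  by_contra! hfix
  have := Fact.mk hp
  obtain ⟨k, hk⟩ := hpgroup
  choose num den hden hnum using fun g => (halg g).exists_polynomial
  exact hchi (dvd_eulerChar_of_polynomial_action (IsPGroup.of_card hk)
    ((isEmbedding_projEmbed N).comp Topology.IsEmbedding.subtypeVal) hV.semiAlg_range num den
    hden hnum hfix)
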